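/- arXiv:1902.02319 — 2 statements merged into one kernel-verified Lean document; each statement's English description precedes it below -/
import Mathlib

section
/- Let Λ = (λ_j)_{j∈ℕ₀} be a lacunary sequence of positive integers with ratio ρ_Λ ∈ (1,2) and λ₀ ≥ 8. Then there exists a set Λ' ⊆ ℕ such that, enumerating Λ̃ := Λ ∪ Λ' ∪ {2^{j+3} : j ∈ ℕ₀} as a strictly increasing sequence (λ̃_k)_{k∈ℕ₀}, one has λ̃₀ = 8 and moreover: (1) for every k ≥ 1 there exists an integer j_k ≥ 4 such that [λ̃_{k−1}, λ̃_k) ⊆ [2^{j_k−1}, 2^{j_k}) and λ̃_k − λ̃_{k−1} ≤ 2^{j_k−3}; and (2) for every N ∈ ℕ, #(Λ̃ ∩ {2^{N−1},…,2^N}) ≤ 9·(#(Λ ∩ {2^{N−1},…,2^N}) + 2). -/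
noncomputable section

/-- The ratio `ρ_Λ = inf_j Λ(j+1)/Λ(j)` of a sequence `Λ`. -/
def ratio (Λ : ℕ → ℕ) : ℝ := ⨅ j : ℕ, (Λ (j+1) : ℝ) / (Λ j : ℝ)

/-- The quarter points of the dyadic blocks `[2^{j+3}, 2^{j+4})`. -/
def dyadicQuarters : Set ℕ := {m | ∃ j i : ℕ, i < 4 ∧ m = (4 + i) * 2 ^ (j + 1)}

theorem two_pow_mem_dyadicQuarters (j : ℕ) : 2 ^ (j + 3) ∈ dyadicQuarters :=
  ⟨j, 0, by norm_num, by ring⟩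

theorem eight_le_of_mem_dyadicQuarters {m : ℕ} (hm : m ∈ dyadicQuarters) : 8 ≤ m := by
  obtain ⟨j, i, -, rfl⟩ := hm
  have h : 1 ≤ 2 ^ j := Nat.one_le_two_pow
  rw [pow_succ]
  nlinarith

/-- Above any `a` in a dyadic block there is a quarter point at distance at most a quarter of the
length of that block, and not beyond its right endpoint. -/
theorem exists_dyadicQuarters_gt {a j : ℕ} (h₁ : 2 ^ (j + 3) ≤ a) (h₂ : a < 2 ^ (j + 4)) :
    ∃ d ∈ dyadicQuarters, a < d ∧ d ≤ 2 ^ (j + 4) ∧ d ≤ a + 2 ^ (j + 1) := by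
  have hq : 0 < 2 ^ (j + 1) := by positivity
  have e₃ : 2 ^ (j + 3) = 4 * 2 ^ (j + 1) := by ring
  have e₄ : 2 ^ (j + 4) = 8 * 2 ^ (j + 1) := by ring
  have h4 : 4 ≤ a / 2 ^ (j + 1) := (Nat.le_div_iff_mul_le hq).2 (by omega)
  have h8 : a / 2 ^ (j + 1) < 8 := (Nat.div_lt_iff_lt_mul hq).2 (by omega)
  have hlt : a < (a / 2 ^ (j + 1) + 1) * 2 ^ (j + 1) := by
    rw [mul_comm]
    exact Nat.lt_mul_div_succ a hq
  have hle : a / 2 ^ (j + 1) * 2 ^ (j + 1) ≤ a := Nat.div_mul_le_self _ _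
  refine ⟨(a / 2 ^ (j + 1) + 1) * 2 ^ (j + 1), ?_, hlt, ?_, by linarith⟩
  · obtain h7 | h7 := Nat.lt_or_ge (a / 2 ^ (j + 1)) 7
    · exact ⟨j, a / 2 ^ (j + 1) - 3, by omega, by congr 1; omega⟩
    · have h : a / 2 ^ (j + 1) = 7 := by omega
      rw [h]
      exact ⟨j + 1, 0, by norm_num, by ring⟩
  · rw [e₄]
    exact Nat.mul_le_mul_right _ h8

theorem dyadicQuarters_inter_Icc_subset (N : ℕ) :
    dyadicQuarters ∩ Set.Icc (2 ^ (N - 1)) (2 ^ N) ⊆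
      (Finset.range 5).image (fun i => 2 ^ (N - 1) + i * 2 ^ (N - 3)) := by
  rintro m ⟨⟨j, i, hi, rfl⟩, hlo, hhi⟩
  have hq : 0 < 2 ^ (j + 1) := by positivity
  have e₃ : 2 ^ (j + 3) = 4 * 2 ^ (j + 1) := by ring
  have e₄ : 2 ^ (j + 4) = 8 * 2 ^ (j + 1) := by ring
  have h₁ : j + 3 ≤ N := (Nat.pow_le_pow_iff_right (a := 2) (by norm_num)).1 (by nlinarith)
  have h₂ : N - 1 < j + 4 := (Nat.pow_lt_pow_iff_right (a := 2) (by norm_num)).1 (by nlinarith)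
  simp only [Finset.coe_image, Finset.coe_range, Set.mem_image, Set.mem_Iio]
  obtain rfl | rfl : N = j + 3 ∨ N = j + 4 := by omega
  · have hi0 : i = 0 := by
      by_contra h
      have : 1 ≤ i := by omega
      nlinarith
    subst hi0
    refine ⟨4, by norm_num, ?_⟩
    simp only [Nat.add_sub_cancel, show j + 3 - 1 = j + 2 by omega]
    ring
  · refine ⟨i, by omega, ?_⟩
    simp only [show j + 4 - 1 = j + 3 by omega, show j + 4 - 3 = j + 1 by omega]
    ring

/-- Refinement lemma: for a lacunary sequence `Λ` of positive integers with ratio in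
`(1,2)` and `λ₀ ≥ 8`, there is a set `Λ' ⊆ ℕ` of positive integers such that, enumerating
`Λ̃ = Λ ∪ Λ' ∪ {2^{j+3}}` as a strictly increasing sequence `e`, one has `e 0 = 8`,
each block `[e(k-1), e k)` lies in a dyadic block `[2^{j_k-1}, 2^{j_k})` with
`e k - e(k-1) ≤ 2^{j_k-3}`, and `#(Λ̃ ∩ {2^{N-1},…,2^N}) ≤ 9(#(Λ ∩ {2^{N-1},…,2^N}) + 2)`
for every `N ≥ 1`. -/
theorem statement8 (Λ : ℕ → ℕ) (hmono : StrictMono Λ) (hpos : 0 < Λ 0)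
    (hrat₁ : 1 < ratio Λ) (hrat₂ : ratio Λ < 2) (h8 : 8 ≤ Λ 0) :
    ∃ Λ' : Set ℕ, (∀ m ∈ Λ', 0 < m) ∧
      ∃ e : ℕ → ℕ, StrictMono e ∧
        Set.range e = Set.range Λ ∪ Λ' ∪ {m : ℕ | ∃ j : ℕ, m = 2 ^ (j + 3)} ∧
        e 0 = 8 ∧
        (∀ k : ℕ, 1 ≤ k →
          ∃ jk : ℕ, 4 ≤ jk ∧
            Set.Ico (e (k - 1)) (e k) ⊆ Set.Ico (2 ^ (jk - 1)) (2 ^ jk) ∧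
            e k - e (k - 1) ≤ 2 ^ (jk - 3)) ∧
        (∀ N : ℕ, 1 ≤ N →
          (Set.range e ∩ Set.Icc (2 ^ (N - 1)) (2 ^ N)).ncard ≤
            9 * ((Set.range Λ ∩ Set.Icc (2 ^ (N - 1)) (2 ^ N)).ncard + 2)) := by
  have hP : {m : ℕ | ∃ j : ℕ, m = 2 ^ (j + 3)} ⊆ dyadicQuarters := by
    rintro m ⟨j, rfl⟩
    exact two_pow_mem_dyadicQuarters j
  have hinf : (Set.range Λ ∪ dyadicQuarters).Infinite :=
    (Set.infinite_range_of_injective hmono.injective).mono Set.subset_union_left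
  have hge : ∀ m ∈ Set.range Λ ∪ dyadicQuarters, 8 ≤ m := by
    rintro m (⟨n, rfl⟩ | hm)
    · exact h8.trans (hmono.monotone (Nat.zero_le n))
    · exact eight_le_of_mem_dyadicQuarters hm
  obtain ⟨e, he, hrange⟩ : ∃ e : ℕ → ℕ, StrictMono e ∧
      Set.range e = Set.range Λ ∪ dyadicQuarters :=
    ⟨Nat.nth (· ∈ Set.range Λ ∪ dyadicQuarters), Nat.nth_strictMono hinf,
      Nat.range_nth_of_infinite hinf⟩
  have he8 : ∀ k, 8 ≤ e k := fun k => hge _ (hrange ▸ Set.mem_range_self k)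
  have hmem : ∀ d ∈ dyadicQuarters, ∃ k, e k = d := fun d hd => by
    have : d ∈ Set.range e := hrange ▸ Or.inr hd
    exact this
  refine ⟨dyadicQuarters, fun m hm => by linarith [eight_le_of_mem_dyadicQuarters hm], e, he,
    ?_, ?_, ?_, ?_⟩
  · rw [hrange, Set.union_assoc, Set.union_eq_left.2 hP]
  · obtain ⟨k, hk⟩ := hmem _ (two_pow_mem_dyadicQuarters 0)
    have := he.monotone (Nat.zero_le k)
    have := he8 0
    omega
  · intro k hk
    have ha := he8 (k - 1)
    have hlog : 3 ≤ Nat.log 2 (e (k - 1)) := Nat.le_log_of_pow_le (by norm_num) (by omega)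
    obtain ⟨j, hj⟩ := Nat.exists_eq_add_of_le' hlog
    have h₁ : 2 ^ (j + 3) ≤ e (k - 1) := hj ▸ Nat.pow_log_le_self 2 (by omega)
    have h₂ : e (k - 1) < 2 ^ (j + 4) := by
      have := Nat.lt_pow_succ_log_self (b := 2) (by norm_num) (e (k - 1))
      rwa [hj] at this
    obtain ⟨d, hd, had, hd₁, hd₂⟩ := exists_dyadicQuarters_gt h₁ h₂
    obtain ⟨m, rfl⟩ := hmem d hd
    have hkm : e k ≤ e m := he.monotone (by have := he.lt_iff_lt.1 had; omega)
    refine ⟨j + 4, by omega, Set.Ico_subset_Ico h₁ (hkm.trans hd₁), ?_⟩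
    rw [show j + 4 - 3 = j + 1 by omega]
    omega
  · intro N _
    have hsub := dyadicQuarters_inter_Icc_subset N
    have hcard : (dyadicQuarters ∩ Set.Icc (2 ^ (N - 1)) (2 ^ N)).ncard ≤ 5 := by
      refine (Set.ncard_le_ncard hsub (Finset.finite_toSet _)).trans ?_
      rw [Set.ncard_coe_finset]
      exact Finset.card_image_le.trans (by simp)
    rw [hrange, Set.union_inter_distrib_right]
    have := Set.ncard_union_le (Set.range Λ ∩ Set.Icc (2 ^ (N - 1)) (2 ^ N))
      (dyadicQuarters ∩ Set.Icc (2 ^ (N - 1)) (2 ^ N))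
    omega

end
end

section
/- There exists an absolute constant C > 0 such that for every lacunary sequence Λ = (λ_j)_{j∈ℕ₀} of positive integers with ratio ρ_Λ ∈ (1,2) and every trigonometric polynomial f on 𝕋, one has ‖S^{(Λ)}(f)‖_{L^{1,∞}(𝕋)} ≤ C (ρ_Λ − 1)^{-1/2} [1 + (2π)^{-1}∫_𝕋 |f(x)| log^{1/2}(e + |f(x)|) dx]. -/
open MeasureTheory Real Complex
open scoped ENNReal

noncomputable section

instance : Fact (0 < 2 * π) := ⟨by positivity⟩

/-- The torus `ℝ/(2πℤ)`. -/
abbrev Tor := AddCircle (2 * π)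

/-- The normalized Haar measure `(2π)⁻¹ dx` on the torus. -/
def haarT : Measure Tor := AddCircle.haarAddCircle

/-- The `j`-th Littlewood–Paley projection associated with the sequence `Λ`:
`Δ₀ f = Σ_{|n| < Λ 0} f̂(n) eⁿ` and, for `j ≥ 1`,
`Δ_j f = Σ_{Λ(j-1) ≤ |n| < Λ j} f̂(n) eⁿ`. -/
def LPproj (Λ : ℕ → ℕ) (j : ℕ) (f : Tor → ℂ) (x : Tor) : ℂ :=
  if j = 0 then
    ∑ n ∈ Finset.Ioo (-(Λ 0 : ℤ)) (Λ 0 : ℤ), fourierCoeff f n * fourier n x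
  else
    ∑ n ∈ (Finset.Ico ((Λ (j-1) : ℤ)) ((Λ j : ℤ)) ∪
        Finset.Ioc (-(Λ j : ℤ)) (-(Λ (j-1) : ℤ))),
      fourierCoeff f n * fourier n x

/-- The Littlewood–Paley square function `S^{(Λ)}(f) = (Σ_j |Δ_j f|²)^{1/2}`. -/
def LPsq (Λ : ℕ → ℕ) (f : Tor → ℂ) (x : Tor) : ℝ :=
  Real.sqrt (∑' j : ℕ, ‖LPproj Λ j f x‖ ^ 2)

/-- The weak-`L¹` quasinorm `sup_{α>0} α·|{|g| > α}|` with respect to the normalized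
measure on the torus. -/
def wkNorm1 (g : Tor → ℝ) : ℝ≥0∞ :=
  ⨆ (α : ℝ) (_ : 0 < α), ENNReal.ofReal α * haarT {x | α < |g x|}

namespace LPWeak

instance : IsProbabilityMeasure haarT := by unfold haarT; infer_instance
instance : haarT.IsAddHaarMeasure := by unfold haarT; infer_instance

lemma fourier_add_arg (n : ℤ) (x y : Tor) :
    (fourier n (x + y) : ℂ) = fourier n x * fourier n y := by
  simp [fourier_apply, smul_add, AddCircle.toCircle_add]

lemma fourier_neg_arg (n : ℤ) (x : Tor) : (fourier n (-x) : ℂ) = fourier (-n) x := by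
  simp [fourier_apply]

lemma fourier_sub_arg (n : ℤ) (x y : Tor) :
    (fourier n (x - y) : ℂ) = fourier n x * fourier (-n) y := by
  rw [sub_eq_add_neg, fourier_add_arg, fourier_neg_arg]

lemma norm_fourier_apply (n : ℤ) (x : Tor) : ‖(fourier n x : ℂ)‖ = 1 := by
  rw [fourier_apply]; exact Circle.norm_coe _

lemma fourier_mul_fourier_neg (n : ℤ) (x : Tor) :
    (fourier n x : ℂ) * fourier (-n) x = 1 := by
  rw [← fourier_add]; simp

lemma fourier_natCast (a : ℕ) (x : Tor) : (fourier (a : ℤ) x : ℂ) = (fourier 1 x : ℂ) ^ a := by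
  induction a with
  | zero => simp
  | succ a ih => rw [Nat.cast_succ, fourier_add, ih, pow_succ]

/-- The chordal distance on the torus. -/
def chord (x y : Tor) : ℝ := ‖(fourier 1 x : ℂ) - fourier 1 y‖

lemma chord_nonneg (x y : Tor) : 0 ≤ chord x y := norm_nonneg _

lemma chord_triangle (x y z : Tor) : chord x z ≤ chord x y + chord y z :=
  norm_sub_le_norm_sub_add_norm_sub _ _ _

lemma chord_le_two (x y : Tor) : chord x y ≤ 2 := by
  refine (norm_sub_le _ _).trans ?_
  rw [norm_fourier_apply, norm_fourier_apply]; norm_num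

lemma chord_sub (x y : Tor) : chord x y = ‖1 - (fourier 1 (x - y) : ℂ)‖ := by
  have h : (1 : ℂ) - fourier 1 (x - y) = (fourier 1 y - fourier 1 x) * fourier (-1) y := by
    rw [fourier_sub_arg, sub_mul, fourier_mul_fourier_neg]
  rw [h, norm_mul, norm_fourier_apply, mul_one, chord, norm_sub_rev]

lemma continuous_chord (c : Tor) : Continuous fun x => chord x c := by
  unfold chord; fun_prop

lemma norm_pow_sub_pow_le (a : ℕ) {z w : ℂ} (hz : ‖z‖ = 1) (hw : ‖w‖ = 1) :
    ‖z ^ a - w ^ a‖ ≤ a * ‖z - w‖ := by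
  induction a with
  | zero => simp
  | succ a ih =>
    have h : z ^ (a + 1) - w ^ (a + 1) = z * (z ^ a - w ^ a) + (z - w) * w ^ a := by ring
    rw [h]
    refine (norm_add_le _ _).trans ?_
    rw [norm_mul, norm_mul, norm_pow, hz, hw, one_pow]
    push_cast
    linarith

lemma norm_fourier_sub_le (a : ℕ) (x y : Tor) :
    ‖(fourier (a : ℤ) x : ℂ) - fourier (a : ℤ) y‖ ≤ a * chord x y := by
  rw [fourier_natCast, fourier_natCast]
  exact norm_pow_sub_pow_le a (norm_fourier_apply 1 x) (norm_fourier_apply 1 y)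

lemma norm_fourier_neg_sub_le (a : ℕ) (x y : Tor) :
    ‖(fourier (-(a : ℤ)) x : ℂ) - fourier (-(a : ℤ)) y‖ ≤ a * chord x y := by
  rw [fourier_neg, fourier_neg, ← map_sub, Complex.norm_conj]
  exact norm_fourier_sub_le a x y

/-- The coordinate of a point of the torus in `[0, 1)`. -/
def coord (x : Tor) : ℝ := (AddCircle.equivIco (2 * π) 0 x : ℝ) / (2 * π)

lemma coord_nonneg (x : Tor) : 0 ≤ coord x :=
  div_nonneg (AddCircle.equivIco (2 * π) 0 x).2.1 (by positivity)

lemma coord_lt_one (x : Tor) : coord x < 1 := by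
  rw [coord, div_lt_one (by positivity)]
  simpa using (AddCircle.equivIco (2 * π) 0 x).2.2

lemma mk_coord (x : Tor) : ((2 * π * coord x : ℝ) : Tor) = x := by
  have h : 2 * π * coord x = (AddCircle.equivIco (2 * π) 0 x : ℝ) := by
    unfold coord; field_simp
  rw [h]; exact AddCircle.coe_equivIco

lemma coord_mk {t : ℝ} (h0 : 0 ≤ t) (h1 : t < 1) : coord ((2 * π * t : ℝ) : Tor) = t := by
  have ht : 2 * π * t ∈ Set.Ico (0:ℝ) (0 + 2 * π) :=
    ⟨by positivity, by nlinarith [Real.pi_pos]⟩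
  rw [coord, AddCircle.equivIco_coe_eq ht]
  field_simp

lemma measurable_coord : Measurable coord :=
  (measurable_subtype_coe.comp
    (AddCircle.measurableEquivIco (2 * π) 0).measurable).div_const _

lemma fourier_one_eq_exp (x : Tor) :
    (fourier 1 x : ℂ) = Complex.exp (((2 * π * coord x : ℝ) : ℂ) * I) := by
  conv_lhs => rw [← mk_coord x]
  rw [fourier_coe_apply]
  congr 1
  have : (π : ℂ) ≠ 0 := by exact_mod_cast Real.pi_ne_zero
  push_cast
  field_simp

lemma chord_le_coord (x y : Tor) : chord x y ≤ 2 * π * |coord x - coord y| := by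
  rw [chord, fourier_one_eq_exp, fourier_one_eq_exp]
  have h : Complex.exp (((2 * π * coord x : ℝ) : ℂ) * I) -
      Complex.exp (((2 * π * coord y : ℝ) : ℂ) * I) =
      Complex.exp (((2 * π * coord y : ℝ) : ℂ) * I) *
        (Complex.exp (I * ((2 * π * coord x - 2 * π * coord y : ℝ) : ℂ)) - 1) := by
    rw [mul_sub, ← Complex.exp_add, mul_one]
    congr 2
    push_cast; ring
  rw [h, norm_mul, Complex.norm_exp_ofReal_mul_I, one_mul]
  refine (Real.norm_exp_I_mul_ofReal_sub_one_le).trans ?_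
  rw [Real.norm_eq_abs, ← mul_sub, abs_mul, abs_of_pos (by positivity)]

lemma haarT_eq : haarT = (ENNReal.ofReal (2 * π))⁻¹ • (volume : Measure Tor) := by
  have h := AddCircle.volume_eq_smul_haarAddCircle (T := 2 * π)
  have h0 : ENNReal.ofReal (2 * π) ≠ 0 := by
    rw [Ne, ENNReal.ofReal_eq_zero, not_le]; positivity
  rw [h, smul_smul, ENNReal.inv_mul_cancel h0 ENNReal.ofReal_ne_top, one_smul]
  rfl

lemma haarT_coord_Ico {u v : ℝ} (hu : 0 ≤ u) (hv : v ≤ 1) :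
    haarT (coord ⁻¹' Set.Ico u v) = ENNReal.ofReal (v - u) := by
  have hm : MeasurableSet (coord ⁻¹' Set.Ico u v) := measurable_coord measurableSet_Ico
  have key : volume (coord ⁻¹' Set.Ico u v) = ENNReal.ofReal (2 * π) * ENNReal.ofReal (v - u) := by
    rw [AddCircle.add_projection_respects_measure (2 * π) 0 hm,
      ← ENNReal.ofReal_mul (by positivity)]
    have e : ENNReal.ofReal (2 * π * (v - u)) = ENNReal.ofReal (2 * π * v - 2 * π * u) := by
      congr 1; ring
    rw [e]
    have hpre : ∀ t ∈ Set.Ioo (0:ℝ) (2 * π), coord (t : Tor) = t / (2 * π) := by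
      intro t ht
      have := coord_mk (t := t / (2 * π)) (div_nonneg ht.1.le (by positivity))
        ((div_lt_one (by positivity)).2 ht.2)
      rwa [mul_div_cancel₀ _ (by positivity)] at this
    apply le_antisymm
    · rw [← Real.volume_Icc]
      calc _ ≤ volume (Set.Icc (2 * π * u) (2 * π * v) ∪ {2 * π}) := by
            apply measure_mono
            rintro t ⟨ht, ht1, ht2⟩
            rw [zero_add] at ht2
            rcases ht2.lt_or_eq with h | h
            · left
              have ht' : coord (t : Tor) ∈ Set.Ico u v := ht
              rw [hpre t ⟨ht1, h⟩] at ht'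
              have h2 := ht'.1
              have h3 := ht'.2
              rw [le_div_iff₀ (by positivity)] at h2
              rw [div_lt_iff₀ (by positivity)] at h3
              constructor <;> linarith
            · right; exact h
        _ ≤ _ := (measure_union_le _ _).trans (by simp)
    · rw [← Real.volume_Ioo]
      apply measure_mono
      rintro t ⟨ht1, ht2⟩
      have h1 : 0 < t := lt_of_le_of_lt (by positivity) ht1
      have h2 : t < 2 * π := lt_of_lt_of_le ht2 (by nlinarith [Real.pi_pos])
      refine ⟨?_, h1, by linarith⟩
      change coord (t : Tor) ∈ Set.Ico u v
      rw [hpre t ⟨h1, h2⟩]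
      constructor
      · rw [le_div_iff₀ (by positivity)]; linarith
      · rw [div_lt_iff₀ (by positivity)]; linarith
  have h0 : ENNReal.ofReal (2 * π) ≠ 0 := by
    rw [Ne, ENNReal.ofReal_eq_zero, not_le]; positivity
  rw [haarT_eq, Measure.smul_apply, key, smul_eq_mul, ← mul_assoc,
    ENNReal.inv_mul_cancel h0 ENNReal.ofReal_ne_top, one_mul]

lemma coord_of_chord_zero_le {x : Tor} {s : ℝ} (h : chord x 0 ≤ s) :
    coord x ≤ s / 4 ∨ 1 - s / 4 ≤ coord x := by
  have h1 : chord x 0 = 2 * Real.sin (π * coord x) := by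
    have hs : 0 ≤ Real.sin (π * coord x) :=
      Real.sin_nonneg_of_nonneg_of_le_pi (mul_nonneg Real.pi_pos.le (coord_nonneg x))
        (by nlinarith [coord_lt_one x, Real.pi_pos])
    rw [chord, fourier_eval_zero, fourier_one_eq_exp, mul_comm,
      Complex.norm_exp_I_mul_ofReal_sub_one]
    rw [show 2 * π * coord x / 2 = π * coord x by ring]
    simp [abs_of_nonneg hs]
  rw [h1] at h
  have hx := coord_nonneg x
  have hx1 := coord_lt_one x
  rcases le_total (coord x) (1 / 2) with h2 | h2
  · left
    have := Real.mul_le_sin (x := π * coord x) (by positivity) (by nlinarith [Real.pi_pos])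
    rw [← mul_assoc, div_mul_cancel₀ _ Real.pi_ne_zero] at this
    linarith
  · right
    have := Real.mul_le_sin (x := π * (1 - coord x))
      (mul_nonneg Real.pi_pos.le (by linarith)) (by nlinarith [Real.pi_pos])
    rw [← mul_assoc, div_mul_cancel₀ _ Real.pi_ne_zero,
      show π * (1 - coord x) = π - π * coord x by ring, Real.sin_pi_sub] at this
    linarith

lemma haarT_chord_le (c : Tor) {s : ℝ} (hs : 0 < s) :
    haarT {x | chord x c ≤ s} ≤ ENNReal.ofReal s := by
  have h1 : haarT {x | chord x c ≤ s} = haarT {x | chord x 0 ≤ s} := by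
    have : {x | chord x c ≤ s} = (fun x => x + (-c)) ⁻¹' {x | chord x 0 ≤ s} := by
      ext x
      change chord x c ≤ s ↔ chord (x + -c) 0 ≤ s
      rw [chord_sub x c, chord_sub _ 0, sub_zero, ← sub_eq_add_neg x c]
    rw [this, measure_preimage_add_right]
  rw [h1]
  rcases le_total 1 s with h | h
  · exact prob_le_one.trans (by simpa using h)
  have h3 : haarT {x | chord x 0 ≤ s} ≤
      haarT (coord ⁻¹' Set.Ico 0 (s / 2) ∪ coord ⁻¹' Set.Ico (1 - s / 2) 1) := by
    apply measure_mono
    intro x hx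
    rcases coord_of_chord_zero_le hx with h | h
    · left; exact ⟨coord_nonneg x, by linarith⟩
    · right; exact ⟨by linarith, coord_lt_one x⟩
  refine h3.trans ((measure_union_le _ _).trans ?_)
  rw [haarT_coord_Ico le_rfl (by linarith), haarT_coord_Ico (by linarith) le_rfl,
    ← ENNReal.ofReal_add (by linarith) (by linarith)]
  apply ENNReal.ofReal_le_ofReal; linarith

/-- Bounded strongly measurable functions. -/
def BddMeas {X E : Type*} [MeasurableSpace X] [NormedAddCommGroup E] (h : X → E) : Prop :=
  StronglyMeasurable h ∧ ∃ B : ℝ, ∀ x, ‖h x‖ ≤ B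

namespace BddMeas
variable {X E : Type*} [MeasurableSpace X] [NormedAddCommGroup E]

lemma integrable {μ : Measure X} [IsFiniteMeasure μ] {h : X → E} (hh : BddMeas h) :
    Integrable h μ := by
  obtain ⟨hm, B, hB⟩ := hh
  exact Integrable.of_bound hm.aestronglyMeasurable B (Filter.Eventually.of_forall hB)

lemma memLp {μ : Measure X} [IsFiniteMeasure μ] {h : X → E} (hh : BddMeas h) (p : ℝ≥0∞) :
    MemLp h p μ := by
  obtain ⟨hm, B, hB⟩ := hh
  exact MemLp.of_bound hm.aestronglyMeasurable B (Filter.Eventually.of_forall hB)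

lemma const (c : E) : BddMeas (fun _ : X => c) := ⟨stronglyMeasurable_const, ‖c‖, fun _ => le_rfl⟩

lemma add {f g : X → E} (hf : BddMeas f) (hg : BddMeas g) : BddMeas (fun x => f x + g x) := by
  obtain ⟨hm, B, hB⟩ := hf
  obtain ⟨hm', B', hB'⟩ := hg
  exact ⟨hm.add hm', B + B', fun x => (norm_add_le _ _).trans (add_le_add (hB x) (hB' x))⟩

lemma neg {f : X → E} (hf : BddMeas f) : BddMeas (fun x => -f x) := by
  obtain ⟨hm, B, hB⟩ := hf
  exact ⟨hm.neg, B, fun x => by rw [norm_neg]; exact hB x⟩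

lemma sub {f g : X → E} (hf : BddMeas f) (hg : BddMeas g) : BddMeas (fun x => f x - g x) := by
  simpa only [sub_eq_add_neg] using hf.add hg.neg

lemma sum {ι : Type*} (s : Finset ι) {f : ι → X → E} (hf : ∀ i ∈ s, BddMeas (f i)) :
    BddMeas (fun x => ∑ i ∈ s, f i x) := by
  classical
  induction s using Finset.induction_on with
  | empty => simpa using const (X := X) (0 : E)
  | insert a s ha ih =>
    simp only [Finset.sum_insert ha]
    exact (hf a (by simp)).add (ih fun i hi => hf i (by simp [hi]))

lemma indicator {f : X → E} (hf : BddMeas f) {s : Set X} (hs : MeasurableSet s) :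
    BddMeas (s.indicator f) := by
  obtain ⟨hm, B, hB⟩ := hf
  exact ⟨hm.indicator hs, B, fun x => (norm_indicator_le_norm_self f x).trans (hB x)⟩

lemma norm {f : X → E} (hf : BddMeas f) : BddMeas (fun x => ‖f x‖) := by
  obtain ⟨hm, B, hB⟩ := hf
  exact ⟨hm.norm, B, fun x => by rw [norm_norm]; exact hB x⟩

lemma mul {R : Type*} [NormedRing R] {f g : X → R} (hf : BddMeas f) (hg : BddMeas g) :
    BddMeas (fun x => f x * g x) := by
  obtain ⟨hm, B, hB⟩ := hf
  obtain ⟨hm', B', hB'⟩ := hg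
  exact ⟨hm.mul hm', B * B', fun x => (norm_mul_le _ _).trans
    (mul_le_mul (hB x) (hB' x) (norm_nonneg _) ((norm_nonneg _).trans (hB x)))⟩

lemma sq_norm {f : X → E} (hf : BddMeas f) : BddMeas (fun x => ‖f x‖ ^ 2) := by
  simpa only [pow_two] using hf.norm.mul hf.norm

lemma of_continuous {Y : Type*} [TopologicalSpace Y] [CompactSpace Y] [MeasurableSpace Y]
    [OpensMeasurableSpace Y] [TopologicalSpace.PseudoMetrizableSpace Y] {f : Y → E}
    (hf : Continuous f) : BddMeas f := by
  let _ := TopologicalSpace.pseudoMetrizableSpacePseudoMetric Y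
  have : SecondCountableTopologyEither Y E := inferInstance
  refine ⟨hf.stronglyMeasurable, ?_⟩
  obtain ⟨B, hB⟩ := isCompact_univ.exists_bound_of_continuousOn hf.continuousOn
  exact ⟨B, fun x => hB x (Set.mem_univ x)⟩

lemma comp {Y : Type*} [MeasurableSpace Y] {f : X → E} (hf : BddMeas f) {g : Y → X}
    (hg : Measurable g) : BddMeas (fun y => f (g y)) := by
  obtain ⟨hm, B, hB⟩ := hf
  exact ⟨hm.comp_measurable hg, B, fun y => hB _⟩

lemma integral_prod {Y : Type*} [MeasurableSpace Y] [NormedSpace ℝ E] {μ : Measure Y}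
    [IsProbabilityMeasure μ]
    {f : X × Y → E} (hf : BddMeas f) : BddMeas (fun x => ∫ y, f (x, y) ∂μ) := by
  obtain ⟨hm, B, hB⟩ := hf
  refine ⟨hm.integral_prod_right', B, fun x => ?_⟩
  have := norm_integral_le_of_norm_le_const (μ := μ) (f := fun y => f (x, y)) (C := B)
    (Filter.Eventually.of_forall fun y => hB _)
  simpa using this

end BddMeas

lemma bddMeas_fourier (n : ℤ) : BddMeas (fun x : Tor => (fourier n x : ℂ)) :=
  BddMeas.of_continuous (ContinuousMap.continuous _)

/-- The Abel-regularised Cauchy kernel `(1 - r e^{it})⁻¹`. -/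
def cauchyKer (r : ℝ) (t : Tor) : ℂ := (1 - r * fourier 1 t)⁻¹

section kernel
variable {r : ℝ}

lemma one_sub_le_norm (h0 : 0 ≤ r) (t : Tor) : 1 - r ≤ ‖1 - r * (fourier 1 t : ℂ)‖ := by
  have := norm_sub_norm_le (1 : ℂ) (r * fourier 1 t)
  rwa [norm_one, norm_mul, norm_fourier_apply, Complex.norm_real, Real.norm_of_nonneg h0,
    mul_one] at this

lemma one_sub_ne_zero (h0 : 0 ≤ r) (h1 : r < 1) (t : Tor) : 1 - r * (fourier 1 t : ℂ) ≠ 0 := by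
  have := one_sub_le_norm h0 t
  rw [← norm_pos_iff]; linarith

lemma continuous_cauchyKer (h0 : 0 ≤ r) (h1 : r < 1) : Continuous (cauchyKer r) := by
  unfold cauchyKer
  exact Continuous.inv₀ (by fun_prop) (one_sub_ne_zero h0 h1)

lemma chord_le_two_mul (h0 : 0 ≤ r) (h1 : r < 1) (x y : Tor) :
    chord x y ≤ 2 * ‖1 - r * (fourier 1 (x - y) : ℂ)‖ := by
  rw [chord_sub]
  have h : (1 : ℂ) - fourier 1 (x - y) =
      (1 - r * fourier 1 (x - y)) - (1 - r : ℝ) * fourier 1 (x - y) := by push_cast; ring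
  rw [h]
  refine (norm_sub_le _ _).trans ?_
  rw [norm_mul, norm_fourier_apply, Complex.norm_real, Real.norm_of_nonneg (by linarith), mul_one]
  linarith [one_sub_le_norm h0 (x - y)]

lemma norm_cauchyKer_le (h0 : 0 ≤ r) (h1 : r < 1) {x y : Tor} (h : 0 < chord x y) :
    ‖cauchyKer r (x - y)‖ ≤ 2 / chord x y := by
  rw [cauchyKer, norm_inv, inv_le_comm₀ (norm_pos_iff.2 (one_sub_ne_zero h0 h1 _)) (by positivity),
    inv_div, div_le_iff₀ (by norm_num)]
  linarith [chord_le_two_mul h0 h1 x y]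

lemma norm_cauchyKer_sub_le (h0 : 0 ≤ r) (h1 : r < 1) {x y z : Tor} (hy : 0 < chord x y)
    (hz : 0 < chord x z) :
    ‖cauchyKer r (x - y) - cauchyKer r (x - z)‖ ≤ 4 * chord y z / (chord x y * chord x z) := by
  have hk : cauchyKer r (x - y) - cauchyKer r (x - z) =
      r * (fourier 1 (x - y) - fourier 1 (x - z)) * cauchyKer r (x - y) * cauchyKer r (x - z) := by
    unfold cauchyKer
    have := one_sub_ne_zero h0 h1 (x - y)
    have := one_sub_ne_zero h0 h1 (x - z)
    field_simp
    ring
  have hd : ‖(fourier 1 (x - y) : ℂ) - fourier 1 (x - z)‖ = chord y z := by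
    rw [fourier_sub_arg, fourier_sub_arg, ← mul_sub, norm_mul, norm_fourier_apply, one_mul,
      fourier_neg, fourier_neg, ← map_sub, Complex.norm_conj]
    rfl
  rw [hk, norm_mul, norm_mul, norm_mul, hd, Complex.norm_real, Real.norm_of_nonneg h0]
  have e1 := norm_cauchyKer_le h0 h1 hy
  have e2 := norm_cauchyKer_le h0 h1 hz
  have hc := chord_nonneg y z
  calc _ ≤ 1 * chord y z * (2 / chord x y) * (2 / chord x z) := by gcongr
    _ = _ := by field_simp; norm_num

lemma norm_modulated_cauchyKer_sub_le (h0 : 0 ≤ r) (h1 : r < 1) (a : ℕ) {x y z : Tor}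
    (hy : 0 < chord x y) (hz : 0 < chord x z) :
    ‖(fourier a (x - y) - 1) * cauchyKer r (x - y) - (fourier a (x - z) - 1) * cauchyKer r (x - z)‖
      ≤ 6 * a * chord y z / chord x z := by
  have hk : (fourier a (x - y) - 1) * cauchyKer r (x - y) -
      (fourier a (x - z) - 1) * cauchyKer r (x - z) =
      (fourier a (x - y) - 1) * (cauchyKer r (x - y) - cauchyKer r (x - z)) +
      (fourier a (x - y) - fourier a (x - z)) * cauchyKer r (x - z) := by ring
  have hd : ‖(fourier a (x - y) : ℂ) - fourier a (x - z)‖ ≤ a * chord y z := by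
    rw [fourier_sub_arg, fourier_sub_arg, ← mul_sub, norm_mul, norm_fourier_apply, one_mul]
    exact norm_fourier_neg_sub_le a y z
  have he : ‖(fourier a (x - y) : ℂ) - 1‖ ≤ a * chord x y := by
    have : (fourier a (x - y) : ℂ) - 1 = (fourier a x - fourier a y) * fourier (-a) y := by
      rw [fourier_sub_arg, sub_mul, fourier_mul_fourier_neg]
    rw [this, norm_mul, norm_fourier_apply, mul_one]
    exact norm_fourier_sub_le a x y
  rw [hk]
  refine (norm_add_le _ _).trans ?_
  rw [norm_mul, norm_mul]
  have e1 := norm_cauchyKer_sub_le h0 h1 hy hz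
  have e2 := norm_cauchyKer_le h0 h1 hz
  have hc := chord_nonneg y z
  calc _ ≤ a * chord x y * (4 * chord y z / (chord x y * chord x z)) +
        a * chord y z * (2 / chord x z) := by gcongr
    _ = _ := by field_simp; norm_num

end kernel

/-- The truncated tail `1_{16ℓ < d} ℓ^{1/2} d^{-3/2}`, where `d` is the chordal distance to `c`. -/
def tail (l : ℝ) (c : Tor) : Tor → ℝ :=
  {x | 16 * l < chord x c}.indicator fun x => √l / (chord x c * √(chord x c))

lemma tail_nonneg (l : ℝ) (c x : Tor) : 0 ≤ tail l c x := by
  refine Set.indicator_nonneg (fun x _ => ?_) x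
  have := chord_nonneg x c
  positivity

lemma measurableSet_chord_lt (c : Tor) (s : ℝ) : MeasurableSet {x | s < chord x c} :=
  (isOpen_lt continuous_const (continuous_chord c)).measurableSet

lemma measurableSet_chord_le (c : Tor) (s : ℝ) : MeasurableSet {x | chord x c ≤ s} :=
  (isClosed_le (continuous_chord c) continuous_const).measurableSet

lemma tail_le_sum {l : ℝ} (hl : 0 < l) (c x : Tor) {n : ℕ} (hn : 2 ≤ 2 ^ n * l) :
    tail l c x ≤ ∑ i ∈ Finset.range n,
      {x | chord x c ≤ 2 ^ (i + 1) * l}.indicator (fun _ => 1 / (2 ^ i * l * √2 ^ i)) x := by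
  have hterm : ∀ i, 0 ≤ {x | chord x c ≤ 2 ^ (i + 1) * l}.indicator
      (fun _ => 1 / (2 ^ i * l * √2 ^ i)) x := fun i =>
    Set.indicator_nonneg (fun _ _ => by positivity) x
  by_cases hx : 16 * l < chord x c
  · have hex : ∃ i, chord x c ≤ 2 ^ (i + 1) * l :=
      ⟨n, (chord_le_two x c).trans
        (hn.trans (by rw [pow_succ]; nlinarith [pow_pos (two_pos : (0:ℝ) < 2) n]))⟩
    classical
    set i := Nat.find hex with hi
    have h1 : chord x c ≤ 2 ^ (i + 1) * l := Nat.find_spec hex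
    have h2 : 2 ^ i * l ≤ chord x c := by
      rcases Nat.eq_zero_or_pos i with h | h
      · rw [h]; linarith
      · have := Nat.find_min hex (m := i - 1) (by omega)
        rw [Nat.sub_add_cancel h] at this
        exact (not_le.1 this).le
    have hin : i < n := by
      by_contra hcon
      have h0 : i ≠ 0 := by
        intro h; rw [h] at h1; norm_num at h1; linarith
      have := Nat.find_min hex (m := i - 1) (by omega)
      rw [Nat.sub_add_cancel (by omega)] at this
      apply this
      refine (chord_le_two x c).trans (hn.trans ?_)
      have : (2:ℝ) ^ n ≤ 2 ^ i := pow_le_pow_right₀ (by norm_num) (not_lt.1 hcon)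
      nlinarith
    refine le_trans ?_ (Finset.single_le_sum (fun j _ => hterm j) (Finset.mem_range.2 hin))
    rw [tail, Set.indicator_of_mem (by exact hx), Set.indicator_of_mem (by exact h1)]
    have h3 : √2 ^ i * √l ≤ √(chord x c) := by
      apply Real.le_sqrt_of_sq_le
      rw [mul_pow, ← pow_mul, mul_comm i, pow_mul, Real.sq_sqrt (by norm_num), Real.sq_sqrt hl.le]
      exact h2
    have h4 : 0 < chord x c := by linarith
    have h5 : 0 < √l := Real.sqrt_pos.2 hl
    calc √l / (chord x c * √(chord x c)) ≤ √l / ((2 ^ i * l) * (√2 ^ i * √l)) := by gcongr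
      _ = _ := by field_simp
  · rw [tail, Set.indicator_of_notMem (by exact hx)]
    exact Finset.sum_nonneg fun j _ => hterm j

lemma bddMeas_tail {l : ℝ} (hl : 0 < l) (c : Tor) : BddMeas (tail l c) := by
  have hm : Measurable (tail l c) := by
    apply Measurable.indicator _ (measurableSet_chord_lt c _)
    have := (continuous_chord c).measurable
    fun_prop
  refine ⟨hm.stronglyMeasurable, √l / (16 * l * √(16 * l)), fun x => ?_⟩
  rw [Real.norm_of_nonneg (tail_nonneg _ _ _)]
  refine Set.indicator_apply_le' (fun hy => ?_) (fun _ => by positivity)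
  have hy : 16 * l < chord x c := hy
  have : √(16 * l) ≤ √(chord x c) := Real.sqrt_le_sqrt hy.le
  have h0 : 0 < √(16 * l) := Real.sqrt_pos.2 (by linarith)
  have h1 := chord_nonneg x c
  gcongr

lemma integral_tail_le {l : ℝ} (hl : 0 < l) (c : Tor) : ∫ x, tail l c x ∂haarT ≤ 8 := by
  obtain ⟨n, hn⟩ := pow_unbounded_of_one_lt (2 / l) (by norm_num : (1:ℝ) < 2)
  rw [div_lt_iff₀ hl] at hn
  have hB : ∀ i ∈ Finset.range n, BddMeas ({x | chord x c ≤ 2 ^ (i + 1) * l}.indicator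
      (fun _ : Tor => (1 / (2 ^ i * l * √2 ^ i) : ℝ))) := fun i _ =>
    (BddMeas.const _).indicator (measurableSet_chord_le c _)
  calc ∫ x, tail l c x ∂haarT ≤ ∫ x, ∑ i ∈ Finset.range n,
      {x | chord x c ≤ 2 ^ (i + 1) * l}.indicator (fun _ => 1 / (2 ^ i * l * √2 ^ i)) x ∂haarT :=
        integral_mono (bddMeas_tail hl c).integrable (BddMeas.sum _ hB).integrable
          fun x => tail_le_sum hl c x hn.le
    _ = ∑ i ∈ Finset.range n, haarT.real {x | chord x c ≤ 2 ^ (i + 1) * l} *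
          (1 / (2 ^ i * l * √2 ^ i)) := by
        rw [integral_finsetSum _ fun i hi => (hB i hi).integrable]
        refine Finset.sum_congr rfl fun i _ => ?_
        rw [integral_indicator_const _ (measurableSet_chord_le c _), smul_eq_mul]
    _ ≤ ∑ i ∈ Finset.range n, 2 * (3 / 4) ^ i := by
        refine Finset.sum_le_sum fun i _ => ?_
        have h1 : haarT.real {x | chord x c ≤ 2 ^ (i + 1) * l} ≤ 2 ^ (i + 1) * l :=
          ENNReal.toReal_le_of_le_ofReal (by positivity) (haarT_chord_le c (by positivity))
        have h2 : 4 / 3 ≤ √2 := Real.le_sqrt_of_sq_le (by norm_num)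
        have h3 : 1 / √2 ^ i ≤ (3 / 4 : ℝ) ^ i := by
          rw [← one_div_pow]
          refine pow_le_pow_left₀ (by positivity) ?_ i
          rw [div_le_iff₀ (by positivity)]; linarith
        calc _ ≤ 2 ^ (i + 1) * l * (1 / (2 ^ i * l * √2 ^ i)) := by gcongr
          _ = 2 * (1 / √2 ^ i) := by field_simp; ring
          _ ≤ _ := by linarith
    _ ≤ 8 := by
        rw [← Finset.mul_sum]
        have h := geom_sum_eq (by norm_num : (3 / 4 : ℝ) ≠ 1) n
        have : (0 : ℝ) ≤ (3 / 4) ^ n := by positivity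
        rw [h, div_eq_mul_inv]
        norm_num
        linarith

/-- Convolution with the Abel-regularised Cauchy kernel, i.e. the multiplier `1_{n ≥ 0} r^n`. -/
def cauchyOp (r : ℝ) (h : Tor → ℂ) (x : Tor) : ℂ := ∫ y, cauchyKer r (x - y) * h y ∂haarT

/-- The multiplier `1_{n ≥ a} r^{n - a}`. -/
def shiftOp (r : ℝ) (a : ℤ) (h : Tor → ℂ) (x : Tor) : ℂ :=
  fourier a x * cauchyOp r (fun y => fourier (-a) y * h y) x

lemma fourierCoeff_haarT (h : Tor → ℂ) (n : ℤ) :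
    fourierCoeff h n = ∫ y, fourier (-n) y * h y ∂haarT := rfl

lemma integral_sub_right' (h : Tor → ℂ) (y : Tor) :
    ∫ x, h (x - y) ∂haarT = ∫ x, h x ∂haarT := integral_sub_right_eq_self h y

lemma integral_fourier (n : ℤ) : ∫ y, (fourier n y : ℂ) ∂haarT = if n = 0 then 1 else 0 := by
  have h := congr_fun (fourierCoeff_fourier (T := 2 * π) n) 0
  rw [fourierCoeff_haarT] at h
  simpa [Pi.single_apply, eq_comm] using h

lemma fourierCoeff_fourier_mul (a : ℤ) (h : Tor → ℂ) (n : ℤ) :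
    fourierCoeff (fun y => fourier a y * h y) n = fourierCoeff h (n - a) := by
  rw [fourierCoeff_haarT, fourierCoeff_haarT]
  congr 1
  ext y
  rw [← mul_assoc, ← fourier_add]
  congr 2
  ring_nf

variable {r : ℝ}

lemma bddMeas_cauchyKer (h0 : 0 ≤ r) (h1 : r < 1) : BddMeas (cauchyKer r) :=
  BddMeas.of_continuous (continuous_cauchyKer h0 h1)

lemma bddMeas_cauchyKer_mul (h0 : 0 ≤ r) (h1 : r < 1) {h : Tor → ℂ} (hh : BddMeas h) (x : Tor) :
    BddMeas (fun y => cauchyKer r (x - y) * h y) :=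
  ((bddMeas_cauchyKer h0 h1).comp (measurable_const.sub measurable_id)).mul hh

lemma bddMeas_cauchyOp (h0 : 0 ≤ r) (h1 : r < 1) {h : Tor → ℂ} (hh : BddMeas h) :
    BddMeas (cauchyOp r h) :=
  BddMeas.integral_prod (f := fun p : Tor × Tor => cauchyKer r (p.1 - p.2) * h p.2)
    (((bddMeas_cauchyKer h0 h1).comp (measurable_fst.sub measurable_snd)).mul
      (hh.comp measurable_snd))

lemma bddMeas_shiftOp (h0 : 0 ≤ r) (h1 : r < 1) (a : ℤ) {h : Tor → ℂ} (hh : BddMeas h) :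
    BddMeas (shiftOp r a h) :=
  (bddMeas_fourier a).mul (bddMeas_cauchyOp h0 h1 ((bddMeas_fourier (-a)).mul hh))

lemma cauchyOp_add (h0 : 0 ≤ r) (h1 : r < 1) {f g : Tor → ℂ} (hf : BddMeas f) (hg : BddMeas g)
    (x : Tor) : cauchyOp r (fun y => f y + g y) x = cauchyOp r f x + cauchyOp r g x := by
  unfold cauchyOp
  rw [← integral_add (bddMeas_cauchyKer_mul h0 h1 hf x).integrable
    (bddMeas_cauchyKer_mul h0 h1 hg x).integrable]
  simp only [mul_add]

lemma cauchyOp_sum (h0 : 0 ≤ r) (h1 : r < 1) {ι : Type*} (s : Finset ι) {f : ι → Tor → ℂ}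
    (hf : ∀ i ∈ s, BddMeas (f i)) (x : Tor) :
    cauchyOp r (fun y => ∑ i ∈ s, f i y) x = ∑ i ∈ s, cauchyOp r (f i) x := by
  unfold cauchyOp
  rw [← integral_finsetSum _ fun i hi => (bddMeas_cauchyKer_mul h0 h1 (hf i hi) x).integrable]
  simp only [Finset.mul_sum]

lemma cauchyOp_const_mul (c : ℂ) (f : Tor → ℂ) (x : Tor) :
    cauchyOp r (fun y => c * f y) x = c * cauchyOp r f x := by
  unfold cauchyOp
  rw [← integral_const_mul]
  congr 1; ext y; ring

lemma fourierCoeff_cauchyKer_succ (h0 : 0 ≤ r) (h1 : r < 1) (n : ℤ) :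
    fourierCoeff (cauchyKer r) n =
      (if n = 0 then 1 else 0) + r * fourierCoeff (cauchyKer r) (n - 1) := by
  have hk : ∀ y, cauchyKer r y = 1 + r * (fourier 1 y * cauchyKer r y) := by
    intro y
    unfold cauchyKer
    have := one_sub_ne_zero h0 h1 y
    field_simp
    ring
  have hB := bddMeas_cauchyKer h0 h1
  rw [← fourierCoeff_fourier_mul 1]
  conv_lhs => rw [fourierCoeff_haarT]
  rw [fourierCoeff_haarT, ← integral_const_mul]
  have : (if n = 0 then (1:ℂ) else 0) = ∫ y, (fourier (-n) y : ℂ) ∂haarT := by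
    rw [integral_fourier]; simp
  rw [this, ← integral_add (bddMeas_fourier _).integrable
    ((BddMeas.const _).mul ((bddMeas_fourier _).mul ((bddMeas_fourier _).mul hB))).integrable]
  congr 1; ext y
  conv_lhs => rw [hk y]
  ring

lemma fourierCoeff_cauchyKer_neg (h0 : 0 ≤ r) (h1 : r < 1) {n : ℤ} (hn : n < 0) :
    fourierCoeff (cauchyKer r) n = 0 := by
  obtain ⟨hm, B, hB⟩ := bddMeas_cauchyKer h0 h1
  have hb : ∀ n, ‖fourierCoeff (cauchyKer r) n‖ ≤ B := by
    intro n
    rw [fourierCoeff_haarT]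
    have := norm_integral_le_of_norm_le_const (μ := haarT)
      (f := fun y => fourier (-n) y * cauchyKer r y) (C := B)
      (Filter.Eventually.of_forall fun y => by
        rw [norm_mul, norm_fourier_apply, one_mul]; exact hB y)
    simpa using this
  have hrec : ∀ m : ℕ,
      fourierCoeff (cauchyKer r) n = r ^ m * fourierCoeff (cauchyKer r) (n - m) := by
    intro m
    induction m with
    | zero => simp
    | succ m ih =>
      rw [ih, fourierCoeff_cauchyKer_succ h0 h1, if_neg (by omega)]
      push_cast
      rw [sub_sub]; ring
  have hlim : Filter.Tendsto (fun m : ℕ => r ^ m * B) Filter.atTop (nhds 0) := by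
    simpa using (tendsto_pow_atTop_nhds_zero_of_lt_one h0 h1).mul_const B
  rw [← norm_le_zero_iff]
  refine ge_of_tendsto hlim (Filter.Eventually.of_forall fun m => ?_)
  rw [hrec m, norm_mul, norm_pow, Complex.norm_real, Real.norm_of_nonneg h0]
  exact mul_le_mul_of_nonneg_left (hb _) (by positivity)

/-- The multiplier `1_{n ≥ 0} r^n`. -/
def abelMult (r : ℝ) (n : ℤ) : ℝ := if 0 ≤ n then r ^ n.toNat else 0

lemma fourierCoeff_cauchyKer (h0 : 0 ≤ r) (h1 : r < 1) (n : ℤ) :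
    fourierCoeff (cauchyKer r) n = abelMult r n := by
  rcases lt_or_ge n 0 with h | h
  · rw [fourierCoeff_cauchyKer_neg h0 h1 h, abelMult, if_neg (by omega)]; simp
  · rw [abelMult, if_pos h]
    obtain ⟨m, rfl⟩ := Int.eq_ofNat_of_zero_le h
    rw [Int.toNat_natCast]
    induction m with
    | zero =>
      rw [fourierCoeff_cauchyKer_succ h0 h1, fourierCoeff_cauchyKer_neg h0 h1 (by simp)]
      simp
    | succ m ih =>
      rw [fourierCoeff_cauchyKer_succ h0 h1, if_neg (by positivity)]
      push_cast at ih ⊢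
      rw [add_sub_cancel_right, ih (by omega), pow_succ]
      ring

lemma fourierCoeff_cauchyOp (h0 : 0 ≤ r) (h1 : r < 1) {h : Tor → ℂ} (hh : BddMeas h) (n : ℤ) :
    fourierCoeff (cauchyOp r h) n = abelMult r n * fourierCoeff h n := by
  rw [← fourierCoeff_cauchyKer h0 h1, fourierCoeff_haarT]
  have hB := bddMeas_cauchyKer h0 h1
  have hP : BddMeas (fun p : Tor × Tor =>
      (fourier (-n) p.1 : ℂ) * (cauchyKer r (p.1 - p.2) * h p.2)) :=
    ((bddMeas_fourier (-n)).comp measurable_fst).mul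
      ((hB.comp (measurable_fst.sub measurable_snd)).mul (hh.comp measurable_snd))
  have e1 : ∀ x, (fourier (-n) x : ℂ) * cauchyOp r h x =
      ∫ y, (fourier (-n) x : ℂ) * (cauchyKer r (x - y) * h y) ∂haarT := by
    intro x; rw [integral_const_mul]; rfl
  simp_rw [e1]
  rw [integral_integral_swap (f := fun x y => (fourier (-n) x : ℂ) * (cauchyKer r (x - y) * h y))
    hP.integrable, fourierCoeff_haarT h, ← integral_const_mul]
  congr 1; ext y
  have e2 : ∀ x, (fourier (-n) x : ℂ) * (cauchyKer r (x - y) * h y) =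
      (fourier (-n) (x - y) * cauchyKer r (x - y)) * (fourier (-n) y * h y) := by
    intro x
    rw [fourier_sub_arg]
    have := fourier_mul_fourier_neg (-n) y
    linear_combination (-(fourier (-n) x : ℂ) * cauchyKer r (x - y) * h y) * this
  simp_rw [e2]
  rw [integral_mul_const, integral_sub_right' (fun x => fourier (-n) x * cauchyKer r x)]
  rfl

lemma hasSum_sq_norm_fourierCoeff {h : Tor → ℂ} (hh : BddMeas h) :
    HasSum (fun n : ℤ => ‖fourierCoeff h n‖ ^ 2) (∫ x, ‖h x‖ ^ 2 ∂haarT) := by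
  have hm : MemLp h 2 (AddCircle.haarAddCircle : Measure Tor) := hh.memLp (μ := haarT) 2
  have H := hasSum_sq_fourierCoeff hm.toLp
  have hc : ∀ n, fourierCoeff (hm.toLp : Tor → ℂ) n = fourierCoeff h n := fun n =>
    congr_fun (fourierCoeff_congr_ae hm.coeFn_toLp) n
  simp_rw [hc] at H
  convert H using 1
  apply integral_congr_ae
  filter_upwards [hm.coeFn_toLp] with x hx
  rw [hx]

lemma abelMult_nonneg (h0 : 0 ≤ r) (n : ℤ) : 0 ≤ abelMult r n := by
  unfold abelMult; split_ifs <;> positivity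

lemma abelMult_le_one (h0 : 0 ≤ r) (h1 : r < 1) (n : ℤ) : abelMult r n ≤ 1 := by
  unfold abelMult; split_ifs
  · exact pow_le_one₀ h0 h1.le
  · norm_num

lemma integral_sq_norm_cauchyOp_le (h0 : 0 ≤ r) (h1 : r < 1) {h : Tor → ℂ} (hh : BddMeas h) :
    ∫ x, ‖cauchyOp r h x‖ ^ 2 ∂haarT ≤ ∫ x, ‖h x‖ ^ 2 ∂haarT := by
  refine hasSum_le (fun n => ?_) (hasSum_sq_norm_fourierCoeff (bddMeas_cauchyOp h0 h1 hh))
    (hasSum_sq_norm_fourierCoeff hh)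
  rw [fourierCoeff_cauchyOp h0 h1 hh, norm_mul, Complex.norm_real,
    Real.norm_of_nonneg (abelMult_nonneg h0 n)]
  have := mul_le_of_le_one_left (norm_nonneg (fourierCoeff h n)) (abelMult_le_one h0 h1 n)
  exact pow_le_pow_left₀ (mul_nonneg (abelMult_nonneg h0 n) (norm_nonneg _)) this 2

lemma fourierCoeff_shiftOp (h0 : 0 ≤ r) (h1 : r < 1) (a : ℤ) {h : Tor → ℂ} (hh : BddMeas h)
    (n : ℤ) : fourierCoeff (shiftOp r a h) n = abelMult r (n - a) * fourierCoeff h n := by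
  unfold shiftOp
  rw [fourierCoeff_fourier_mul, fourierCoeff_cauchyOp h0 h1 ((bddMeas_fourier _).mul hh),
    fourierCoeff_fourier_mul]
  congr 2; ring

lemma shiftOp_fourier (h0 : 0 ≤ r) (h1 : r < 1) (a n : ℤ) (x : Tor) :
    shiftOp r a (fun y => fourier n y) x = abelMult r (n - a) * fourier n x := by
  unfold shiftOp cauchyOp
  rw [← fourierCoeff_cauchyKer h0 h1, fourierCoeff_haarT]
  have e : ∀ y, cauchyKer r (x - y) * ((fourier (-a) y : ℂ) * fourier n y) =
      fourier (n - a) x * (fourier (-(n - a)) (x - y) * cauchyKer r (x - y)) := by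
    intro y
    rw [fourier_sub_arg, neg_neg, ← fourier_add, show -a + n = n - a by ring]
    have := fourier_mul_fourier_neg (n - a) x
    linear_combination (-(fourier (n - a) y : ℂ) * cauchyKer r (x - y)) * this
  simp_rw [e]
  rw [integral_const_mul, integral_sub_left_eq_self (fun t => fourier (-(n - a)) t * cauchyKer r t),
    ← mul_assoc, ← fourier_add, mul_comm, add_sub_cancel]

lemma shiftOp_add (h0 : 0 ≤ r) (h1 : r < 1) (a : ℤ) {f g : Tor → ℂ} (hf : BddMeas f)
    (hg : BddMeas g) (x : Tor) :
    shiftOp r a (fun y => f y + g y) x = shiftOp r a f x + shiftOp r a g x := by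
  unfold shiftOp
  rw [← mul_add, ← cauchyOp_add h0 h1 ((bddMeas_fourier _).mul hf) ((bddMeas_fourier _).mul hg)]
  simp only [mul_add]

lemma shiftOp_sum (h0 : 0 ≤ r) (h1 : r < 1) (a : ℤ) {ι : Type*} (s : Finset ι)
    {f : ι → Tor → ℂ} (hf : ∀ i ∈ s, BddMeas (f i)) (x : Tor) :
    shiftOp r a (fun y => ∑ i ∈ s, f i y) x = ∑ i ∈ s, shiftOp r a (f i) x := by
  unfold shiftOp
  rw [← Finset.mul_sum, ← cauchyOp_sum h0 h1 s fun i hi => (bddMeas_fourier _).mul (hf i hi)]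
  simp only [Finset.mul_sum]

lemma shiftOp_const_mul (a : ℤ) (c : ℂ) (f : Tor → ℂ) (x : Tor) :
    shiftOp r a (fun y => c * f y) x = c * shiftOp r a f x := by
  have h : (fun y => (fourier (-a) y : ℂ) * (c * f y)) = fun y => c * (fourier (-a) y * f y) := by
    funext y; ring
  unfold shiftOp
  rw [h, cauchyOp_const_mul, mul_left_comm]

lemma sum_sq_abelMult_sub_le (h0 : 0 ≤ r) (h1 : r < 1) {A : ℕ → ℕ} (hA : Monotone A) (n : ℤ)
    (m : ℕ) :
    ∑ j ∈ Finset.range m, (abelMult r (n - A j) - abelMult r (n - A (j + 1))) ^ 2 ≤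
      2 := by
  have key : ∀ m, (∑ j ∈ Finset.range m, (abelMult r (n - A j) - abelMult r (n - A (j + 1))) ^ 2 ≤
      if (A m : ℤ) ≤ n then abelMult r (n - A m) else 2) := by
    intro m
    induction m with
    | zero =>
      simp only [Finset.range_zero, Finset.sum_empty]
      split_ifs
      · exact abelMult_nonneg h0 _
      · norm_num
    | succ m ih =>
      rw [Finset.sum_range_succ]
      have hm : A m ≤ A (m + 1) := hA (Nat.le_succ m)
      have a0 := abelMult_nonneg h0 (n - A m)
      have a1 := abelMult_le_one h0 h1 (n - A m)
      have b0 := abelMult_nonneg h0 (n - A (m + 1))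
      have b1 := abelMult_le_one h0 h1 (n - A (m + 1))
      by_cases hc : (A (m + 1) : ℤ) ≤ n
      · rw [if_pos hc]
        rw [if_pos (by omega)] at ih
        have hle : abelMult r (n - A m) ≤ abelMult r (n - A (m + 1)) := by
          unfold abelMult
          rw [if_pos (by omega), if_pos (by omega)]
          exact pow_le_pow_of_le_one h0 h1.le (by omega)
        nlinarith
      · rw [if_neg hc]
        have hb : abelMult r (n - A (m + 1)) = 0 := by
          unfold abelMult; rw [if_neg (by omega)]
        by_cases hc' : (A m : ℤ) ≤ n
        · rw [if_pos hc'] at ih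
          rw [hb]; nlinarith
        · rw [if_neg hc'] at ih
          have ha : abelMult r (n - A m) = 0 := by
            unfold abelMult; rw [if_neg (by omega)]
          rw [ha, hb]; linarith
  refine (key m).trans ?_
  split_ifs
  · linarith [abelMult_le_one h0 h1 (n - A m)]
  · exact le_rfl

lemma sum_integral_sq_shiftOp_sub_le (h0 : 0 ≤ r) (h1 : r < 1) {A : ℕ → ℕ} (hA : Monotone A)
    {h : Tor → ℂ} (hh : BddMeas h) (m : ℕ) :
    ∑ j ∈ Finset.range m, ∫ x, ‖shiftOp r (A j) h x - shiftOp r (A (j + 1)) h x‖ ^ 2 ∂haarT ≤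
      2 * ∫ x, ‖h x‖ ^ 2 ∂haarT := by
  have hB : ∀ a : ℤ, BddMeas (shiftOp r a h) := fun a => bddMeas_shiftOp h0 h1 a hh
  have hs := hasSum_sum (s := Finset.range m) fun j _ =>
    hasSum_sq_norm_fourierCoeff ((hB (A j)).sub (hB (A (j + 1))))
  refine hasSum_le (fun n => ?_) hs ((hasSum_sq_norm_fourierCoeff hh).mul_left 2)
  have e : ∀ j, fourierCoeff (fun x => shiftOp r (A j) h x - shiftOp r (A (j + 1)) h x) n =
      ((abelMult r (n - A j) - abelMult r (n - A (j + 1)) : ℝ) : ℂ) * fourierCoeff h n := by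
    intro j
    have : fourierCoeff (fun x => shiftOp r (A j) h x - shiftOp r (A (j + 1)) h x) n =
        fourierCoeff (shiftOp r (A j) h) n - fourierCoeff (shiftOp r (A (j + 1)) h) n := by
      simp only [fourierCoeff_haarT, mul_sub]
      exact integral_sub ((bddMeas_fourier _).mul (hB _)).integrable
        ((bddMeas_fourier _).mul (hB _)).integrable
    rw [this, fourierCoeff_shiftOp h0 h1 _ hh, fourierCoeff_shiftOp h0 h1 _ hh]
    push_cast; ring
  simp_rw [e, norm_mul, mul_pow, Complex.norm_real, Real.norm_eq_abs, sq_abs]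
  rw [← Finset.sum_mul]
  gcongr
  exact sum_sq_abelMult_sub_le h0 h1 hA n m

/-- The dyadic arc of generation `q.1` and index `q.2`. -/
def cube (q : ℕ × ℕ) : Set Tor :=
  coord ⁻¹' Set.Ico ((q.2 : ℝ) / 2 ^ q.1) ((q.2 + 1 : ℝ) / 2 ^ q.1)

/-- The normalised length of a dyadic arc. -/
def side (q : ℕ × ℕ) : ℝ := (2 ^ q.1)⁻¹

/-- The midpoint of a dyadic arc. -/
def center (q : ℕ × ℕ) : Tor := ((2 * π * ((q.2 + 1 / 2) / 2 ^ q.1) : ℝ) : Tor)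

lemma side_pos (q : ℕ × ℕ) : 0 < side q := by unfold side; positivity

lemma measurableSet_cube (q : ℕ × ℕ) : MeasurableSet (cube q) :=
  measurable_coord measurableSet_Ico

lemma haarT_cube {q : ℕ × ℕ} (hq : q.2 < 2 ^ q.1) : haarT.real (cube q) = side q := by
  have h2 : (q.2 + 1 : ℝ) ≤ 2 ^ q.1 := by exact_mod_cast hq
  have hs : ((q.2 + 1 : ℝ) / 2 ^ q.1) - q.2 / 2 ^ q.1 = side q := by
    unfold side; field_simp; ring
  rw [Measure.real, cube, haarT_coord_Ico (by positivity) ((div_le_one (by positivity)).2 h2), hs,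
    ENNReal.toReal_ofReal (side_pos q).le]

lemma coord_center {q : ℕ × ℕ} (hq : q.2 < 2 ^ q.1) :
    coord (center q) = (q.2 + 1 / 2) / 2 ^ q.1 := by
  have h2 : (q.2 + 1 : ℝ) ≤ 2 ^ q.1 := by exact_mod_cast hq
  exact coord_mk (by positivity) ((div_lt_one (by positivity)).2 (by linarith))

lemma chord_center_le {q : ℕ × ℕ} (hq : q.2 < 2 ^ q.1) {y : Tor} (hy : y ∈ cube q) :
    chord y (center q) ≤ π * side q := by
  refine (chord_le_coord _ _).trans ?_
  obtain ⟨h1, h2⟩ := hy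
  rw [coord_center hq]
  rw [div_eq_mul_inv] at h1 h2
  change _ ≤ π * (2 ^ q.1)⁻¹
  have h3 : |coord y - (q.2 + 1 / 2) / 2 ^ q.1| ≤ 1 / 2 * (2 ^ q.1)⁻¹ := by
    rw [div_eq_mul_inv, abs_le]
    constructor <;> nlinarith
  nlinarith [pi_pos]

lemma chord_le_of_mem_cube {q : ℕ × ℕ} {y z : Tor} (hy : y ∈ cube q) (hz : z ∈ cube q) :
    chord y z ≤ 2 * π * side q := by
  refine (chord_le_coord _ _).trans ?_
  obtain ⟨h1, h2⟩ := hy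
  obtain ⟨h3, h4⟩ := hz
  rw [div_eq_mul_inv] at h1 h2 h3 h4
  have h5 : |coord y - coord z| ≤ side q := by
    unfold side
    rw [abs_le]
    constructor <;> nlinarith
  nlinarith [pi_pos]

/-- The index of the dyadic arc of generation `k` containing `x`. -/
def dyadicIdx (k : ℕ) (x : Tor) : ℕ := ⌊coord x * 2 ^ k⌋₊

lemma mem_cube_iff {q : ℕ × ℕ} {x : Tor} : x ∈ cube q ↔ q.2 = dyadicIdx q.1 x := by
  have h := coord_nonneg x
  unfold cube dyadicIdx
  rw [eq_comm, Nat.floor_eq_iff (by positivity)]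
  simp only [Set.mem_preimage, Set.mem_Ico]
  rw [div_le_iff₀ (by positivity), lt_div_iff₀ (by positivity)]

lemma center_mem_cube {q : ℕ × ℕ} (hq : q.2 < 2 ^ q.1) : center q ∈ cube q := by
  rw [mem_cube_iff, dyadicIdx, coord_center hq, div_mul_cancel₀ _ (by positivity), eq_comm,
    Nat.floor_eq_iff (by positivity)]
  constructor <;> linarith

lemma dyadicIdx_lt (k : ℕ) (x : Tor) : dyadicIdx k x < 2 ^ k := by
  unfold dyadicIdx
  have h := coord_nonneg x
  rw [Nat.floor_lt (by positivity)]
  push_cast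
  have := coord_lt_one x
  have : (0:ℝ) < 2 ^ k := by positivity
  nlinarith

lemma dyadicIdx_div (k m : ℕ) (x : Tor) : dyadicIdx (k + m) x / 2 ^ m = dyadicIdx k x := by
  unfold dyadicIdx
  rw [← Nat.floor_div_natCast]
  congr 1
  push_cast
  rw [pow_add]; field_simp

/-- The Calderón–Zygmund stopping-time decomposition of a continuous function at height `1`. -/
theorem exists_calderon_zygmund {u : Tor → ℝ} (hu : Continuous u) (h0 : ∀ x, 0 ≤ u x)
    (h1 : ∫ x, u x ∂haarT ≤ 1) :
    ∃ S : Finset (ℕ × ℕ), (∀ q ∈ S, q.2 < 2 ^ q.1) ∧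
      (∀ x, ∀ q ∈ S, ∀ q' ∈ S, x ∈ cube q → x ∈ cube q' → q = q') ∧
      (∀ q ∈ S, side q ≤ ∫ x in cube q, u x ∂haarT ∧ ∫ x in cube q, u x ∂haarT ≤ 2 * side q) ∧
      ∀ x, (∀ q ∈ S, x ∉ cube q) → u x ≤ 2 := by
  classical
  have hB : BddMeas u := BddMeas.of_continuous hu
  obtain ⟨K, hK⟩ : ∃ K : ℕ, ∀ i, ∀ y ∈ cube (K, i), ∀ z ∈ cube (K, i), u y ≤ u z + 1 := by
    have hv : Continuous (fun t : ℝ => u ((2 * π * t : ℝ) : Tor)) :=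
      hu.comp ((AddCircle.continuous_mk' _).comp (by fun_prop))
    have huc := isCompact_Icc.uniformContinuousOn_of_continuous
      (hv.continuousOn (s := Set.Icc (0 : ℝ) 1))
    obtain ⟨δ, hδ, H⟩ := Metric.uniformContinuousOn_iff.1 huc 1 one_pos
    obtain ⟨K, hK⟩ := exists_pow_lt_of_lt_one hδ (by norm_num : (1 / 2 : ℝ) < 1)
    refine ⟨K, fun i y hy z hz => ?_⟩
    have hyz : dist (coord y) (coord z) < δ := by
      refine lt_of_le_of_lt ?_ hK
      obtain ⟨h1, h2⟩ := hy
      obtain ⟨h3, h4⟩ := hz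
      rw [Real.dist_eq, one_div, inv_pow, abs_le]
      simp only [div_eq_mul_inv] at h1 h2 h3 h4
      constructor <;> nlinarith
    have := H _ ⟨coord_nonneg y, (coord_lt_one y).le⟩ _ ⟨coord_nonneg z, (coord_lt_one z).le⟩ hyz
    simp only [mk_coord, Real.dist_eq] at this
    linarith [(abs_lt.1 this).2]
  let bad : ℕ → ℕ → Prop := fun k i => side (k, i) < ∫ x in cube (k, i), u x ∂haarT
  let S : Finset (ℕ × ℕ) := (Finset.range (K + 1) ×ˢ Finset.range (2 ^ K)).filter fun q =>
    q.2 < 2 ^ q.1 ∧ bad q.1 q.2 ∧ ∀ m < q.1, ¬ bad m (q.2 / 2 ^ (q.1 - m))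
  have hS : ∀ q ∈ S, q.2 < 2 ^ q.1 ∧ bad q.1 q.2 ∧ ∀ m < q.1, ¬ bad m (q.2 / 2 ^ (q.1 - m)) :=
    fun q hq => (Finset.mem_filter.1 hq).2
  have hanc : ∀ k m x, m ≤ k → dyadicIdx k x / 2 ^ (k - m) = dyadicIdx m x := by
    intro k m x hm
    obtain ⟨n, rfl⟩ := Nat.exists_eq_add_of_le hm
    rw [Nat.add_sub_cancel_left, dyadicIdx_div]
  refine ⟨S, fun q hq => (hS q hq).1, ?_, ?_, ?_⟩
  · intro x q hq q' hq' hx hx'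
    rw [mem_cube_iff] at hx hx'
    obtain ⟨k, i⟩ := q
    obtain ⟨k', i'⟩ := q'
    obtain ⟨-, hb, hn⟩ := hS _ hq
    obtain ⟨-, hb', hn'⟩ := hS _ hq'
    dsimp only at hx hx' hb hb' hn hn'
    subst hx; subst hx'
    rcases lt_trichotomy k k' with h | h | h
    · exact absurd hb (by simpa only [hanc k' k x h.le] using hn' k h)
    · rw [h]
    · exact absurd hb' (by simpa only [hanc k k' x h.le] using hn k' h)
  · intro q hq
    obtain ⟨hlt, hb, hn⟩ := hS q hq
    obtain ⟨k, i⟩ := q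
    refine ⟨hb.le, ?_⟩
    dsimp only at hlt hb hn
    rcases k with _ | k
    · refine (setIntegral_le_integral hB.integrable (Filter.Eventually.of_forall h0)).trans ?_
      simp only [side]; norm_num; linarith
    · have hp := hn k (Nat.lt_succ_self k)
      simp only [bad, not_lt] at hp
      have hsub : cube (k + 1, i) ⊆ cube (k, i / 2 ^ (k + 1 - k)) := by
        intro x hx
        rw [mem_cube_iff] at hx ⊢
        dsimp only at hx ⊢
        rw [hx, hanc _ _ _ (Nat.le_succ k)]
      refine (setIntegral_mono_set hB.integrable.integrableOn (Filter.Eventually.of_forall h0)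
        hsub.eventuallyLE).trans (hp.trans ?_)
      simp only [side, pow_succ]
      apply le_of_eq; field_simp
  · intro x hx
    have hgood : ∀ k ≤ K, ¬ bad k (dyadicIdx k x) := by
      by_contra! hcon
      let k := Nat.find hcon
      obtain ⟨hk, hkb⟩ : k ≤ K ∧ bad k (dyadicIdx k x) := Nat.find_spec hcon
      refine hx (k, dyadicIdx k x) (Finset.mem_filter.2 ⟨?_, dyadicIdx_lt k x, hkb, ?_⟩)
        (mem_cube_iff.2 rfl)
      · rw [Finset.mem_product, Finset.mem_range, Finset.mem_range]
        exact ⟨by dsimp only; omega,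
          (dyadicIdx_lt k x).trans_le (Nat.pow_le_pow_right (by norm_num) hk)⟩
      · intro m hm hb
        dsimp only at hm hb
        rw [hanc k m x hm.le] at hb
        exact Nat.find_min hcon hm ⟨hm.le.trans hk, hb⟩
    have hg := hgood K le_rfl
    simp only [bad, not_lt] at hg
    have hxm : x ∈ cube (K, dyadicIdx K x) := mem_cube_iff.2 rfl
    have hlow : (u x - 1) * side (K, dyadicIdx K x) ≤
        ∫ y in cube (K, dyadicIdx K x), u y ∂haarT := by
      have := setIntegral_mono_on (μ := haarT) (f := fun _ => u x - 1) (g := u)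
        (integrable_const _).integrableOn hB.integrable.integrableOn
        (measurableSet_cube (K, dyadicIdx K x))
        (fun y hy => by linarith [hK _ x hxm y hy])
      rwa [setIntegral_const, haarT_cube (dyadicIdx_lt K x), smul_eq_mul, mul_comm] at this
    have := side_pos (K, dyadicIdx K x)
    have : u x - 1 ≤ 1 := by
      by_contra! h
      nlinarith
    linarith

/-- A factor of a Riesz product. -/
def rieszFactor (t : ℝ) (ζ : ℂ) (a : ℕ) (y : Tor) : ℝ :=
  Real.cosh t + (ζ * fourier a y).re * Real.sinh t

lemma abs_re_mul_fourier_le {ζ : ℂ} (hζ : ‖ζ‖ ≤ 1) (n : ℤ) (y : Tor) :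
    |(ζ * fourier n y).re| ≤ 1 := by
  refine (Complex.abs_re_le_norm _).trans ?_
  rwa [norm_mul, norm_fourier_apply, mul_one]

lemma exp_le_rieszFactor (t : ℝ) {ζ : ℂ} (hζ : ‖ζ‖ ≤ 1) (a : ℕ) (y : Tor) :
    Real.exp ((ζ * fourier a y).re * t) ≤ rieszFactor t ζ a y :=
  Real.exp_mul_le_cosh_add_mul_sinh (abs_re_mul_fourier_le hζ _ _) t

lemma continuous_rieszFactor (t : ℝ) (ζ : ℂ) (a : ℕ) : Continuous (rieszFactor t ζ a) := by
  unfold rieszFactor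
  fun_prop

lemma rieszFactor_eq (t : ℝ) (ζ : ℂ) (a : ℕ) (y : Tor) :
    (rieszFactor t ζ a y : ℂ) = Real.cosh t +
      Real.sinh t / 2 * ζ * fourier a y + Real.sinh t / 2 * starRingEnd ℂ ζ * fourier (-a) y := by
  unfold rieszFactor
  push_cast [Complex.re_eq_add_conj]
  rw [map_mul, ← fourier_neg]
  ring

section riesz
variable {a : ℕ → ℕ} {w : Tor → ℝ} (t : ℕ → ℝ) (ζ : ℕ → ℂ)

lemma bddMeas_mul_prod_rieszFactor (hw : Continuous w) (k : ℕ) (m : ℤ) :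
    BddMeas (fun y => ((w y * ∏ i ∈ Finset.range k, rieszFactor (t i) (ζ i) (a i) y : ℝ) : ℂ) *
      fourier m y) := by
  apply BddMeas.of_continuous
  have := fun i => continuous_rieszFactor (t i) (ζ i) (a i)
  fun_prop

lemma integral_mul_prod_rieszFactor_succ (hw : Continuous w) (k : ℕ) (m : ℤ) :
    ∫ y, ((w y * ∏ i ∈ Finset.range (k + 1), rieszFactor (t i) (ζ i) (a i) y : ℝ) : ℂ) *
      fourier m y ∂haarT =
    Real.cosh (t k) * ∫ y, ((w y * ∏ i ∈ Finset.range k, rieszFactor (t i) (ζ i) (a i) y : ℝ) : ℂ) *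
      fourier m y ∂haarT +
    Real.sinh (t k) / 2 * ζ k *
      ∫ y, ((w y * ∏ i ∈ Finset.range k, rieszFactor (t i) (ζ i) (a i) y : ℝ) : ℂ) *
        fourier (m + a k) y ∂haarT +
    Real.sinh (t k) / 2 * starRingEnd ℂ (ζ k) *
      ∫ y, ((w y * ∏ i ∈ Finset.range k, rieszFactor (t i) (ζ i) (a i) y : ℝ) : ℂ) *
        fourier (m - a k) y ∂haarT := by
  have hB := bddMeas_mul_prod_rieszFactor (a := a) t ζ hw k
  simp only [← integral_const_mul]
  rw [← integral_add ((BddMeas.const _).mul (hB m)).integrable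
    ((BddMeas.const _).mul (hB _)).integrable,
    ← integral_add (((BddMeas.const _).mul (hB m)).add ((BddMeas.const _).mul (hB _))).integrable
    ((BddMeas.const _).mul (hB _)).integrable]
  congr 1
  funext y
  rw [Finset.prod_range_succ, ← mul_assoc, Complex.ofReal_mul (w y * _), rieszFactor_eq,
    fourier_add, sub_eq_add_neg, fourier_add]
  ring

lemma integral_mul_prod_rieszFactor (hw : Continuous w) (ha : ∀ i, 2 * a i ≤ a (i + 1))
    (hs : ∀ m : ℤ, (a 0 : ℤ) ≤ |m| → ∫ y, (w y : ℂ) * fourier m y ∂haarT = 0) (k : ℕ) :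
    (∀ m : ℤ, (a k : ℤ) ≤ |m| →
      ∫ y, ((w y * ∏ i ∈ Finset.range k, rieszFactor (t i) (ζ i) (a i) y : ℝ) : ℂ) *
        fourier m y ∂haarT = 0) ∧
    ∫ y, ((w y * ∏ i ∈ Finset.range k, rieszFactor (t i) (ζ i) (a i) y : ℝ) : ℂ) *
        fourier 0 y ∂haarT =
        (∏ i ∈ Finset.range k, Real.cosh (t i) : ℝ) * ∫ y, (w y : ℂ) ∂haarT := by
  induction k with
  | zero => simpa using hs
  | succ k ih =>
    obtain ⟨ih1, ih2⟩ := ih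
    constructor
    · intro m hm
      have := ha k
      rw [integral_mul_prod_rieszFactor_succ t ζ hw, ih1 m, ih1 (m + a k), ih1 (m - a k)]
      · simp
      all_goals rw [le_abs] at hm ⊢; omega
    · rw [integral_mul_prod_rieszFactor_succ t ζ hw, ih2, ih1 (0 + a k), ih1 (0 - a k),
        Finset.prod_range_succ]
      · push_cast; ring
      all_goals rw [le_abs]; omega

lemma integral_mul_exp_le (hw : Continuous w) (hw0 : ∀ y, 0 ≤ w y)
    (ha : ∀ i, 2 * a i ≤ a (i + 1))
    (hs : ∀ m : ℤ, (a 0 : ℤ) ≤ |m| → ∫ y, (w y : ℂ) * fourier m y ∂haarT = 0)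
    (c : ℕ → ℂ) (k : ℕ) :
    ∫ y, w y * Real.exp (∑ i ∈ Finset.range k, (c i * fourier (a i) y).re) ∂haarT ≤
      Real.exp ((∑ i ∈ Finset.range k, ‖c i‖ ^ 2) / 2) * ∫ y, w y ∂haarT := by
  have hc : ∀ i, ∃ ζ : ℂ, ‖ζ‖ ≤ 1 ∧ c i = ζ * (‖c i‖ : ℝ) := by
    intro i
    rcases eq_or_ne (c i) 0 with h | h
    · exact ⟨0, by simp, by simp [h]⟩
    · have h' : ‖c i‖ ≠ 0 := norm_ne_zero_iff.2 h
      refine ⟨c i / ‖c i‖, by simp [h'], ?_⟩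
      rw [div_mul_cancel₀]
      exact_mod_cast h'
  choose ζ hζ hζc using hc
  have key := (integral_mul_prod_rieszFactor (fun i => ‖c i‖) ζ hw ha hs k).2
  simp only [fourier_zero, mul_one] at key
  rw [integral_complex_ofReal, integral_complex_ofReal] at key
  norm_cast at key
  have hcont := fun i => continuous_rieszFactor ‖c i‖ (ζ i) (a i)
  calc _ ≤ ∫ y, w y * ∏ i ∈ Finset.range k, rieszFactor ‖c i‖ (ζ i) (a i) y ∂haarT := by
        refine integral_mono (BddMeas.of_continuous (by fun_prop)).integrable
          (BddMeas.of_continuous (by fun_prop)).integrable fun y => ?_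
        refine mul_le_mul_of_nonneg_left ?_ (hw0 y)
        rw [Real.exp_sum]
        refine Finset.prod_le_prod (fun i _ => (Real.exp_pos _).le) fun i _ => ?_
        refine le_trans (le_of_eq ?_) (exp_le_rieszFactor ‖c i‖ (hζ i) (a i) y)
        conv_lhs => rw [hζc i, mul_right_comm, Complex.re_mul_ofReal]
    _ = (∏ i ∈ Finset.range k, Real.cosh ‖c i‖) * ∫ y, w y ∂haarT := key
    _ ≤ _ := by
        refine mul_le_mul_of_nonneg_right ?_ (integral_nonneg hw0)
        rw [Finset.sum_div, Real.exp_sum]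
        exact Finset.prod_le_prod (fun i _ => (Real.cosh_pos _).le)
          fun i _ => Real.cosh_le_exp_half_sq _

end riesz

/-- A Fejér-type weight adapted to a dyadic arc. -/
def fejerWeight (q : ℕ × ℕ) (y : Tor) : ℝ :=
  ‖∑ n ∈ Finset.range (2 ^ q.1 / 8 + 1), (fourier n (y - center q) : ℂ)‖ ^ 2 /
    (2 ^ q.1 / 8 + 1 : ℕ) ^ 2

lemma continuous_fejerWeight (q : ℕ × ℕ) : Continuous (fejerWeight q) := by
  unfold fejerWeight
  fun_prop

lemma fejerWeight_nonneg (q : ℕ × ℕ) (y : Tor) : 0 ≤ fejerWeight q y := by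
  unfold fejerWeight; positivity

lemma le_fejerWeight {q : ℕ × ℕ} (hq : q.2 < 2 ^ q.1) {y : Tor} (hy : y ∈ cube q) :
    1 / 3 ≤ fejerWeight q y := by
  set N := 2 ^ q.1 / 8 + 1 with hN
  have hN8 : ((N - 1 : ℕ) : ℝ) * side q ≤ 1 / 8 := by
    have : (N - 1) * 8 ≤ 2 ^ q.1 := by omega
    have : ((N - 1 : ℕ) : ℝ) * 8 ≤ 2 ^ q.1 := by exact_mod_cast this
    rw [side, ← div_eq_mul_inv, div_le_iff₀ (by positivity)]
    linarith
  have hn : ∀ n ∈ Finset.range N, ‖(1 : ℂ) - fourier n (y - center q)‖ ≤ 2 / 5 := by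
    intro n hn
    have h1 : n ≤ N - 1 := by rw [Finset.mem_range] at hn; omega
    have h1' : (n : ℝ) ≤ (N - 1 : ℕ) := by exact_mod_cast h1
    have h2 := norm_fourier_sub_le n (y - center q) 0
    rw [fourier_eval_zero, chord, fourier_eval_zero, norm_sub_rev,
      norm_sub_rev (fourier 1 _ : ℂ), ← chord_sub] at h2
    have h3 := chord_center_le hq hy
    have hpi := pi_lt_d2
    have hs := side_pos q
    have hd := chord_nonneg y (center q)
    calc _ ≤ (n : ℝ) * chord y (center q) := h2
      _ ≤ (N - 1 : ℕ) * (π * side q) := by gcongr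
      _ = π * ((N - 1 : ℕ) * side q) := by ring
      _ ≤ 3.15 * (1 / 8) := by gcongr
      _ ≤ 2 / 5 := by norm_num
  have hsum : (3 / 5 : ℝ) * N ≤ ‖∑ n ∈ Finset.range N, (fourier n (y - center q) : ℂ)‖ := by
    have h1 : ‖∑ n ∈ Finset.range N, ((1 : ℂ) - fourier n (y - center q))‖ ≤ N * (2 / 5) := by
      refine (norm_sum_le_of_le _ hn).trans (le_of_eq ?_)
      simp
    rw [Finset.sum_sub_distrib] at h1
    have h2 := norm_sub_norm_le (∑ n ∈ Finset.range N, (1 : ℂ))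
      (∑ n ∈ Finset.range N, (fourier n (y - center q) : ℂ))
    have h3 : ‖∑ n ∈ Finset.range N, (1 : ℂ)‖ = N := by simp
    rw [h3] at h2
    linarith
  have hNpos : (0 : ℝ) < N := by rw [hN]; positivity
  unfold fejerWeight
  rw [← hN, le_div_iff₀ (by positivity)]
  nlinarith

lemma ofReal_sq_norm_sum_fourier (N : ℕ) (z : Tor) :
    ((‖∑ n ∈ Finset.range N, (fourier n z : ℂ)‖ ^ 2 : ℝ) : ℂ) =
      ∑ n ∈ Finset.range N, ∑ m ∈ Finset.range N, fourier (m - n : ℤ) z := by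
  rw [Complex.ofReal_pow, ← Complex.conj_mul', map_sum, Finset.sum_mul_sum]
  refine Finset.sum_congr rfl fun n _ => Finset.sum_congr rfl fun m _ => ?_
  rw [← fourier_neg, ← fourier_add]
  congr 2; ring

lemma integral_fejerWeight_mul_fourier (q : ℕ × ℕ) (m : ℤ) :
    ∫ y, (fejerWeight q y : ℂ) * fourier m y ∂haarT =
      fourier m (center q) / ((2 ^ q.1 / 8 + 1 : ℕ) : ℂ) ^ 2 *
        ∑ n ∈ Finset.range (2 ^ q.1 / 8 + 1), ∑ n' ∈ Finset.range (2 ^ q.1 / 8 + 1),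
          if (n' - n + m : ℤ) = 0 then 1 else 0 := by
  set N := 2 ^ q.1 / 8 + 1 with hN
  have h1 : ∀ y, (fejerWeight q y : ℂ) * fourier m y =
      fourier m (center q) / (N : ℂ) ^ 2 * ∑ n ∈ Finset.range N, ∑ n' ∈ Finset.range N,
        (fourier (n' - n + m : ℤ) (y - center q) : ℂ) := by
    intro y
    have : (fourier m y : ℂ) = fourier m (center q) * fourier m (y - center q) := by
      rw [← fourier_add_arg]; congr 1; abel
    simp only [fourier_add, ← Finset.sum_mul]
    rw [this, fejerWeight, ← hN, Complex.ofReal_div, ofReal_sq_norm_sum_fourier]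
    push_cast
    ring
  simp only [h1]
  rw [integral_const_mul, integral_sub_right_eq_self (fun z => ∑ n ∈ Finset.range N,
    ∑ n' ∈ Finset.range N, (fourier (n' - n + m : ℤ) z : ℂ)), integral_finsetSum]
  · congr 1
    refine Finset.sum_congr rfl fun n _ => ?_
    rw [integral_finsetSum]
    · simp only [integral_fourier]
    · exact fun n' _ => (bddMeas_fourier _).integrable
  · exact fun n _ => (BddMeas.sum _ fun n' _ => bddMeas_fourier _).integrable

lemma integral_fejerWeight_mul_fourier_eq_zero {q : ℕ × ℕ} {m : ℤ} (hm : (2 ^ q.1 : ℤ) ≤ |m|) :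
    ∫ y, (fejerWeight q y : ℂ) * fourier m y ∂haarT = 0 := by
  rw [integral_fejerWeight_mul_fourier, Finset.sum_eq_zero, mul_zero]
  refine fun n hn => Finset.sum_eq_zero fun n' hn' => if_neg ?_
  rw [Finset.mem_range] at hn hn'
  have h : (1 : ℕ) ≤ 2 ^ q.1 := Nat.one_le_two_pow
  zify at h hn hn'
  rw [le_abs] at hm
  omega

lemma integral_fejerWeight_le (q : ℕ × ℕ) : ∫ y, fejerWeight q y ∂haarT ≤ 8 * side q := by
  have h := integral_fejerWeight_mul_fourier q 0
  simp only [fourier_zero, mul_one, add_zero, sub_eq_zero, Nat.cast_inj] at h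
  rw [integral_complex_ofReal] at h
  have h8 : (2 ^ q.1 : ℝ) ≤ 8 * (2 ^ q.1 / 8 + 1 : ℕ) := by
    have : 2 ^ q.1 ≤ 8 * (2 ^ q.1 / 8 + 1) := by omega
    exact_mod_cast this
  set N := 2 ^ q.1 / 8 + 1
  have hN : (N : ℝ) ≠ 0 := by simp [N]; positivity
  have h' : ∫ y, fejerWeight q y ∂haarT = (N : ℝ)⁻¹ := by
    have : ((∫ y, fejerWeight q y ∂haarT : ℝ) : ℂ) = ((N : ℝ)⁻¹ : ℝ) := by
      rw [h, Finset.sum_congr rfl fun n hn =>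
        Finset.sum_ite_eq' (Finset.range N) n fun _ => (1 : ℂ)]
      have : (N : ℂ) ≠ 0 := by exact_mod_cast hN
      simp only [Finset.sum_ite_mem, Finset.inter_self, Finset.sum_const, Finset.card_range]
      push_cast
      field_simp
      simp
    exact_mod_cast this
  rw [h', side, inv_le_comm₀ (by positivity) (by positivity [side_pos q]), mul_inv, inv_inv]
  linarith

lemma setIntegral_exp_le {q : ℕ × ℕ} (hq : q.2 < 2 ^ q.1) {a : ℕ → ℕ} (ha0 : 2 ^ q.1 ≤ a 0)
    (ha : ∀ i, 2 * a i ≤ a (i + 1)) (c : ℕ → ℂ) (k : ℕ) :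
    ∫ y in cube q, Real.exp (∑ i ∈ Finset.range k, (c i * fourier (a i) y).re) ∂haarT ≤
      24 * side q * Real.exp ((∑ i ∈ Finset.range k, ‖c i‖ ^ 2) / 2) := by
  have hw := continuous_fejerWeight q
  have h1 : Continuous fun y : Tor =>
      Real.exp (∑ i ∈ Finset.range k, (c i * fourier (a i) y).re) := by
    fun_prop
  have h2 : BddMeas fun y : Tor => fejerWeight q y *
      Real.exp (∑ i ∈ Finset.range k, (c i * fourier (a i) y).re) :=
    BddMeas.of_continuous (hw.mul h1)
  have h3 := integral_mul_exp_le hw (fejerWeight_nonneg q) ha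
    (fun m hm => integral_fejerWeight_mul_fourier_eq_zero
      (le_trans (by exact_mod_cast ha0) hm)) c k
  have h4 := integral_fejerWeight_le q
  have h5 := Real.exp_pos ((∑ i ∈ Finset.range k, ‖c i‖ ^ 2) / 2)
  calc _ ≤ ∫ y in cube q, 3 * (fejerWeight q y *
          Real.exp (∑ i ∈ Finset.range k, (c i * fourier (a i) y).re)) ∂haarT := by
        refine setIntegral_mono_on (BddMeas.of_continuous h1).integrable.integrableOn
          (((BddMeas.const 3).mul h2).integrable.integrableOn) (measurableSet_cube q) fun y hy => ?_
        have := le_fejerWeight hq hy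
        have := Real.exp_pos (∑ i ∈ Finset.range k, (c i * fourier (a i) y).re)
        nlinarith
    _ ≤ ∫ y, 3 * (fejerWeight q y *
          Real.exp (∑ i ∈ Finset.range k, (c i * fourier (a i) y).re)) ∂haarT :=
        setIntegral_le_integral ((BddMeas.const 3).mul h2).integrable
          (Filter.Eventually.of_forall fun y => mul_nonneg (by norm_num)
            (mul_nonneg (fejerWeight_nonneg q y) (Real.exp_pos _).le))
    _ ≤ _ := by
        rw [integral_const_mul]
        nlinarith

/-- The Young function `s ↦ s √(log (e + s))`. -/
def young (s : ℝ) : ℝ := s * √(Real.log (Real.exp 1 + s))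

lemma one_le_log_exp_add {s : ℝ} (hs : 0 ≤ s) : 1 ≤ Real.log (Real.exp 1 + s) := by
  rw [Real.le_log_iff_exp_le (by positivity)]; linarith

lemma le_young {s : ℝ} (hs : 0 ≤ s) : s ≤ young s :=
  le_mul_of_one_le_right hs (Real.one_le_sqrt.2 (one_le_log_exp_add hs))

lemma continuous_young_comp {s : Tor → ℝ} (hs : Continuous s) (h0 : ∀ x, 0 ≤ s x) :
    Continuous fun x => young (s x) := by
  have : ∀ x, Real.exp 1 + s x ≠ 0 := fun x => by have := h0 x; positivity
  unfold young
  fun_prop (disch := assumption)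

lemma mul_le_young_add_exp {s : ℝ} (hs : 0 ≤ s) (k : ℕ) :
    s * (k + 1) ≤ 4 * young s + 4 * Real.exp (k ^ 2 / 4) := by
  have hL := one_le_log_exp_add hs
  have hexp := Real.add_one_le_exp ((k : ℝ) ^ 2 / 8)
  have he : Real.exp ((k : ℝ) ^ 2 / 4) = Real.exp (k ^ 2 / 8) * Real.exp (k ^ 2 / 8) := by
    rw [← Real.exp_add]; ring_nf
  rcases le_total s (Real.exp (k ^ 2 / 8)) with h | h
  · have h0 := hs.trans (le_young hs)
    rw [he]
    have : (k + 1 : ℝ) ≤ 4 * Real.exp (k ^ 2 / 8) := by nlinarith [sq_nonneg ((k : ℝ) - 1)]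
    calc s * (k + 1) ≤ Real.exp (k ^ 2 / 8) * (4 * Real.exp (k ^ 2 / 8)) := by gcongr
      _ ≤ _ := by linarith
  · have h1 : (k : ℝ) ^ 2 / 8 ≤ Real.log (Real.exp 1 + s) := by
      rw [Real.le_log_iff_exp_le (by positivity)]
      linarith [Real.exp_pos 1]
    have h2 : (k + 1 : ℝ) ≤ 4 * √(Real.log (Real.exp 1 + s)) := by
      have : (k + 1 : ℝ) / 4 ≤ √(Real.log (Real.exp 1 + s)) := by
        apply Real.le_sqrt_of_sq_le
        nlinarith [sq_nonneg ((k : ℝ) - 1)]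
      linarith
    have h3 : s * (k + 1) ≤ s * (4 * √(Real.log (Real.exp 1 + s))) := by gcongr
    have := Real.exp_pos ((k : ℝ) ^ 2 / 4)
    unfold young
    linarith

lemma mul_abs_le_young_add_sum {s : ℝ} (hs : 0 ≤ s) (x : ℝ) {K : ℕ} (hK : |x| < K) :
    s * |x| ≤ 4 * young s + 4 * ∑ k ∈ Finset.range K,
      Real.exp (-(3 * k ^ 2 / 4)) * (Real.exp (k * x) + Real.exp (-(k * x))) := by
  set k := ⌊|x|⌋₊
  have hk : k ∈ Finset.range K := by
    rw [Finset.mem_range, Nat.floor_lt (abs_nonneg x)]; exact hK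
  have h1 : |x| ≤ k + 1 := (Nat.lt_floor_add_one |x|).le
  have h2 : (k : ℝ) ≤ |x| := Nat.floor_le (abs_nonneg x)
  have h3 : Real.exp (k * |x|) ≤ Real.exp (k * x) + Real.exp (-(k * x)) := by
    rcases abs_cases x with ⟨h, -⟩ | ⟨h, -⟩ <;> rw [h]
    · linarith [Real.exp_pos (-(k * x))]
    · rw [mul_neg]; linarith [Real.exp_pos (k * x)]
  have h4 : Real.exp ((k : ℝ) ^ 2 / 4) ≤
      Real.exp (-(3 * k ^ 2 / 4)) * (Real.exp (k * x) + Real.exp (-(k * x))) := by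
    refine le_trans ?_ (mul_le_mul_of_nonneg_left h3 (Real.exp_pos _).le)
    rw [← Real.exp_add, Real.exp_le_exp]
    nlinarith [mul_le_mul_of_nonneg_left h2 (Nat.cast_nonneg (α := ℝ) k)]
  have h5 := Finset.single_le_sum (f := fun k : ℕ => Real.exp (-(3 * (k : ℝ) ^ 2 / 4)) *
    (Real.exp (k * x) + Real.exp (-(k * x)))) (fun i _ => by positivity) hk
  have h6 := mul_le_young_add_exp hs k
  have h7 : s * |x| ≤ s * (k + 1) := by gcongr
  linarith

lemma sum_exp_neg_sq_le (K : ℕ) : ∑ k ∈ Finset.range K, Real.exp (-((k : ℝ) ^ 2 / 4)) ≤ 5 := by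
  have h1 : Real.exp (-(1 / 4)) ≤ 4 / 5 := by
    rw [Real.exp_neg, inv_le_comm₀ (Real.exp_pos _) (by norm_num)]
    linarith [Real.add_one_le_exp (1 / 4 : ℝ)]
  have h2 : ∀ k : ℕ, Real.exp (-((k : ℝ) ^ 2 / 4)) ≤ (4 / 5) ^ k := by
    intro k
    refine le_trans ?_ (pow_le_pow_left₀ (Real.exp_pos _).le h1 k)
    rw [← Real.exp_nat_mul, Real.exp_le_exp]
    have : (k : ℝ) ≤ k ^ 2 := by exact_mod_cast Nat.le_self_pow two_ne_zero k
    linarith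
  refine (Finset.sum_le_sum fun k _ => h2 k).trans ?_
  rw [geom_sum_eq (by norm_num)]
  have : (0 : ℝ) < (4 / 5) ^ K := by positivity
  rw [div_le_iff_of_neg (by norm_num)]
  linarith

section zygmund
variable {q : ℕ × ℕ} {a : ℕ → ℕ}

lemma setIntegral_mul_abs_re_le (hq : q.2 < 2 ^ q.1) (ha0 : 2 ^ q.1 ≤ a 0)
    (ha : ∀ i, 2 * a i ≤ a (i + 1)) {s : Tor → ℝ} (hs : Continuous s) (hs0 : ∀ x, 0 ≤ s x)
    (c : ℕ → ℂ) (n : ℕ) (hc : ∑ i ∈ Finset.range n, ‖c i‖ ^ 2 ≤ 1) :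
    ∫ y in cube q, s y * |∑ i ∈ Finset.range n, (c i * fourier (a i) y).re| ∂haarT ≤
      4 * (∫ y in cube q, young (s y) ∂haarT) + 960 * side q := by
  set X : Tor → ℝ := fun y => ∑ i ∈ Finset.range n, (c i * fourier (a i) y).re with hX
  have hXc : Continuous X := by fun_prop
  obtain ⟨-, B, hB⟩ := BddMeas.of_continuous hXc
  obtain ⟨K, hK⟩ := exists_nat_gt B
  have hyc := continuous_young_comp hs hs0
  have hexp : ∀ (k : ℕ), ∫ y in cube q, Real.exp (k * X y) ∂haarT ≤
      24 * side q * Real.exp (k ^ 2 / 2) ∧ ∫ y in cube q, Real.exp (-(k * X y)) ∂haarT ≤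
      24 * side q * Real.exp (k ^ 2 / 2) := by
    intro k
    have hz : ∀ z : ℝ, z ^ 2 = k ^ 2 → ∫ y in cube q, Real.exp (z * X y) ∂haarT ≤
        24 * side q * Real.exp (k ^ 2 / 2) := by
      intro z hz
      have h := setIntegral_exp_le hq ha0 ha (fun i => z * c i) n
      simp only [mul_assoc, Complex.re_ofReal_mul, ← Finset.mul_sum, norm_mul, mul_pow,
        Complex.norm_real, Real.norm_eq_abs, sq_abs, hz] at h
      refine h.trans ?_
      have := side_pos q
      rw [← mul_assoc]
      gcongr
      exact mul_le_of_le_one_right (by positivity) hc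
    refine ⟨hz _ rfl, ?_⟩
    have := hz (-k) (by ring)
    simpa only [neg_mul] using this
  have hI : ∀ {g : Tor → ℝ}, Continuous g → IntegrableOn g (cube q) haarT :=
    fun hg => (BddMeas.of_continuous hg).integrable.integrableOn
  calc _ ≤ ∫ y in cube q, (4 * young (s y) + 4 * ∑ k ∈ Finset.range K,
          Real.exp (-(3 * k ^ 2 / 4)) * (Real.exp (k * X y) + Real.exp (-(k * X y)))) ∂haarT := by
        refine setIntegral_mono (hI (by fun_prop)) (hI (by fun_prop)) fun y => ?_
        exact mul_abs_le_young_add_sum (hs0 y) (X y) ((hB y).trans_lt hK)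
    _ = 4 * (∫ y in cube q, young (s y) ∂haarT) + 4 * ∑ k ∈ Finset.range K,
          Real.exp (-(3 * k ^ 2 / 4)) * (∫ y in cube q, Real.exp (k * X y) ∂haarT +
            ∫ y in cube q, Real.exp (-(k * X y)) ∂haarT) := by
        rw [integral_add (hI (by fun_prop)) (hI (by fun_prop)), integral_const_mul,
          integral_const_mul, integral_finsetSum _ fun k _ => hI (by fun_prop)]
        congr 2
        refine Finset.sum_congr rfl fun k _ => ?_
        rw [integral_const_mul, integral_add (hI (by fun_prop)) (hI (by fun_prop))]
    _ ≤ 4 * (∫ y in cube q, young (s y) ∂haarT) + 4 * ∑ k ∈ Finset.range K,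
          48 * side q * Real.exp (-((k : ℝ) ^ 2 / 4)) := by
        refine add_le_add le_rfl
          (mul_le_mul_of_nonneg_left (Finset.sum_le_sum fun k _ => ?_) (by norm_num))
        have h1 : Real.exp (-((k : ℝ) ^ 2 / 4)) =
            Real.exp (-(3 * k ^ 2 / 4)) * Real.exp (k ^ 2 / 2) := by
          rw [← Real.exp_add]; ring_nf
        obtain ⟨h2, h3⟩ := hexp k
        have h4 := Real.exp_pos (-(3 * (k : ℝ) ^ 2 / 4))
        rw [h1]
        nlinarith
    _ ≤ _ := by
        rw [← Finset.mul_sum]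
        have := sum_exp_neg_sq_le K
        have := side_pos q
        nlinarith

lemma young_two_le : young 2 ≤ 4 := by
  have h1 : Real.log (Real.exp 1 + 2) ≤ 2 ^ 2 := by
    refine (Real.log_le_sub_one_of_pos (by positivity)).trans ?_
    linarith [Real.exp_one_lt_d9]
  have h2 : √(Real.log (Real.exp 1 + 2)) ≤ 2 := Real.sqrt_le_iff.2 ⟨by norm_num, h1⟩
  unfold young
  linarith

lemma setIntegral_add_two_mul_abs_re_le (hq : q.2 < 2 ^ q.1) (ha0 : 2 ^ q.1 ≤ a 0)
    (ha : ∀ i, 2 * a i ≤ a (i + 1)) {s : Tor → ℝ} (hs : Continuous s) (hs0 : ∀ x, 0 ≤ s x)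
    (hy : ∫ y in cube q, young (s y) ∂haarT ≤ 2 * side q)
    (c : ℕ → ℂ) (n : ℕ) (hc : ∑ i ∈ Finset.range n, ‖c i‖ ^ 2 ≤ 1) :
    ∫ y in cube q, (s y + 2) * |∑ i ∈ Finset.range n, (c i * fourier (a i) y).re| ∂haarT ≤
      1944 * side q := by
  have h1 := setIntegral_mul_abs_re_le hq ha0 ha hs hs0 c n hc
  have h2 := setIntegral_mul_abs_re_le hq ha0 ha (continuous_const (y := (2 : ℝ)))
    (fun _ => by norm_num) c n hc
  rw [setIntegral_const, haarT_cube hq, smul_eq_mul] at h2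
  have hI : ∀ {g : Tor → ℝ}, Continuous g → IntegrableOn g (cube q) haarT :=
    fun hg => (BddMeas.of_continuous hg).integrable.integrableOn
  simp only [add_mul]
  rw [integral_add (hI (by fun_prop)) (hI (by fun_prop))]
  have h3 := young_two_le
  have h4 := side_pos q
  nlinarith

/-- Zygmund's inequality for the coefficients of a lacunary sequence, localised to an arc. -/
theorem sum_sq_norm_setIntegral_le (hq : q.2 < 2 ^ q.1) (ha0 : 2 ^ q.1 ≤ a 0)
    (ha : ∀ i, 2 * a i ≤ a (i + 1)) {s : Tor → ℝ} (hs : Continuous s) (hs0 : ∀ x, 0 ≤ s x)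
    (hy : ∫ y in cube q, young (s y) ∂haarT ≤ 2 * side q) {h : Tor → ℂ} (hh : BddMeas h)
    {β : ℝ} (hb : ∀ y ∈ cube q, ‖h y‖ ≤ β * (s y + 2)) (n : ℕ) :
    ∑ i ∈ Finset.range n, ‖∫ y in cube q, fourier (-a i) y * h y ∂haarT‖ ^ 2 ≤
      (4000 * β * side q) ^ 2 := by
  set v : ℕ → ℂ := fun i => ∫ y in cube q, fourier (-a i) y * h y ∂haarT with hv
  set V := √(∑ i ∈ Finset.range n, ‖v i‖ ^ 2) with hV
  have hV2 : V ^ 2 = ∑ i ∈ Finset.range n, ‖v i‖ ^ 2 :=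
    Real.sq_sqrt (Finset.sum_nonneg fun i _ => by positivity)
  rw [← hV2]
  have hV0 : 0 ≤ V := Real.sqrt_nonneg _
  suffices V ≤ 4000 * β * side q from pow_le_pow_left₀ hV0 this 2
  have hℓ := side_pos q
  have hβ : 0 ≤ β := by
    have h1 := hb (center q) (center_mem_cube hq)
    have h2 := hs0 (center q)
    have h3 := norm_nonneg (h (center q))
    by_contra! hneg
    nlinarith
  rcases eq_or_lt_of_le hV0 with hz | hpos
  · rw [← hz]; positivity
  set c : ℕ → ℂ := fun i => v i / V with hc
  have hcs : ∑ i ∈ Finset.range n, ‖c i‖ ^ 2 = 1 := by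
    simp only [hc, norm_div, div_pow, Complex.norm_real, Real.norm_eq_abs, sq_abs]
    rw [← Finset.sum_div, ← hV2, div_self (by positivity)]
  set G : Tor → ℂ := fun y => ∑ i ∈ Finset.range n, c i * fourier (a i) y with hG
  have hGc : Continuous G := by fun_prop
  have hVe : (V : ℂ) = ∫ y in cube q, starRingEnd ℂ (G y) * h y ∂haarT := by
    have h1 : ∀ y, starRingEnd ℂ (G y) * h y =
        ∑ i ∈ Finset.range n, starRingEnd ℂ (c i) * (fourier (-a i) y * h y) := by
      intro y
      rw [hG, map_sum, Finset.sum_mul]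
      refine Finset.sum_congr rfl fun i _ => ?_
      rw [map_mul, ← fourier_neg, mul_assoc]
    simp only [h1]
    rw [integral_finsetSum _ fun i _ => (BddMeas.mul (BddMeas.const _)
      ((bddMeas_fourier _).mul hh)).integrable.integrableOn]
    simp only [integral_const_mul]
    have h2 : ∀ i, starRingEnd ℂ (c i) * v i = ((‖v i‖ ^ 2 / V : ℝ) : ℂ) := by
      intro i
      rw [hc, map_div₀, Complex.conj_ofReal, div_mul_eq_mul_div, Complex.conj_mul']
      push_cast; rfl
    rw [Finset.sum_congr rfl fun i _ => h2 i, ← Complex.ofReal_sum, ← Finset.sum_div, ← hV2]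
    congr 1
    field_simp
  have hnorm : V ≤ ∫ y in cube q, ‖starRingEnd ℂ (G y) * h y‖ ∂haarT := by
    calc V = ‖(V : ℂ)‖ := by rw [Complex.norm_real, Real.norm_of_nonneg hV0]
      _ ≤ _ := by rw [hVe]; exact norm_integral_le_integral_norm _
  have hre : ∀ y, (G y).re = ∑ i ∈ Finset.range n, (c i * fourier (a i) y).re := fun y => by
    rw [hG, Complex.re_sum]
  have him : ∀ y, (G y).im = ∑ i ∈ Finset.range n, (-I * c i * fourier (a i) y).re := fun y => by
    rw [hG, Complex.im_sum]
    refine Finset.sum_congr rfl fun i _ => ?_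
    rw [mul_assoc]; simp
  have h1 := setIntegral_add_two_mul_abs_re_le hq ha0 ha hs hs0 hy c n hcs.le
  have h2 := setIntegral_add_two_mul_abs_re_le hq ha0 ha hs hs0 hy (fun i => -I * c i) n
    (by simpa using hcs.le)
  simp only [← hre] at h1
  simp only [← him] at h2
  have hI : ∀ {g : Tor → ℝ}, Continuous g → IntegrableOn g (cube q) haarT :=
    fun hg => (BddMeas.of_continuous hg).integrable.integrableOn
  have hrec : Continuous fun y => (G y).re := Complex.continuous_re.comp hGc
  have himc : Continuous fun y => (G y).im := Complex.continuous_im.comp hGc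
  calc V ≤ _ := hnorm
    _ ≤ ∫ y in cube q, β * ((s y + 2) * |(G y).re| + (s y + 2) * |(G y).im|) ∂haarT := by
        refine setIntegral_mono_on ?_ (hI (by fun_prop)) (measurableSet_cube q) fun y hyq => ?_
        · exact (((BddMeas.of_continuous (by fun_prop)).mul hh).norm).integrable.integrableOn
        · rw [norm_mul, RCLike.norm_conj]
          have h3 := Complex.norm_le_abs_re_add_abs_im (G y)
          calc _ ≤ (|(G y).re| + |(G y).im|) * (β * (s y + 2)) := by
                have := hb y hyq
                gcongr
            _ = _ := by ring
    _ = β * (∫ y in cube q, (s y + 2) * |(G y).re| ∂haarT +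
          ∫ y in cube q, (s y + 2) * |(G y).im| ∂haarT) := by
        rw [integral_const_mul, integral_add (hI (by fun_prop)) (hI (by fun_prop))]
    _ ≤ β * (1944 * side q + 1944 * side q) := by gcongr
    _ ≤ _ := by nlinarith [mul_nonneg hβ hℓ.le]

end zygmund

/-- A monotone sequence which at least doubles after `M` steps. -/
structure Doubling (A : ℕ → ℕ) (M : ℕ) : Prop where
  mono : Monotone A
  pos : 0 < M
  two_mul_le : ∀ j, 2 * A j ≤ A (j + M)

namespace Doubling
variable {A : ℕ → ℕ} {M : ℕ}

lemma sum_le (hA : Doubling A M) (t : ℕ) : ∑ j ∈ Finset.range (t + 1), A j ≤ 2 * M * A t := by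
  induction t using Nat.strong_induction_on with
  | _ t ih =>
    rcases lt_or_ge t M with h | h
    · calc ∑ j ∈ Finset.range (t + 1), A j ≤ ∑ j ∈ Finset.range (t + 1), A t :=
            Finset.sum_le_sum fun j hj => hA.mono (by rw [Finset.mem_range] at hj; omega)
        _ = (t + 1) * A t := by simp
        _ ≤ 2 * M * A t := Nat.mul_le_mul_right _ (by omega)
    · obtain ⟨t', rfl⟩ := Nat.exists_eq_add_of_le' h
      have h1 := ih t' (by have := hA.pos; omega)
      have h2 := hA.two_mul_le t'
      rw [show t' + M + 1 = t' + 1 + M by ring, Finset.sum_range_add]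
      have h3 : ∑ x ∈ Finset.range M, A (t' + 1 + x) ≤ ∑ x ∈ Finset.range M, A (t' + M) :=
        Finset.sum_le_sum fun j hj => hA.mono (by rw [Finset.mem_range] at hj; omega)
      rw [Finset.sum_const, Finset.card_range, smul_eq_mul] at h3
      nlinarith

lemma sum_filter_lt_le (hA : Doubling A M) (N n : ℕ) :
    ∑ j ∈ Finset.range n with A j < N, A j ≤ 2 * M * N := by
  induction n with
  | zero => simp
  | succ n ih =>
    by_cases h : A n < N
    · calc _ ≤ ∑ j ∈ Finset.range (n + 1), A j :=
            Finset.sum_le_sum_of_subset (Finset.filter_subset _ _)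
        _ ≤ 2 * M * A n := hA.sum_le n
        _ ≤ _ := Nat.mul_le_mul_left _ h.le
    · rwa [Finset.range_add_one, Finset.filter_insert, if_neg h]

lemma sum_filter_le_le (hA : Doubling A M) {N : ℕ} {g : ℕ → ℝ} (hg : ∀ a, 0 ≤ g a) {H : ℝ}
    (hhi : ∀ a : ℕ → ℕ, N ≤ a 0 → (∀ i, 2 * a i ≤ a (i + 1)) → ∀ n,
      ∑ i ∈ Finset.range n, g (a i) ≤ H) (n : ℕ) :
    ∑ j ∈ Finset.range n with ¬ A j < N, g (A j) ≤ M * H := by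
  classical
  have hH : 0 ≤ H := by
    have := hhi (fun i => N * 2 ^ i) (by simp) (fun i => le_of_eq (by ring)) 0
    simpa using this
  by_cases hex : ∃ j, N ≤ A j
  · let j0 := Nat.find hex
    have hj0 : N ≤ A j0 := Nat.find_spec hex
    have hmin : ∀ j, N ≤ A j → j0 ≤ j := fun j hj => Nat.find_min' hex hj
    rw [← Finset.sum_fiberwise_of_maps_to (t := Finset.range M) (g := fun j => (j - j0) % M)
      (fun j _ => Finset.mem_range.2 (Nat.mod_lt _ hA.pos))]
    calc _ ≤ ∑ i ∈ Finset.range M, H := Finset.sum_le_sum fun i _ => ?_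
      _ = M * H := by simp
    have hinj : Function.Injective fun k => j0 + i + k * M := by
      intro k k' h
      have : k * M = k' * M := by simpa using h
      exact Nat.eq_of_mul_eq_mul_right hA.pos this
    refine le_trans ?_ (hhi (fun k => A (j0 + i + k * M))
      (hj0.trans (hA.mono (by omega))) (fun k => ?_) n)
    · rw [← Finset.sum_image (f := fun j => g (A j)) (g := fun k => j0 + i + k * M)
        (hinj.injOn)]
      refine Finset.sum_le_sum_of_subset_of_nonneg (fun j hj => ?_) fun _ _ _ => hg _
      simp only [Finset.mem_filter, Finset.mem_range, not_lt] at hj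
      obtain ⟨⟨hjn, hjN⟩, hji⟩ := hj
      have h1 := hmin j hjN
      have h2 := Nat.mod_add_div' (j - j0) M
      have h3 : (j - j0) / M ≤ j - j0 := Nat.div_le_self _ _
      refine Finset.mem_image.2 ⟨(j - j0) / M, Finset.mem_range.2 (by omega), ?_⟩
      omega
    · have := hA.two_mul_le (j0 + i + k * M)
      rwa [add_assoc (j0 + i), ← Nat.succ_mul] at this
  · rw [Finset.sum_eq_zero]
    · positivity
    · intro j hj
      rw [Finset.mem_filter, not_lt] at hj
      exact absurd ⟨j, hj.2⟩ hex

lemma sum_comp_le (hA : Doubling A M) {N : ℕ} {g : ℕ → ℝ} (hg : ∀ a, 0 ≤ g a) {H L : ℝ}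
    (hL : 0 ≤ L)
    (hhi : ∀ a : ℕ → ℕ, N ≤ a 0 → (∀ i, 2 * a i ≤ a (i + 1)) → ∀ n,
      ∑ i ∈ Finset.range n, g (a i) ≤ H)
    (hlo : ∀ a : ℕ, a < N → g a ≤ L * a) (n : ℕ) :
    ∑ j ∈ Finset.range n, g (A j) ≤ M * (H + 2 * N * L) := by
  rw [← Finset.sum_filter_add_sum_filter_not _ (fun j => A j < N)]
  have h1 := hA.sum_filter_le_le hg hhi n
  have h2 : ∑ j ∈ Finset.range n with A j < N, g (A j) ≤ L * (2 * M * N) := by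
    refine (Finset.sum_le_sum fun j hj => hlo _ (Finset.mem_filter.1 hj).2).trans ?_
    rw [← Finset.mul_sum]
    refine mul_le_mul_of_nonneg_left ?_ hL
    exact_mod_cast hA.sum_filter_lt_le N n
  linarith

end Doubling

/-- The average over an arc of the translated kernels `cauchyKer r (x - ·)`. -/
def meanKer (r : ℝ) (q : ℕ × ℕ) (x : Tor) : ℂ :=
  cauchyOp r ((cube q).indicator fun _ => 1) x / side q

/-- A mean-zero function supported in an arc and dominated by `β (s + 2)`, where the Orlicz norm
of `s` on the arc is controlled. -/
structure IsAtom (q : ℕ × ℕ) (s : Tor → ℝ) (β : ℝ) (b : Tor → ℂ) : Prop where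
  idx_lt : q.2 < 2 ^ q.1
  continuous_weight : Continuous s
  weight_nonneg : ∀ x, 0 ≤ s x
  young_le : ∫ y in cube q, young (s y) ∂haarT ≤ 2 * side q
  height_nonneg : 0 ≤ β
  bddMeas : BddMeas b
  eq_zero : ∀ y ∉ cube q, b y = 0
  integral_eq_zero : ∫ y, b y ∂haarT = 0
  integral_norm_le : ∫ y, ‖b y‖ ∂haarT ≤ 4 * β * side q
  norm_le : ∀ y ∈ cube q, ‖b y‖ ≤ β * (s y + 2)

/-- The localised part of the modulated Cauchy integral of an atom. -/
def localErr (r : ℝ) (q : ℕ × ℕ) (b : Tor → ℂ) (a : ℕ) (x : Tor) : ℂ :=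
  cauchyOp r (fun y => fourier (-a) y * b y) x - fourierCoeff b a * meanKer r q x

/-- The localised part, corrected at low frequencies. -/
def correctedErr (r : ℝ) (q : ℕ × ℕ) (b : Tor → ℂ) (a : ℕ) (x : Tor) : ℂ :=
  localErr r q b a x -
    if a * chord x (center q) < 1 then fourier (-a) x * cauchyOp r b x else 0

section kernel
variable {r : ℝ} {q : ℕ × ℕ} {x y : Tor}

lemma half_chord_le (hq : q.2 < 2 ^ q.1) (hx : 16 * side q < chord x (center q))
    (hy : y ∈ cube q) : chord x (center q) / 2 ≤ chord x y := by
  have h1 := chord_center_le hq hy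
  have h2 := chord_triangle x y (center q)
  have h3 := pi_lt_d2
  have h4 := side_pos q
  nlinarith

lemma norm_cauchyKer_le_of_mem (h0 : 0 ≤ r) (h1 : r < 1) (hq : q.2 < 2 ^ q.1)
    (hx : 16 * side q < chord x (center q)) (hy : y ∈ cube q) :
    ‖cauchyKer r (x - y)‖ ≤ 4 / chord x (center q) := by
  have h2 := half_chord_le hq hx hy
  have h4 := side_pos q
  have h5 : 0 < chord x (center q) := by linarith
  refine (norm_cauchyKer_le h0 h1 (by linarith)).trans ?_
  rw [div_le_div_iff₀ (by linarith) (by linarith)]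
  linarith

lemma norm_cauchyKer_sub_le_of_mem (h0 : 0 ≤ r) (h1 : r < 1) (hq : q.2 < 2 ^ q.1)
    (hx : 16 * side q < chord x (center q)) (hy : y ∈ cube q) {z : Tor} (hz : z ∈ cube q) :
    ‖cauchyKer r (x - y) - cauchyKer r (x - z)‖ ≤ 101 * side q / chord x (center q) ^ 2 := by
  have h2 := half_chord_le hq hx hy
  have h3 := half_chord_le hq hx hz
  have h4 := side_pos q
  have h5 : 0 < chord x (center q) := by linarith
  have h6 := chord_le_of_mem_cube hy hz
  have h7 := pi_lt_d2
  have h8 := chord_nonneg x y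
  refine (norm_cauchyKer_sub_le h0 h1 (by linarith) (by linarith)).trans ?_
  calc _ ≤ 4 * (2 * 3.15 * side q) / (chord x (center q) / 2 * (chord x (center q) / 2)) := by
        gcongr
        exact h6.trans (by gcongr)
    _ ≤ _ := by
        rw [div_le_div_iff₀ (by positivity) (by positivity)]
        nlinarith [mul_pos h4 (pow_pos h5 2)]

lemma meanKer_eq (r : ℝ) (q : ℕ × ℕ) (x : Tor) :
    meanKer r q x = (∫ z in cube q, cauchyKer r (x - z) ∂haarT) / side q := by
  unfold meanKer cauchyOp
  rw [← integral_indicator (measurableSet_cube q)]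
  congr 2
  funext z
  by_cases hz : z ∈ cube q <;> simp [hz]

lemma norm_meanKer_le (h0 : 0 ≤ r) (h1 : r < 1) (hq : q.2 < 2 ^ q.1)
    (hx : 16 * side q < chord x (center q)) : ‖meanKer r q x‖ ≤ 4 / chord x (center q) := by
  have hs := side_pos q
  have h := norm_setIntegral_le_of_norm_le_const (μ := haarT) (s := cube q)
    (measure_lt_top _ _) (fun z hz => norm_cauchyKer_le_of_mem h0 h1 hq hx hz)
  rw [haarT_cube hq] at h
  rw [meanKer_eq, norm_div, Complex.norm_real, Real.norm_of_nonneg hs.le, div_le_iff₀ hs]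
  exact h

lemma norm_cauchyKer_sub_meanKer_le (h0 : 0 ≤ r) (h1 : r < 1) (hq : q.2 < 2 ^ q.1)
    (hx : 16 * side q < chord x (center q)) (hy : y ∈ cube q) :
    ‖cauchyKer r (x - y) - meanKer r q x‖ ≤ 101 * side q / chord x (center q) ^ 2 := by
  have hs := side_pos q
  have h := norm_setIntegral_le_of_norm_le_const (μ := haarT) (s := cube q)
    (measure_lt_top _ _) (fun z hz => norm_cauchyKer_sub_le_of_mem h0 h1 hq hx hy hz)
  have hK : Integrable (fun z => cauchyKer r (x - z)) haarT :=
    ((bddMeas_cauchyKer h0 h1).comp (measurable_const.sub measurable_id)).integrable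
  rw [haarT_cube hq, integral_sub (integrable_const _).integrableOn hK.integrableOn,
    setIntegral_const, haarT_cube hq, Complex.real_smul] at h
  have hs' : (side q : ℂ) ≠ 0 := by exact_mod_cast hs.ne'
  have e : cauchyKer r (x - y) - meanKer r q x = (side q * cauchyKer r (x - y) -
      ∫ z in cube q, cauchyKer r (x - z) ∂haarT) / side q := by
    rw [meanKer_eq]; field_simp
  rw [e, norm_div, Complex.norm_real, Real.norm_of_nonneg hs.le, div_le_iff₀ hs]
  exact h

end kernel

namespace IsAtom
variable {r : ℝ} {q : ℕ × ℕ} {s : Tor → ℝ} {β : ℝ} {b : Tor → ℂ} {x : Tor}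

lemma fourierCoeff_zero (hb : IsAtom q s β b) : fourierCoeff b 0 = 0 := by
  rw [fourierCoeff_haarT]
  simpa using hb.integral_eq_zero

/-- Integration of a bounded kernel against an atom. -/
lemma norm_integral_mul_le (hb : IsAtom q s β b) {κ : Tor → ℂ} {B : ℝ}
    (hκ : ∀ y ∈ cube q, ‖κ y‖ ≤ B) : ‖∫ y, κ y * b y ∂haarT‖ ≤ B * (4 * β * side q) := by
  by_cases hB : B < 0
  · exfalso
    have h1 := hκ (center q) (center_mem_cube hb.idx_lt)
    linarith [norm_nonneg (κ (center q))]
  · rw [not_lt] at hB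
    calc _ ≤ ∫ y, B * ‖b y‖ ∂haarT := by
          refine norm_integral_le_of_norm_le ((BddMeas.const B).mul hb.bddMeas.norm).integrable
            (Filter.Eventually.of_forall fun y => ?_)
          by_cases hy : y ∈ cube q
          · rw [norm_mul]; gcongr; exact hκ y hy
          · simp [hb.eq_zero y hy]
      _ ≤ _ := by
          rw [integral_const_mul]
          gcongr
          exact hb.integral_norm_le

lemma localErr_eq (h0 : 0 ≤ r) (h1 : r < 1) (hb : IsAtom q s β b) (a : ℕ) (x : Tor) :
    localErr r q b a x =
      ∫ y, fourier (-a) y * ((cauchyKer r (x - y) - meanKer r q x) * b y) ∂haarT := by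
  unfold localErr cauchyOp
  have hm := (bddMeas_fourier (-a)).mul hb.bddMeas
  rw [fourierCoeff_haarT, mul_comm (integral _ _), ← integral_const_mul, ← integral_sub
    (bddMeas_cauchyKer_mul h0 h1 hm x).integrable ((BddMeas.const _).mul hm).integrable]
  congr 1; funext y; ring

lemma norm_localErr_le (h0 : 0 ≤ r) (h1 : r < 1) (hb : IsAtom q s β b) (a : ℕ)
    (hx : 16 * side q < chord x (center q)) :
    ‖localErr r q b a x‖ ≤ 101 * side q / chord x (center q) ^ 2 * (4 * β * side q) := by
  rw [localErr_eq h0 h1 hb]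
  simp only [← mul_assoc (fourier _ _ : ℂ)]
  refine hb.norm_integral_mul_le fun y hy => ?_
  rw [norm_mul, norm_fourier_apply, one_mul]
  exact norm_cauchyKer_sub_meanKer_le h0 h1 hb.idx_lt hx hy

lemma norm_cauchyOp_le (h0 : 0 ≤ r) (h1 : r < 1) (hb : IsAtom q s β b)
    (hx : 16 * side q < chord x (center q)) :
    ‖cauchyOp r b x‖ ≤ 101 * side q / chord x (center q) ^ 2 * (4 * β * side q) := by
  have h := norm_localErr_le h0 h1 hb 0 hx
  simpa [localErr, hb.fourierCoeff_zero] using h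

lemma sum_sq_norm_integral_le (hb : IsAtom q s β b) {a : ℕ → ℕ} (ha0 : 2 ^ q.1 ≤ a 0)
    (ha : ∀ i, 2 * a i ≤ a (i + 1)) {κ : Tor → ℂ} (hκ : BddMeas κ) {B : ℝ} (hB : 0 ≤ B)
    (hκB : ∀ y ∈ cube q, ‖κ y‖ ≤ B) (n : ℕ) :
    ∑ i ∈ Finset.range n, ‖∫ y, fourier (-a i) y * (κ y * b y) ∂haarT‖ ^ 2 ≤
      (4000 * (B * β) * side q) ^ 2 := by
  have h := sum_sq_norm_setIntegral_le hb.idx_lt ha0 ha hb.continuous_weight hb.weight_nonneg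
    hb.young_le (hκ.mul hb.bddMeas) (β := B * β) (fun y hy => by
      rw [norm_mul, mul_assoc]
      exact mul_le_mul (hκB y hy) (hb.norm_le y hy) (norm_nonneg _) hB) n
  refine le_trans (le_of_eq (Finset.sum_congr rfl fun i _ => ?_)) h
  rw [setIntegral_eq_integral_of_forall_compl_eq_zero]
  intro y hy
  simp [hb.eq_zero y hy]

lemma norm_fourierCoeff_le (hb : IsAtom q s β b) (a : ℕ) :
    ‖fourierCoeff b a‖ ≤ a * (3.15 * side q) * (4 * β * side q) := by
  have e : fourierCoeff b a =
      ∫ y, ((fourier (-a) y : ℂ) - fourier (-a) (center q)) * b y ∂haarT := by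
    simp only [sub_mul]
    rw [integral_sub ((bddMeas_fourier _).mul hb.bddMeas).integrable
      ((BddMeas.const _).mul hb.bddMeas).integrable, integral_const_mul, hb.integral_eq_zero,
      mul_zero, sub_zero, fourierCoeff_haarT]
  rw [e]
  refine hb.norm_integral_mul_le fun y hy => (norm_fourier_neg_sub_le a _ _).trans ?_
  have := chord_center_le hb.idx_lt hy
  have := side_pos q
  have := pi_lt_d2
  gcongr
  nlinarith

lemma sum_sq_norm_fourierCoeff_le (hb : IsAtom q s β b) {A : ℕ → ℕ} {M : ℕ} (hA : Doubling A M)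
    (n : ℕ) : ∑ j ∈ Finset.range n, ‖fourierCoeff b (A j)‖ ^ 2 ≤ M * (4001 * β * side q) ^ 2 := by
  have hs := side_pos q
  have hβ := hb.height_nonneg
  have hN : (2 ^ q.1 : ℕ) * side q = 1 := by unfold side; push_cast; field_simp
  have h := hA.sum_comp_le (N := 2 ^ q.1) (g := fun a => ‖fourierCoeff b a‖ ^ 2)
    (fun a => by positivity) (H := (4000 * β * side q) ^ 2)
    (L := (12.6 * β * side q) ^ 2 * side q) (by positivity)
    (fun a ha0 ha n => by
      have := hb.sum_sq_norm_integral_le ha0 ha (BddMeas.const 1) zero_le_one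
        (fun y _ => by simp) n
      simpa only [one_mul, ← fourierCoeff_haarT] using this)
    (fun a ha => by
      have h1 := hb.norm_fourierCoeff_le a
      have h2 : a * side q ≤ 1 := by
        rw [← hN]; gcongr
      calc _ ≤ (a * (3.15 * side q) * (4 * β * side q)) ^ 2 := by gcongr
        _ = (12.6 * β * side q) ^ 2 * side q * a * (a * side q) := by ring
        _ ≤ _ := mul_le_of_le_one_right (by positivity) h2) n
  refine h.trans ?_
  gcongr
  have e : 2 * (2 ^ q.1 : ℕ) * ((12.6 * β * side q) ^ 2 * side q) =
    2 * (12.6 * β * side q) ^ 2 * ((2 ^ q.1 : ℕ) * side q) := by ring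
  rw [e, hN]
  nlinarith [sq_nonneg (β * side q)]

lemma norm_correctedErr_le (h0 : 0 ≤ r) (h1 : r < 1) (hb : IsAtom q s β b) (a : ℕ)
    (hx : 16 * side q < chord x (center q)) :
    ‖correctedErr r q b a x‖ ^ 2 ≤
      (404 * β * side q) ^ 2 * (side q ^ 2 / chord x (center q) ^ 3) * a := by
  have hs := side_pos q
  have hβ := hb.height_nonneg
  set D := chord x (center q) with hD
  have hDpos : 0 < D := by linarith
  have hfin : ∀ z : ℝ, 0 ≤ z → z ≤ 404 * β * side q * (side q / D ^ 2) → z ^ 2 * (a * D) ≤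
      (404 * β * side q) ^ 2 * (side q ^ 2 / D ^ 3) * a := by
    intro z hz hzle
    calc z ^ 2 * (a * D) ≤ (404 * β * side q * (side q / D ^ 2)) ^ 2 * (a * D) := by gcongr
      _ = _ := by field_simp
  unfold correctedErr
  rw [← hD]
  split_ifs with h
  · have e : localErr r q b a x - fourier (-a) x * cauchyOp r b x =
        fourier (-a) x * (∫ y, ((fourier a (x - y) - 1) * cauchyKer r (x - y) -
          (fourier a (x - center q) - 1) * cauchyKer r (x - center q)) * b y ∂haarT) -
        fourierCoeff b a * meanKer r q x := by
      have hbK := bddMeas_cauchyKer_mul h0 h1 hb.bddMeas x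
      have h2 : BddMeas fun y => ((fourier a (x - y) : ℂ) - 1) * cauchyKer r (x - y) * b y := by
        simp only [mul_assoc]
        exact (((bddMeas_fourier a).comp (measurable_const.sub measurable_id)).sub
          (BddMeas.const 1)).mul hbK
      simp only [sub_mul (_ * cauchyKer r _)]
      rw [integral_sub h2.integrable ((BddMeas.const _).mul hb.bddMeas).integrable,
        integral_const_mul, hb.integral_eq_zero, mul_zero, sub_zero]
      unfold localErr cauchyOp
      rw [sub_right_comm, ← integral_const_mul, ← integral_const_mul, ← integral_sub
        (bddMeas_cauchyKer_mul h0 h1 ((bddMeas_fourier (-a)).mul hb.bddMeas) x).integrable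
        ((BddMeas.const _).mul hbK).integrable]
      congr 2
      funext y
      have h3 : (fourier (-a) y : ℂ) = fourier (-a) x * fourier a (x - y) := by
        rw [fourier_sub_arg, ← mul_assoc, mul_comm (fourier (-a) x : ℂ), fourier_mul_fourier_neg,
          one_mul]
      rw [h3]; ring
    have hc1 : ‖∫ y, ((fourier a (x - y) - 1) * cauchyKer r (x - y) -
        (fourier a (x - center q) - 1) * cauchyKer r (x - center q)) * b y ∂haarT‖ ≤
        6 * a * (3.15 * side q) / D * (4 * β * side q) := by
      refine hb.norm_integral_mul_le fun y hy => ?_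
      have h2 := half_chord_le hb.idx_lt hx hy
      refine (norm_modulated_cauchyKer_sub_le h0 h1 a (by linarith) hDpos).trans ?_
      have := chord_center_le hb.idx_lt hy
      have := pi_lt_d2
      rw [← hD]
      gcongr
      nlinarith
    have hc2 := hb.norm_fourierCoeff_le a
    have hc3 := norm_meanKer_le h0 h1 hb.idx_lt hx
    have hle : ‖localErr r q b a x - fourier (-a) x * cauchyOp r b x‖ ≤
        404 * β * side q * (side q / D ^ 2) * (a * D) := by
      rw [e]
      refine (norm_sub_le _ _).trans ?_
      rw [norm_mul, norm_fourier_apply, one_mul, norm_mul]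
      calc _ ≤ 6 * a * (3.15 * side q) / D * (4 * β * side q) +
            a * (3.15 * side q) * (4 * β * side q) * (4 / D) := by gcongr
        _ = 126 * β * side q * (side q / D ^ 2) * (a * D) := by field_simp; ring
        _ ≤ _ := by gcongr; norm_num
    have h4 : (a * D) ≤ 1 := h.le
    calc _ ≤ (404 * β * side q * (side q / D ^ 2) * (a * D)) ^ 2 := by gcongr
      _ = (404 * β * side q * (side q / D ^ 2)) ^ 2 * (a * D) * (a * D) := by ring
      _ ≤ (404 * β * side q * (side q / D ^ 2)) ^ 2 * (a * D) :=
          mul_le_of_le_one_right (by positivity) h4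
      _ ≤ _ := hfin _ (by positivity) le_rfl
  · rw [sub_zero]
    have h2 := norm_localErr_le h0 h1 hb a hx
    rw [← hD] at h2
    refine le_trans ?_ (hfin _ (norm_nonneg _) (h2.trans (le_of_eq (by ring))))
    exact le_mul_of_one_le_right (by positivity) (not_lt.1 h)

lemma sum_sq_norm_correctedErr_le (h0 : 0 ≤ r) (h1 : r < 1) (hb : IsAtom q s β b)
    {A : ℕ → ℕ} {M : ℕ} (hA : Doubling A M) (hx : 16 * side q < chord x (center q)) (n : ℕ) :
    ∑ j ∈ Finset.range n, ‖correctedErr r q b (A j) x‖ ^ 2 ≤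
      M * (102000 * β * side q) ^ 2 * (side q / chord x (center q) ^ 3) := by
  have hs := side_pos q
  have hβ := hb.height_nonneg
  have hN : (2 ^ q.1 : ℕ) * side q = 1 := by unfold side; push_cast; field_simp
  set D := chord x (center q) with hD
  have hDpos : 0 < D := by linarith
  have h := hA.sum_comp_le (N := 2 ^ q.1) (g := fun a => ‖correctedErr r q b a x‖ ^ 2)
    (fun a => by positivity) (H := (4000 * (101 * side q / D ^ 2 * β) * side q) ^ 2)
    (L := (404 * β * side q) ^ 2 * (side q ^ 2 / D ^ 3)) (by positivity)
    (fun a ha0 ha n => by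
      have hK : BddMeas fun y => cauchyKer r (x - y) - meanKer r q x :=
        ((bddMeas_cauchyKer h0 h1).comp (measurable_const.sub measurable_id)).sub (BddMeas.const _)
      have := hb.sum_sq_norm_integral_le ha0 ha hK (B := 101 * side q / D ^ 2) (by positivity)
        (fun y hy => norm_cauchyKer_sub_meanKer_le h0 h1 hb.idx_lt hx hy) n
      simp only [← localErr_eq h0 h1 hb] at this
      refine le_trans (le_of_eq (Finset.sum_congr rfl fun i _ => ?_)) this
      have hai : a 0 ≤ a i := by
        have : Monotone a := monotone_nat_of_le_succ fun i => by have := ha i; omega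
        exact this (Nat.zero_le i)
      have hai' : ((2 ^ q.1 : ℕ) : ℝ) ≤ a i := by exact_mod_cast ha0.trans hai
      rw [correctedErr, if_neg, sub_zero]
      rw [← hD, not_lt]
      calc (1 : ℝ) = (2 ^ q.1 : ℕ) * side q := hN.symm
        _ ≤ a i * D := by gcongr; linarith)
    (fun a _ => norm_correctedErr_le h0 h1 hb a hx) n
  refine h.trans ?_
  rw [mul_assoc (M : ℝ)]
  refine mul_le_mul_of_nonneg_left ?_ (Nat.cast_nonneg M)
  have e : 2 * (2 ^ q.1 : ℕ) * ((404 * β * side q) ^ 2 * (side q ^ 2 / D ^ 3)) =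
    2 * (404 * β * side q) ^ 2 * (side q / D ^ 3) * ((2 ^ q.1 : ℕ) * side q) := by ring
  have e2 : (4000 * (101 * side q / D ^ 2 * β) * side q) ^ 2 =
    (404000 * β * side q) ^ 2 * (side q / D ^ 3) * (side q / D) := by
    field_simp; ring
  have h3 : side q / D ≤ 1 / 16 := by
    rw [div_le_div_iff₀ hDpos (by norm_num)]; linarith
  rw [e, hN, e2]
  have h4 : (404000 * β * side q) ^ 2 * (side q / D ^ 3) * (side q / D) ≤
    (404000 * β * side q) ^ 2 * (side q / D ^ 3) * (1 / 16) := by gcongr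
  have h5 : 0 ≤ (β * side q) ^ 2 * (side q / D ^ 3) := by positivity
  nlinarith

end IsAtom

/-- The `ℓ²` norm of the first `n` terms of a sequence. -/
def l2norm (n : ℕ) (u : ℕ → ℂ) : ℝ := √(∑ j ∈ Finset.range n, ‖u j‖ ^ 2)

lemma sq_l2norm (n : ℕ) (u : ℕ → ℂ) : l2norm n u ^ 2 = ∑ j ∈ Finset.range n, ‖u j‖ ^ 2 :=
  Real.sq_sqrt (Finset.sum_nonneg fun _ _ => by positivity)

lemma l2norm_eq_norm (n : ℕ) (u : ℕ → ℂ) :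
    l2norm n u = ‖(WithLp.toLp 2 fun i : Fin n => u i : EuclideanSpace ℂ (Fin n))‖ := by
  rw [l2norm, EuclideanSpace.norm_eq, Finset.sum_range]

lemma l2norm_add_le (n : ℕ) (u v : ℕ → ℂ) :
    l2norm n (fun j => u j + v j) ≤ l2norm n u + l2norm n v := by
  simp only [l2norm_eq_norm]
  exact norm_add_le (WithLp.toLp 2 fun i : Fin n => u i : EuclideanSpace ℂ (Fin n))
    (WithLp.toLp 2 fun i : Fin n => v i)

lemma l2norm_sum_le (n : ℕ) {ι : Type*} (s : Finset ι) (u : ι → ℕ → ℂ) :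
    l2norm n (fun j => ∑ i ∈ s, u i j) ≤ ∑ i ∈ s, l2norm n (u i) := by
  classical
  induction s using Finset.induction_on with
  | empty => simp [l2norm]
  | insert i s hi ih =>
    simp only [Finset.sum_insert hi]
    exact (l2norm_add_le _ _ _).trans (by gcongr)

/-- The part of the modulated Cauchy integral of an atom which decays away from its arc. -/
def remainder (r : ℝ) (q : ℕ × ℕ) (b : Tor → ℂ) (a : ℕ) (x : Tor) : ℂ :=
  shiftOp r a b x - fourier a x * (fourierCoeff b a * meanKer r q x)

lemma remainder_eq (r : ℝ) (q : ℕ × ℕ) (b : Tor → ℂ) (a : ℕ) (x : Tor) :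
    remainder r q b a x = fourier a x * correctedErr r q b a x +
      (if a * chord x (center q) < 1 then 1 else 0) * cauchyOp r b x := by
  have h := fourier_mul_fourier_neg a x
  unfold remainder correctedErr localErr shiftOp
  split_ifs
  · linear_combination (cauchyOp r b x) * h
  · ring

lemma sum_sq_sub_indicator_le {A : ℕ → ℕ} (hA : Monotone A) {D : ℝ} (hD : 0 ≤ D) (n : ℕ) :
    ∑ j ∈ Finset.range n,
      ‖((if A j * D < 1 then 1 else 0) - (if A (j + 1) * D < 1 then 1 else 0) : ℂ)‖ ^ 2 ≤ 1 := by
  have h : ∀ j, ‖((if A j * D < 1 then 1 else 0) - (if A (j + 1) * D < 1 then 1 else 0) : ℂ)‖ ^ 2 =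
      (if A j * D < 1 then 1 else 0) - (if A (j + 1) * D < 1 then 1 else 0 : ℝ) := by
    intro j
    have : (A j : ℝ) * D ≤ A (j + 1) * D :=
      mul_le_mul_of_nonneg_right (by exact_mod_cast hA (Nat.le_succ j)) hD
    split_ifs <;> first | (exfalso; linarith) | simp
  simp only [h]
  rw [Finset.sum_range_sub' fun j => (if A j * D < 1 then 1 else 0 : ℝ)]
  split_ifs <;> norm_num

lemma sq_tail {l : ℝ} (hl : 0 < l) {c x : Tor} (hx : 16 * l < chord x c) :
    tail l c x ^ 2 = l / chord x c ^ 3 := by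
  have hD : 0 < chord x c := by linarith
  have hx' : x ∈ {x | 16 * l < chord x c} := hx
  rw [tail, Set.indicator_of_mem hx', div_pow, mul_pow, Real.sq_sqrt hl.le, Real.sq_sqrt hD.le]
  ring

lemma norm_add_add_sq_le (x y z : ℂ) :
    ‖x + y + z‖ ^ 2 ≤ 3 * (‖x‖ ^ 2 + ‖y‖ ^ 2 + ‖z‖ ^ 2) := by
  have h := norm_add₃_le (a := x) (b := y) (c := z)
  have := norm_nonneg (x + y + z)
  calc _ ≤ (‖x‖ + ‖y‖ + ‖z‖) ^ 2 := by gcongr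
    _ ≤ _ := by nlinarith [sq_nonneg (‖x‖ - ‖y‖), sq_nonneg (‖y‖ - ‖z‖), sq_nonneg (‖x‖ - ‖z‖)]

namespace IsAtom
variable {r : ℝ} {q : ℕ × ℕ} {s : Tor → ℝ} {β : ℝ} {b : Tor → ℂ} {x : Tor}

lemma l2norm_remainder_le (h0 : 0 ≤ r) (h1 : r < 1) (hb : IsAtom q s β b)
    {A : ℕ → ℕ} {M : ℕ} (hA : Doubling A M) (hx : 16 * side q < chord x (center q)) (n : ℕ) :
    l2norm n (fun j => remainder r q b (A j) x - remainder r q b (A (j + 1)) x) ≤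
      250000 * √M * β * side q * tail (side q) (center q) x := by
  have hs := side_pos q
  have hβ := hb.height_nonneg
  have hM : (1 : ℝ) ≤ M := by exact_mod_cast hA.pos
  set D := chord x (center q) with hD
  have hDpos : 0 < D := by linarith
  have htail := tail_nonneg (side q) (center q) x
  have ht2 := sq_tail hs hx
  rw [← hD] at ht2
  set ind : ℕ → ℂ := fun j => if A j * D < 1 then 1 else 0 with hind
  have hZ := fun n => hb.sum_sq_norm_correctedErr_le h0 h1 hA hx n
  rw [← hD, ← ht2] at hZ
  have hZ' : ∑ j ∈ Finset.range n, ‖correctedErr r q b (A (j + 1)) x‖ ^ 2 ≤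
      M * (102000 * β * side q) ^ 2 * tail (side q) (center q) x ^ 2 := by
    refine le_trans ?_ (hZ (n + 1))
    rw [Finset.sum_range_succ']
    exact le_add_of_nonneg_right (by positivity)
  have hI := sum_sq_sub_indicator_le hA.mono hDpos.le n
  have hH := hb.norm_cauchyOp_le h0 h1 hx
  rw [← hD] at hH
  have hH2 : ‖cauchyOp r b x‖ ^ 2 ≤ (404 * β * side q) ^ 2 * tail (side q) (center q) x ^ 2 := by
    rw [ht2]
    have h3 : side q / D ≤ 1 := by
      rw [div_le_one hDpos]; linarith
    calc _ ≤ (101 * side q / D ^ 2 * (4 * β * side q)) ^ 2 := by gcongr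
      _ = (404 * β * side q) ^ 2 * (side q / D ^ 3) * (side q / D) := by field_simp; ring
      _ ≤ _ := mul_le_of_le_one_right (by positivity) h3
  refine Real.sqrt_le_iff.2 ⟨by positivity, ?_⟩
  calc _ ≤ ∑ j ∈ Finset.range n, 3 * (‖correctedErr r q b (A j) x‖ ^ 2 +
          ‖correctedErr r q b (A (j + 1)) x‖ ^ 2 +
          ‖ind j - ind (j + 1)‖ ^ 2 * ‖cauchyOp r b x‖ ^ 2) := by
        refine Finset.sum_le_sum fun j _ => ?_
        have e : remainder r q b (A j) x - remainder r q b (A (j + 1)) x =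
            fourier (A j) x * correctedErr r q b (A j) x +
            -(fourier (A (j + 1)) x * correctedErr r q b (A (j + 1)) x) +
            (ind j - ind (j + 1)) * cauchyOp r b x := by
          rw [remainder_eq, remainder_eq]; ring
        dsimp only
        rw [e]
        refine (norm_add_add_sq_le _ _ _).trans (le_of_eq ?_)
        rw [norm_neg, norm_mul, norm_mul, norm_mul, norm_fourier_apply, norm_fourier_apply]
        ring
    _ = 3 * (∑ j ∈ Finset.range n, ‖correctedErr r q b (A j) x‖ ^ 2 +
          ∑ j ∈ Finset.range n, ‖correctedErr r q b (A (j + 1)) x‖ ^ 2 +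
          (∑ j ∈ Finset.range n, ‖ind j - ind (j + 1)‖ ^ 2) * ‖cauchyOp r b x‖ ^ 2) := by
        rw [← Finset.mul_sum, Finset.sum_add_distrib, Finset.sum_add_distrib, Finset.sum_mul]
    _ ≤ 3 * (M * (102000 * β * side q) ^ 2 * tail (side q) (center q) x ^ 2 +
          M * (102000 * β * side q) ^ 2 * tail (side q) (center q) x ^ 2 +
          1 * (M * ((404 * β * side q) ^ 2 * tail (side q) (center q) x ^ 2))) := by
        have hH3 := hH2.trans (le_mul_of_one_le_left (by positivity) hM)
        have := hZ n
        gcongr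
    _ ≤ _ := by
        have hsq : √(M : ℝ) ^ 2 = M := Real.sq_sqrt (Nat.cast_nonneg M)
        have e : (250000 * √M * β * side q * tail (side q) (center q) x) ^ 2 =
            62500000000 * (√M ^ 2 * β ^ 2 * side q ^ 2 * tail (side q) (center q) x ^ 2) := by ring
        rw [e, hsq]
        have : 0 ≤ M * β ^ 2 * side q ^ 2 * tail (side q) (center q) x ^ 2 := by positivity
        nlinarith

end IsAtom

lemma measureReal_lt_l2norm_le {F : ℕ → Tor → ℂ} (hF : ∀ j, BddMeas (F j)) (n : ℕ) {γ : ℝ}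
    (hγ : 0 < γ) :
    haarT.real {x | γ < l2norm n fun j => F j x} ≤
      (∑ j ∈ Finset.range n, ∫ x, ‖F j x‖ ^ 2 ∂haarT) / γ ^ 2 := by
  have hFi : Integrable (fun x => ∑ j ∈ Finset.range n, ‖F j x‖ ^ 2) haarT :=
    (BddMeas.sum _ fun j _ => (hF j).sq_norm).integrable
  have h := mul_meas_ge_le_integral_of_nonneg
    (Filter.Eventually.of_forall fun x => Finset.sum_nonneg fun j _ => by positivity) hFi (γ ^ 2)
  rw [integral_finsetSum _ fun j _ => (hF j).sq_norm.integrable] at h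
  rw [le_div_iff₀ (by positivity), mul_comm]
  refine le_trans (mul_le_mul_of_nonneg_left (measureReal_mono fun x hx => ?_) (by positivity)) h
  change γ ^ 2 ≤ ∑ j ∈ Finset.range n, ‖F j x‖ ^ 2
  rw [← sq_l2norm]
  have hx' : γ < l2norm n fun j => F j x := hx
  gcongr

/-- The step function with mass `v q` on each arc `cube q`. -/
def packet (S : Finset (ℕ × ℕ)) (v : ℕ × ℕ → ℂ) (y : Tor) : ℂ :=
  ∑ q ∈ S, v q / side q * (cube q).indicator (fun _ => 1) y

section packet
variable {S : Finset (ℕ × ℕ)} {v : ℕ × ℕ → ℂ} {r : ℝ}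

lemma bddMeas_packet (S : Finset (ℕ × ℕ)) (v : ℕ × ℕ → ℂ) : BddMeas (packet S v) :=
  BddMeas.sum _ fun q _ =>
    (BddMeas.const (v q / side q)).mul ((BddMeas.const (1 : ℂ)).indicator (measurableSet_cube q))

lemma cauchyOp_packet (h0 : 0 ≤ r) (h1 : r < 1) (S : Finset (ℕ × ℕ)) (v : ℕ × ℕ → ℂ) (x : Tor) :
    cauchyOp r (packet S v) x = ∑ q ∈ S, v q * meanKer r q x := by
  have h := cauchyOp_sum h0 h1 S
    (f := fun q y => v q / side q * (cube q).indicator (fun _ => 1) y)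
    (fun q _ => (BddMeas.const (v q / side q)).mul
      ((BddMeas.const (1 : ℂ)).indicator (measurableSet_cube q))) x
  refine h.trans (Finset.sum_congr rfl fun q _ => ?_)
  rw [cauchyOp_const_mul, meanKer]
  ring

lemma sum_indicator_eq_single (hd : ∀ x, ∀ q ∈ S, ∀ q' ∈ S, x ∈ cube q → x ∈ cube q' → q = q')
    {E : Type*} [AddCommMonoid E] (h : ℕ × ℕ → Tor → E) {q : ℕ × ℕ} (hq : q ∈ S) {x : Tor}
    (hx : x ∈ cube q) : ∑ p ∈ S, (cube p).indicator (h p) x = h q x := by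
  rw [Finset.sum_eq_single_of_mem q hq, Set.indicator_of_mem hx]
  intro p hp hpq
  exact Set.indicator_of_notMem (fun hxp => hpq (hd x p hp q hq hxp hx)) _

lemma integral_sq_norm_packet_le (hi : ∀ q ∈ S, q.2 < 2 ^ q.1)
    (hd : ∀ x, ∀ q ∈ S, ∀ q' ∈ S, x ∈ cube q → x ∈ cube q' → q = q') :
    ∫ y, ‖packet S v y‖ ^ 2 ∂haarT ≤ ∑ q ∈ S, ‖v q‖ ^ 2 / side q := by
  have e : ∀ y, ‖packet S v y‖ ^ 2 =
      ∑ q ∈ S, (cube q).indicator (fun _ => (‖v q‖ / side q) ^ 2) y := by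
    intro y
    have e1 : packet S v y = ∑ q ∈ S, (cube q).indicator (fun _ => v q / side q) y := by
      refine Finset.sum_congr rfl fun q _ => ?_
      by_cases hy : y ∈ cube q <;> simp [hy]
    by_cases hy : ∃ q ∈ S, y ∈ cube q
    · obtain ⟨q, hq, hyq⟩ := hy
      rw [e1, sum_indicator_eq_single hd _ hq hyq, sum_indicator_eq_single hd _ hq hyq, norm_div,
        Complex.norm_real, Real.norm_of_nonneg (side_pos q).le]
    · push Not at hy
      rw [e1, Finset.sum_eq_zero fun q hq => Set.indicator_of_notMem (hy q hq) _,
        Finset.sum_eq_zero fun q hq => Set.indicator_of_notMem (hy q hq) _]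
      simp
  simp only [e]
  rw [integral_finsetSum _ fun q _ =>
    ((BddMeas.const ((‖v q‖ / side q) ^ 2)).indicator (measurableSet_cube q)).integrable]
  refine Finset.sum_le_sum fun q hq => le_of_eq ?_
  have := (side_pos q).ne'
  rw [integral_indicator_const _ (measurableSet_cube q), haarT_cube (hi q hq), smul_eq_mul]
  field_simp

end packet

/-- The sum of the main terms of the modulated Cauchy integrals of a family of atoms. -/
def mainTerm (r : ℝ) (S : Finset (ℕ × ℕ)) (b : ℕ × ℕ → Tor → ℂ) (a : ℕ) (x : Tor) : ℂ :=
  fourier a x * cauchyOp r (packet S fun q => fourierCoeff (b q) a) x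

section assembly
variable {r : ℝ} {S : Finset (ℕ × ℕ)} {s : Tor → ℝ} {β : ℝ} {b : ℕ × ℕ → Tor → ℂ} {A : ℕ → ℕ}
  {M : ℕ}

lemma sum_shiftOp_eq (h0 : 0 ≤ r) (h1 : r < 1) (S : Finset (ℕ × ℕ)) (b : ℕ × ℕ → Tor → ℂ) (a : ℕ)
    (x : Tor) :
    ∑ q ∈ S, shiftOp r a (b q) x = mainTerm r S b a x + ∑ q ∈ S, remainder r q (b q) a x := by
  simp only [remainder, Finset.sum_sub_distrib, mainTerm, cauchyOp_packet h0 h1, Finset.mul_sum]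
  ring

lemma bddMeas_mainTerm (h0 : 0 ≤ r) (h1 : r < 1) (S : Finset (ℕ × ℕ)) (b : ℕ × ℕ → Tor → ℂ)
    (a : ℕ) : BddMeas (mainTerm r S b a) :=
  (bddMeas_fourier a).mul (bddMeas_cauchyOp h0 h1 (bddMeas_packet _ _))

lemma sum_integral_sq_mainTerm_le (h0 : 0 ≤ r) (h1 : r < 1)
    (hd : ∀ x, ∀ q ∈ S, ∀ q' ∈ S, x ∈ cube q → x ∈ cube q' → q = q')
    (hb : ∀ q ∈ S, IsAtom q s β (b q)) (hA : Doubling A M) (n : ℕ) :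
    ∑ j ∈ Finset.range n, ∫ x, ‖mainTerm r S b (A j) x‖ ^ 2 ∂haarT ≤
      M * (4001 * β) ^ 2 * ∑ q ∈ S, side q := by
  calc _ ≤ ∑ j ∈ Finset.range n, ∑ q ∈ S, ‖fourierCoeff (b q) (A j)‖ ^ 2 / side q := by
        refine Finset.sum_le_sum fun j _ => ?_
        simp only [mainTerm, norm_mul, norm_fourier_apply, one_mul]
        exact (integral_sq_norm_cauchyOp_le h0 h1 (bddMeas_packet _ _)).trans
          (integral_sq_norm_packet_le (fun q hq => (hb q hq).idx_lt) hd)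
    _ = ∑ q ∈ S, (∑ j ∈ Finset.range n, ‖fourierCoeff (b q) (A j)‖ ^ 2) / side q := by
        rw [Finset.sum_comm]
        simp only [Finset.sum_div]
    _ ≤ ∑ q ∈ S, M * (4001 * β) ^ 2 * side q := by
        refine Finset.sum_le_sum fun q hq => ?_
        have hs := side_pos q
        rw [div_le_iff₀ hs]
        refine ((hb q hq).sum_sq_norm_fourierCoeff_le hA n).trans (le_of_eq ?_)
        ring
    _ = _ := by rw [Finset.mul_sum]

lemma sum_integral_sq_mainTerm_sub_le (h0 : 0 ≤ r) (h1 : r < 1)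
    (hd : ∀ x, ∀ q ∈ S, ∀ q' ∈ S, x ∈ cube q → x ∈ cube q' → q = q')
    (hb : ∀ q ∈ S, IsAtom q s β (b q)) (hA : Doubling A M) (n : ℕ) :
    ∑ j ∈ Finset.range n,
        ∫ x, ‖mainTerm r S b (A j) x - mainTerm r S b (A (j + 1)) x‖ ^ 2 ∂haarT ≤
      4 * (M * (4001 * β) ^ 2 * ∑ q ∈ S, side q) := by
  have h := fun n => sum_integral_sq_mainTerm_le h0 h1 hd hb hA n
  have h' : ∑ j ∈ Finset.range n, ∫ x, ‖mainTerm r S b (A (j + 1)) x‖ ^ 2 ∂haarT ≤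
      M * (4001 * β) ^ 2 * ∑ q ∈ S, side q := by
    refine le_trans ?_ (h (n + 1))
    rw [Finset.sum_range_succ']
    exact le_add_of_nonneg_right (integral_nonneg fun _ => by positivity)
  calc _ ≤ ∑ j ∈ Finset.range n, 2 * (∫ x, ‖mainTerm r S b (A j) x‖ ^ 2 ∂haarT +
          ∫ x, ‖mainTerm r S b (A (j + 1)) x‖ ^ 2 ∂haarT) := by
        refine Finset.sum_le_sum fun j _ => ?_
        have m1 := bddMeas_mainTerm h0 h1 S b (A j)
        have m2 := bddMeas_mainTerm h0 h1 S b (A (j + 1))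
        rw [← integral_add m1.sq_norm.integrable m2.sq_norm.integrable, ← integral_const_mul]
        refine integral_mono (m1.sub m2).sq_norm.integrable
          ((m1.sq_norm.add m2.sq_norm).integrable.const_mul 2) fun x => ?_
        have h := norm_sub_le (mainTerm r S b (A j) x) (mainTerm r S b (A (j + 1)) x)
        calc _ ≤ (‖mainTerm r S b (A j) x‖ + ‖mainTerm r S b (A (j + 1)) x‖) ^ 2 := by
              gcongr
          _ ≤ _ := add_sq_le
    _ = 2 * (∑ j ∈ Finset.range n, ∫ x, ‖mainTerm r S b (A j) x‖ ^ 2 ∂haarT +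
          ∑ j ∈ Finset.range n, ∫ x, ‖mainTerm r S b (A (j + 1)) x‖ ^ 2 ∂haarT) := by
        rw [← Finset.mul_sum, Finset.sum_add_distrib]
    _ ≤ _ := by linarith [h n]

/-- The weak-type estimate for a function split into a good part and a family of atoms. -/
lemma measureReal_lt_l2norm_shiftOp_sub_le (h0 : 0 ≤ r) (h1 : r < 1)
    (hd : ∀ x, ∀ q ∈ S, ∀ q' ∈ S, x ∈ cube q → x ∈ cube q' → q = q')
    (hb : ∀ q ∈ S, IsAtom q s β (b q)) (hA : Doubling A M) (hβ : 0 < β) {f g : Tor → ℂ}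
    (hg : BddMeas g) (hfg : ∀ x, f x = g x + ∑ q ∈ S, b q x) (n : ℕ) :
    haarT.real {x | √M * β < l2norm n fun j => shiftOp r (A j) f x - shiftOp r (A (j + 1)) f x} ≤
      18 * (∫ x, ‖g x‖ ^ 2 ∂haarT) / β ^ 2 + 590000000 * ∑ q ∈ S, side q := by
  have hM : (1 : ℝ) ≤ M := by exact_mod_cast hA.pos
  have hsM : (1 : ℝ) ≤ √M := Real.one_le_sqrt.2 hM
  have hsq : √(M : ℝ) ^ 2 = M := Real.sq_sqrt (Nat.cast_nonneg M)
  set L := ∑ q ∈ S, side q with hL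
  set G : ℕ → Tor → ℂ := fun j x => shiftOp r (A j) g x - shiftOp r (A (j + 1)) g x with hG
  set T : ℕ → Tor → ℂ := fun j x => mainTerm r S b (A j) x - mainTerm r S b (A (j + 1)) x with hT
  set R : Tor → ℝ := fun x => ∑ q ∈ S, 250000 * √M * β * side q * tail (side q) (center q) x
    with hR
  set γ := √M * β / 3 with hγ
  have hγ0 : 0 < γ := by positivity
  have hγ2 : γ ^ 2 = M * β ^ 2 / 9 := by rw [hγ, div_pow, mul_pow, hsq]; norm_num
  have hL0 : 0 ≤ L := Finset.sum_nonneg fun q _ => (side_pos q).le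
  set J := ⋃ q ∈ S, {x | chord x (center q) ≤ 16 * side q} with hJ
  have hsub : {x | √M * β < l2norm n fun j => shiftOp r (A j) f x - shiftOp r (A (j + 1)) f x} ⊆
      (J ∪ {x | γ ≤ R x}) ∪
      ({x | γ < l2norm n fun j => G j x} ∪ {x | γ < l2norm n fun j => T j x}) := by
    intro x hx
    by_contra hcon
    simp only [Set.mem_union, not_or] at hcon
    obtain ⟨⟨hxJ, hxR⟩, hxG, hxT⟩ := hcon
    have hxR : R x < γ := not_le.1 hxR
    have hxG : (l2norm n fun j => G j x) ≤ γ := not_lt.1 hxG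
    have hxT : (l2norm n fun j => T j x) ≤ γ := not_lt.1 hxT
    have hx : √M * β < l2norm n fun j => shiftOp r (A j) f x - shiftOp r (A (j + 1)) f x := hx
    have hx16 : ∀ q ∈ S, 16 * side q < chord x (center q) := by
      intro q hq
      by_contra hle
      exact hxJ (Set.mem_biUnion hq (not_lt.1 hle))
    have hop : ∀ a : ℕ, shiftOp r a f x = shiftOp r a g x +
        (mainTerm r S b a x + ∑ q ∈ S, remainder r q (b q) a x) := by
      intro a
      have hsum : BddMeas fun y => ∑ q ∈ S, b q y := BddMeas.sum _ fun q hq => (hb q hq).bddMeas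
      rw [← sum_shiftOp_eq h0 h1, funext hfg, shiftOp_add h0 h1 _ hg hsum,
        shiftOp_sum h0 h1 _ _ fun q hq => (hb q hq).bddMeas]
    have e : (fun j => shiftOp r (A j) f x - shiftOp r (A (j + 1)) f x) = fun j =>
        (G j x + T j x) +
          ∑ q ∈ S, (remainder r q (b q) (A j) x - remainder r q (b q) (A (j + 1)) x) := by
      funext j
      rw [hop, hop, Finset.sum_sub_distrib]
      simp only [hG, hT]
      ring
    have h3 : √M * β = γ + γ + γ := by rw [hγ]; ring
    have : (l2norm n fun j => shiftOp r (A j) f x - shiftOp r (A (j + 1)) f x) ≤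
        (γ + γ) + R x := by
      rw [e]
      refine (l2norm_add_le _ _ _).trans (add_le_add ?_ ?_)
      · exact (l2norm_add_le _ _ _).trans (add_le_add hxG hxT)
      · exact (l2norm_sum_le _ _ _).trans (Finset.sum_le_sum fun q hq =>
          (hb q hq).l2norm_remainder_le h0 h1 hA (hx16 q hq) n)
    linarith
  have hmJ : haarT.real J ≤ 16 * L := by
    refine (measureReal_biUnion_finset_le (μ := haarT) S _).trans ?_
    rw [hL, Finset.mul_sum]
    refine Finset.sum_le_sum fun q _ => ?_
    have hs := side_pos q
    exact ENNReal.toReal_le_of_le_ofReal (by positivity) (haarT_chord_le _ (by positivity))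
  have hmR : haarT.real {x | γ ≤ R x} ≤ 6000000 * L := by
    have hRm : BddMeas R := BddMeas.sum _ fun q _ =>
      (BddMeas.const (250000 * √M * β * side q)).mul (bddMeas_tail (side_pos q) _)
    have hR0 : ∀ x, 0 ≤ R x := fun x => Finset.sum_nonneg fun q _ =>
      mul_nonneg (by have := (side_pos q).le; positivity) (tail_nonneg _ _ _)
    have h := mul_meas_ge_le_integral_of_nonneg (μ := haarT) (Filter.Eventually.of_forall hR0)
      hRm.integrable γ
    have hI : ∫ x, R x ∂haarT ≤ γ * (6000000 * L) := by
      rw [hR, integral_finsetSum _ fun q _ =>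
        ((BddMeas.const (250000 * √M * β * side q)).mul (bddMeas_tail (side_pos q) _)).integrable]
      calc _ ≤ ∑ q ∈ S, 250000 * √M * β * side q * 8 := by
            refine Finset.sum_le_sum fun q _ => ?_
            have hs := side_pos q
            rw [integral_const_mul]
            exact mul_le_mul_of_nonneg_left (integral_tail_le hs _) (by positivity)
        _ = ∑ q ∈ S, γ * 6000000 * side q := Finset.sum_congr rfl fun q _ => by rw [hγ]; ring
        _ = _ := by rw [← Finset.mul_sum, hL, mul_assoc]
    exact le_of_mul_le_mul_left (h.trans hI) hγ0
  have hmG : haarT.real {x | γ < l2norm n fun j => G j x} ≤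
      18 * (∫ x, ‖g x‖ ^ 2 ∂haarT) / β ^ 2 := by
    refine (measureReal_lt_l2norm_le (fun j =>
      (bddMeas_shiftOp h0 h1 _ hg).sub (bddMeas_shiftOp h0 h1 _ hg)) n hγ0).trans ?_
    have hI := sum_integral_sq_shiftOp_sub_le h0 h1 hA.mono hg n
    have hg0 : 0 ≤ ∫ x, ‖g x‖ ^ 2 ∂haarT := integral_nonneg fun _ => by positivity
    rw [hγ2, div_le_div_iff₀ (by positivity) (by positivity)]
    calc _ ≤ 2 * (∫ x, ‖g x‖ ^ 2 ∂haarT) * β ^ 2 := by gcongr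
      _ ≤ M * (2 * (∫ x, ‖g x‖ ^ 2 ∂haarT) * β ^ 2) :=
          le_mul_of_one_le_left (by positivity) hM
      _ = _ := by ring
  have hmT : haarT.real {x | γ < l2norm n fun j => T j x} ≤ 580000000 * L := by
    refine (measureReal_lt_l2norm_le (fun j =>
      (bddMeas_mainTerm h0 h1 S b _).sub (bddMeas_mainTerm h0 h1 S b _)) n hγ0).trans ?_
    have hI := sum_integral_sq_mainTerm_sub_le h0 h1 hd hb hA n
    rw [hγ2, div_le_iff₀ (by positivity)]
    refine hI.trans ?_
    rw [← hL]
    have : 0 ≤ M * β ^ 2 * L := by positivity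
    nlinarith
  calc _ ≤ _ := measureReal_mono (μ := haarT) hsub
    _ ≤ _ := measureReal_union_le (μ := haarT) _ _
    _ ≤ (16 * L + 6000000 * L) + (18 * (∫ x, ‖g x‖ ^ 2 ∂haarT) / β ^ 2 + 580000000 * L) := by
        refine add_le_add ((measureReal_union_le _ _).trans (add_le_add hmJ hmR))
          ((measureReal_union_le _ _).trans (add_le_add hmG hmT))
    _ ≤ _ := by linarith

end assembly

lemma young_nonneg {s : ℝ} (hs : 0 ≤ s) : 0 ≤ young s := hs.trans (le_young hs)

lemma young_div_le {s β : ℝ} (hs : 0 ≤ s) (hβ : 1 ≤ β) : young (s / β) ≤ young s / β := by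
  have hβ0 : 0 < β := by linarith
  have h : s / β ≤ s := div_le_self hs hβ
  have he : 0 < Real.exp 1 + s / β := by positivity
  rw [young, young, div_mul_eq_mul_div]
  gcongr

/-- The average of a function over an arc. -/
def arcAvg (f : Tor → ℂ) (q : ℕ × ℕ) : ℂ := (∫ y in cube q, f y ∂haarT) / side q

/-- The mean-zero part of a function on an arc. -/
def atomPart (f : Tor → ℂ) (q : ℕ × ℕ) : Tor → ℂ := (cube q).indicator fun y => f y - arcAvg f q

section decomposition
variable {f : Tor → ℂ} {β : ℝ} {q : ℕ × ℕ}

lemma norm_le_mul_young (hβ : 0 < β) (z : ℂ) : ‖z‖ ≤ β * young (‖z‖ / β) := by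
  calc ‖z‖ = β * (‖z‖ / β) := by field_simp
    _ ≤ _ := by gcongr; exact le_young (by positivity)

lemma continuous_young_norm_div (hf : Continuous f) (hβ : 0 < β) :
    Continuous fun y => young (‖f y‖ / β) :=
  continuous_young_comp (hf.norm.div_const β) fun _ => by positivity

lemma setIntegral_norm_le (hf : Continuous f) (hβ : 0 < β)
    (hu : ∫ y in cube q, young (‖f y‖ / β) ∂haarT ≤ 2 * side q) :
    ∫ y in cube q, ‖f y‖ ∂haarT ≤ 2 * β * side q := by
  calc _ ≤ ∫ y in cube q, β * young (‖f y‖ / β) ∂haarT := by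
        refine integral_mono (BddMeas.of_continuous hf.norm).integrable
          (BddMeas.of_continuous ((continuous_young_norm_div hf hβ).const_mul β)).integrable
          fun y => norm_le_mul_young hβ _
    _ = β * ∫ y in cube q, young (‖f y‖ / β) ∂haarT := integral_const_mul _ _
    _ ≤ β * (2 * side q) := by gcongr
    _ = _ := by ring

lemma norm_arcAvg_le (hf : Continuous f) (hβ : 0 < β)
    (hu : ∫ y in cube q, young (‖f y‖ / β) ∂haarT ≤ 2 * side q) : ‖arcAvg f q‖ ≤ 2 * β := by
  have hs := side_pos q
  rw [arcAvg, norm_div, Complex.norm_real, Real.norm_of_nonneg hs.le, div_le_iff₀ hs]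
  exact (norm_integral_le_integral_norm _).trans (setIntegral_norm_le hf hβ hu)

lemma bddMeas_atomPart (hf : Continuous f) (q : ℕ × ℕ) : BddMeas (atomPart f q) :=
  ((BddMeas.of_continuous hf).sub (BddMeas.const _)).indicator (measurableSet_cube q)

lemma isAtom_atomPart (hf : Continuous f) (hβ : 0 < β) (hq : q.2 < 2 ^ q.1)
    (hu : ∫ y in cube q, young (‖f y‖ / β) ∂haarT ≤ 2 * side q) :
    IsAtom q (fun y => ‖f y‖ / β) β (atomPart f q) where
  idx_lt := hq
  continuous_weight := hf.norm.div_const β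
  weight_nonneg x := by positivity
  young_le := hu
  height_nonneg := hβ.le
  bddMeas := bddMeas_atomPart hf q
  eq_zero y hy := Set.indicator_of_notMem hy _
  integral_eq_zero := by
    have hs : (side q : ℂ) ≠ 0 := by exact_mod_cast (side_pos q).ne'
    rw [atomPart, integral_indicator (measurableSet_cube q),
      integral_sub (BddMeas.of_continuous hf).integrable (BddMeas.const _).integrable,
      setIntegral_const, haarT_cube hq, arcAvg, Complex.real_smul]
    field_simp
    ring
  integral_norm_le := by
    have e : ∀ y, ‖atomPart f q y‖ = (cube q).indicator (fun y => ‖f y - arcAvg f q‖) y := by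
      intro y
      by_cases hy : y ∈ cube q <;> simp [atomPart, hy]
    simp only [e]
    rw [integral_indicator (measurableSet_cube q)]
    have hA := norm_arcAvg_le hf hβ hu
    have hs := side_pos q
    calc _ ≤ ∫ y in cube q, (‖f y‖ + ‖arcAvg f q‖) ∂haarT :=
          integral_mono ((BddMeas.of_continuous hf).sub (BddMeas.const _)).norm.integrable
            ((BddMeas.of_continuous hf.norm).add (BddMeas.const _)).integrable
            fun y => norm_sub_le _ _
      _ = ∫ y in cube q, ‖f y‖ ∂haarT + side q * ‖arcAvg f q‖ := by
          rw [integral_add (BddMeas.of_continuous hf.norm).integrable (BddMeas.const _).integrable,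
            setIntegral_const, haarT_cube hq, smul_eq_mul]
      _ ≤ 2 * β * side q + side q * (2 * β) := by
          gcongr
          exact setIntegral_norm_le hf hβ hu
      _ = _ := by ring
  norm_le y hy := by
    rw [atomPart, Set.indicator_of_mem hy]
    calc _ ≤ ‖f y‖ + ‖arcAvg f q‖ := norm_sub_le _ _
      _ ≤ ‖f y‖ + 2 * β := by gcongr; exact norm_arcAvg_le hf hβ hu
      _ = _ := by field_simp

end decomposition

/-- Weak-type estimate for the square function of the smoothed frequency projections. -/
theorem mul_measureReal_lt_l2norm_le {r : ℝ} (h0 : 0 ≤ r) (h1 : r < 1) {A : ℕ → ℕ} {M : ℕ}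
    (hA : Doubling A M) {f : Tor → ℂ} (hf : Continuous f) (n : ℕ) {α : ℝ} (hα : 0 < α) :
    α * haarT.real
        {x | α < l2norm n fun j => shiftOp r (A j) f x - shiftOp r (A (j + 1)) f x} ≤
      600000000 * √M * (1 + ∫ x, young ‖f x‖ ∂haarT) := by
  have hM : (1 : ℝ) ≤ M := by exact_mod_cast hA.pos
  have hsM : (1 : ℝ) ≤ √M := Real.one_le_sqrt.2 hM
  set Y := ∫ x, young ‖f x‖ ∂haarT with hY
  have hyc : Continuous fun x => young ‖f x‖ := continuous_young_comp hf.norm fun _ => norm_nonneg _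
  have hY0 : 0 ≤ Y := integral_nonneg fun x => young_nonneg (norm_nonneg _)
  obtain ⟨β, rfl⟩ : ∃ β, α = √M * β := ⟨α / √M, by field_simp⟩
  have hβ : 0 < β := pos_of_mul_pos_right hα (by positivity)
  by_cases htriv : β < 1 + Y
  · calc _ ≤ √M * β * 1 := by gcongr; exact measureReal_le_one
      _ ≤ √M * (1 + Y) := by rw [mul_one]; gcongr
      _ ≤ _ := by nlinarith [mul_nonneg (zero_le_one.trans hsM) (by linarith : 0 ≤ 1 + Y)]
  have hβ1 : 1 ≤ β := by linarith
  have hβY : Y ≤ β := by linarith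
  set u : Tor → ℝ := fun y => young (‖f y‖ / β) with hu
  have huc : Continuous u := continuous_young_norm_div hf hβ
  have hu0 : ∀ x, 0 ≤ u x := fun x => young_nonneg (by positivity)
  have huY : ∫ x, u x ∂haarT ≤ Y / β := by
    rw [hY, ← integral_div]
    exact integral_mono (BddMeas.of_continuous huc).integrable
      (BddMeas.of_continuous (hyc.div_const β)).integrable
      fun x => young_div_le (norm_nonneg _) hβ1
  obtain ⟨S, hi, hd, hS, hout⟩ := exists_calderon_zygmund huc hu0
    (huY.trans ((div_le_one hβ).2 hβY))
  have hb : ∀ q ∈ S, IsAtom q (fun y => ‖f y‖ / β) β (atomPart f q) := fun q hq =>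
    isAtom_atomPart hf hβ (hi q hq) (hS q hq).2
  have hL : ∑ q ∈ S, side q ≤ Y / β := by
    calc _ ≤ ∑ q ∈ S, ∫ x in cube q, u x ∂haarT := Finset.sum_le_sum fun q hq => (hS q hq).1
      _ = ∫ x in ⋃ q ∈ S, cube q, u x ∂haarT := by
          refine (integral_biUnion_finset S (fun q _ => measurableSet_cube q) ?_
            fun q _ => (BddMeas.of_continuous huc).integrable).symm
          intro q hq q' hq' hne
          exact Set.disjoint_left.2 fun x hx hx' => hne (hd x q hq q' hq' hx hx')
      _ ≤ ∫ x, u x ∂haarT :=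
          setIntegral_le_integral (BddMeas.of_continuous huc).integrable
            (Filter.Eventually.of_forall hu0)
      _ ≤ _ := huY
  set g : Tor → ℂ := fun x => f x - ∑ q ∈ S, atomPart f q x with hg
  have hgm : BddMeas g :=
    (BddMeas.of_continuous hf).sub (BddMeas.sum _ fun q _ => bddMeas_atomPart hf q)
  have hgb : ∀ x, ‖g x‖ ≤ 2 * β := by
    intro x
    by_cases hx : ∃ q ∈ S, x ∈ cube q
    · obtain ⟨q, hq, hxq⟩ := hx
      have : g x = arcAvg f q := by
        simp only [hg, atomPart]
        rw [sum_indicator_eq_single hd (fun q y => f y - arcAvg f q) hq hxq]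
        ring
      rw [this]
      exact norm_arcAvg_le hf hβ (hS q hq).2
    · push Not at hx
      have : g x = f x := by
        simp only [hg]
        rw [Finset.sum_eq_zero fun q hq => (hb q hq).eq_zero x (hx q hq), sub_zero]
      rw [this]
      have := hout x hx
      exact (norm_le_mul_young hβ _).trans (by rw [mul_comm 2 β]; gcongr)
  have hgI : ∫ x, ‖g x‖ ∂haarT ≤ 5 * Y := by
    calc _ ≤ ∫ x, (‖f x‖ + ∑ q ∈ S, ‖atomPart f q x‖) ∂haarT := by
          refine integral_mono hgm.norm.integrable ((BddMeas.of_continuous hf.norm).add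
            (BddMeas.sum _ fun q _ => (bddMeas_atomPart hf q).norm)).integrable fun x => ?_
          exact (norm_sub_le _ _).trans (by gcongr; exact norm_sum_le _ _)
      _ = ∫ x, ‖f x‖ ∂haarT + ∑ q ∈ S, ∫ x, ‖atomPart f q x‖ ∂haarT := by
          rw [integral_add (BddMeas.of_continuous hf.norm).integrable
            (BddMeas.sum _ fun q _ => (bddMeas_atomPart hf q).norm).integrable,
            integral_finsetSum _ fun q _ => (bddMeas_atomPart hf q).norm.integrable]
      _ ≤ Y + ∑ q ∈ S, 4 * β * side q := by
          gcongr with q hq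
          · exact integral_mono (BddMeas.of_continuous hf.norm).integrable
              (BddMeas.of_continuous hyc).integrable fun x => le_young (norm_nonneg _)
          · exact (hb q hq).integral_norm_le
      _ ≤ Y + 4 * β * (Y / β) := by rw [← Finset.mul_sum]; gcongr
      _ = _ := by field_simp; ring
  have hg2 : ∫ x, ‖g x‖ ^ 2 ∂haarT ≤ 10 * β * Y := by
    calc _ ≤ ∫ x, 2 * β * ‖g x‖ ∂haarT := by
          refine integral_mono hgm.sq_norm.integrable (hgm.norm.integrable.const_mul _) fun x => ?_
          have := hgb x
          dsimp only
          nlinarith [norm_nonneg (g x)]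
      _ = 2 * β * ∫ x, ‖g x‖ ∂haarT := integral_const_mul _ _
      _ ≤ 2 * β * (5 * Y) := by gcongr
      _ = _ := by ring
  have hmain := measureReal_lt_l2norm_shiftOp_sub_le h0 h1 hd hb hA hβ hgm
    (fun x => (sub_add_cancel (f x) _).symm) n
  have hfin : 18 * (∫ x, ‖g x‖ ^ 2 ∂haarT) / β ^ 2 + 590000000 * ∑ q ∈ S, side q ≤
      600000000 * (Y / β) := by
    have h : 18 * (∫ x, ‖g x‖ ^ 2 ∂haarT) / β ^ 2 ≤ 180 * (Y / β) := by
      calc _ ≤ 18 * (10 * β * Y) / β ^ 2 := by gcongr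
        _ = _ := by field_simp; ring
    have : 0 ≤ Y / β := by positivity
    linarith
  calc _ ≤ √M * β * (600000000 * (Y / β)) := by gcongr; exact hmain.trans hfin
    _ = 600000000 * √M * Y := by field_simp
    _ ≤ _ := by gcongr; linarith

/-- The smoothed projection of `∑ i ∈ s, c i * fourier (k i)` to the frequencies in
`[A j, A (j + 1))`; for `r = 1` it is the sharp projection. -/
def band (r : ℝ) (s : Finset ℤ) (c : ℤ → ℂ) (k : ℤ → ℤ) (A : ℕ → ℕ) (j : ℕ) (x : Tor) : ℂ :=
  ∑ i ∈ s, c i * (abelMult r (k i - A j) - abelMult r (k i - A (j + 1)) : ℝ) * fourier (k i) x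

section band
variable {r : ℝ} {s : Finset ℤ} {c : ℤ → ℂ} {k : ℤ → ℤ} {A : ℕ → ℕ}

lemma shiftOp_sub_eq_band (h0 : 0 ≤ r) (h1 : r < 1) (j : ℕ) (x : Tor) :
    shiftOp r (A j) (fun y => ∑ i ∈ s, c i * fourier (k i) y) x -
      shiftOp r (A (j + 1)) (fun y => ∑ i ∈ s, c i * fourier (k i) y) x = band r s c k A j x := by
  have h : ∀ i ∈ s, BddMeas fun y : Tor => c i * fourier (k i) y := fun i _ =>
    (BddMeas.const (c i)).mul (bddMeas_fourier (k i))
  rw [shiftOp_sum h0 h1 _ _ h, shiftOp_sum h0 h1 _ _ h, ← Finset.sum_sub_distrib]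
  refine Finset.sum_congr rfl fun i _ => ?_
  rw [shiftOp_const_mul, shiftOp_const_mul, shiftOp_fourier h0 h1, shiftOp_fourier h0 h1]
  push_cast
  ring

lemma continuous_abelMult (n : ℤ) : Continuous fun r => abelMult r n := by
  unfold abelMult
  split_ifs <;> fun_prop

lemma exists_l2norm_band_sub_le (s : Finset ℤ) (c : ℤ → ℂ) (k : ℤ → ℤ) (A : ℕ → ℕ) (n : ℕ) {ε : ℝ}
    (hε : 0 < ε) : ∃ r, 0 ≤ r ∧ r < 1 ∧
      ∀ x, l2norm n (fun j => band 1 s c k A j x - band r s c k A j x) ≤ ε := by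
  set w : ℝ → ℤ → ℕ → ℝ := fun r i j =>
    abelMult r (k i - A j) - abelMult r (k i - A (j + 1)) with hw
  set D : ℝ → ℝ := fun r => √(∑ j ∈ Finset.range n, (∑ i ∈ s, ‖c i‖ * |w 1 i j - w r i j|) ^ 2)
    with hD
  have hwc : ∀ i j, Continuous fun r => w r i j := fun i j =>
    (continuous_abelMult _).sub (continuous_abelMult _)
  have hc : Continuous D := by
    refine Real.continuous_sqrt.comp (continuous_finsetSum _ fun j _ => Continuous.pow
      (continuous_finsetSum _ fun i _ => continuous_const.mul ?_) 2)
    exact (continuous_const.sub (hwc i j)).abs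
  have hD1 : D 1 = 0 := by simp [hD]
  have hev : ∀ᶠ r in nhdsWithin 1 (Set.Iio 1), D r < ε :=
    (hc.tendsto' 1 0 hD1).mono_left nhdsWithin_le_nhds |>.eventually_lt_const hε
  have h01 : ∀ᶠ r : ℝ in nhdsWithin 1 (Set.Iio 1), r ∈ Set.Ico (0 : ℝ) 1 :=
    Ico_mem_nhdsLT zero_lt_one
  obtain ⟨r, hr, h0, h1⟩ := (hev.and h01).exists
  refine ⟨r, h0, h1, fun x => le_trans (Real.sqrt_le_sqrt ?_) hr.le⟩
  refine Finset.sum_le_sum fun j _ => ?_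
  gcongr
  simp only [band]
  rw [← Finset.sum_sub_distrib]
  refine (norm_sum_le _ _).trans (Finset.sum_le_sum fun i _ => le_of_eq ?_)
  rw [← sub_mul, ← mul_sub, norm_mul, norm_mul, norm_fourier_apply, mul_one, ← Complex.ofReal_sub,
    Complex.norm_real, Real.norm_eq_abs]

/-- Weak-type estimate for the square function of the sharp one-sided frequency projections. -/
theorem mul_measureReal_lt_l2norm_band_le {M : ℕ} (hA : Doubling A M) (s : Finset ℤ) (c : ℤ → ℂ)
    (k : ℤ → ℤ) (n : ℕ) {α : ℝ} (hα : 0 < α) :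
    α * haarT.real {x | α < l2norm n fun j => band 1 s c k A j x} ≤
      600000000 * √M * (1 + ∫ x, young ‖∑ i ∈ s, c i * fourier (k i) x‖ ∂haarT) := by
  set f : Tor → ℂ := fun x => ∑ i ∈ s, c i * fourier (k i) x with hf
  have hfc : Continuous f := continuous_finsetSum _ fun i _ => continuous_const.mul (by fun_prop)
  set m := haarT.real {x | α < l2norm n fun j => band 1 s c k A j x} with hm
  have hm1 : m ≤ 1 := measureReal_le_one
  refine le_of_forall_pos_le_add fun ε hε => ?_
  set δ := min ε (α / 2) with hδ
  have hδ0 : 0 < δ := lt_min hε (by linarith)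
  have hδα : δ ≤ α / 2 := min_le_right _ _
  have hδε : δ ≤ ε := min_le_left _ _
  obtain ⟨r, h0, h1, hr⟩ := exists_l2norm_band_sub_le s c k A n hδ0
  have hle : m ≤ haarT.real
      {x | α - δ < l2norm n fun j => shiftOp r (A j) f x - shiftOp r (A (j + 1)) f x} := by
    refine measureReal_mono fun x hx => ?_
    have hx : α < l2norm n fun j => band 1 s c k A j x := hx
    change α - δ < _
    simp only [hf, shiftOp_sub_eq_band h0 h1]
    have h := l2norm_add_le n (fun j => band 1 s c k A j x - band r s c k A j x)
      (fun j => band r s c k A j x)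
    simp only [sub_add_cancel] at h
    linarith [hr x]
  have h := mul_measureReal_lt_l2norm_le h0 h1 hA hfc n (by linarith : 0 < α - δ)
  have h2 : (α - δ) * m ≤ _ := (mul_le_mul_of_nonneg_left hle (by linarith)).trans h
  have h3 : δ * m ≤ ε := by
    calc δ * m ≤ δ * 1 := by gcongr
      _ ≤ ε := by linarith
  linarith

end band

/-- A sequence preceded by `0`. -/
def consZero (Λ : ℕ → ℕ) : ℕ → ℕ
  | 0 => 0
  | j + 1 => Λ j

lemma ratio_mul_le {Λ : ℕ → ℕ} (hpos : ∀ j, 0 < Λ j) (j : ℕ) : ratio Λ * Λ j ≤ Λ (j + 1) := by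
  have h : (0 : ℝ) < Λ j := by exact_mod_cast hpos j
  rw [← le_div_iff₀ h]
  exact ciInf_le ⟨0, by rintro _ ⟨i, rfl⟩; positivity⟩ j

lemma exists_doubling {Λ : ℕ → ℕ} (hΛ : StrictMono Λ) (hpos : 0 < Λ 0) (h1 : 1 < ratio Λ)
    (h2 : ratio Λ < 2) : ∃ M : ℕ, Doubling (consZero Λ) M ∧ (M : ℝ) ≤ 2 / (ratio Λ - 1) := by
  have hp : ∀ j, 0 < Λ j := fun j => hpos.trans_le (hΛ.monotone (Nat.zero_le j))
  have hr : 0 < ratio Λ - 1 := by linarith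
  have hr1 : 1 ≤ 1 / (ratio Λ - 1) := by rw [le_div_iff₀ hr]; linarith
  have hpow : ∀ j m, ratio Λ ^ m * Λ j ≤ Λ (j + m) := by
    intro j m
    induction m with
    | zero => simp
    | succ m ih =>
      calc _ = ratio Λ * (ratio Λ ^ m * Λ j) := by ring
        _ ≤ ratio Λ * Λ (j + m) := by gcongr
        _ ≤ _ := ratio_mul_le hp (j + m)
  refine ⟨⌈1 / (ratio Λ - 1)⌉₊, ⟨?_, Nat.ceil_pos.2 (by linarith), ?_⟩, ?_⟩
  · refine monotone_nat_of_le_succ fun j => ?_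
    cases j with
    | zero => exact Nat.zero_le _
    | succ j => exact hΛ.monotone (Nat.le_succ j)
  · intro j
    cases j with
    | zero => exact Nat.zero_le _
    | succ j =>
      set M := ⌈1 / (ratio Λ - 1)⌉₊ with hM
      have e : j + 1 + M = (j + M) + 1 := by omega
      rw [e]
      change 2 * Λ j ≤ Λ (j + M)
      have hc : 1 / (ratio Λ - 1) ≤ M := Nat.le_ceil _
      rw [div_le_iff₀ hr] at hc
      have hb := one_add_mul_le_pow (by linarith : (-2 : ℝ) ≤ ratio Λ - 1) M
      rw [add_sub_cancel] at hb
      have h3 : (2 : ℝ) ≤ ratio Λ ^ M := by linarith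
      have : (2 : ℝ) * Λ j ≤ Λ (j + M) := le_trans (by gcongr) (hpow j M)
      exact_mod_cast this
  · have := Nat.ceil_lt_add_one (by linarith : 0 ≤ 1 / (ratio Λ - 1))
    have e : 2 / (ratio Λ - 1) = 1 / (ratio Λ - 1) + 1 / (ratio Λ - 1) := by ring
    linarith

section projection
variable {Λ : ℕ → ℕ} {s : Finset ℤ} {c : ℤ → ℂ}

lemma fourierCoeff_trigPoly (s : Finset ℤ) (c : ℤ → ℂ) (m : ℤ) :
    fourierCoeff (fun x : Tor => ∑ n ∈ s, c n * fourier n x) m = if m ∈ s then c m else 0 := by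
  rw [fourierCoeff_haarT]
  have e : ∀ y : Tor, fourier (-m) y * ∑ n ∈ s, c n * fourier n y =
      ∑ n ∈ s, c n * fourier (n - m) y := by
    intro y
    rw [Finset.mul_sum]
    refine Finset.sum_congr rfl fun n _ => ?_
    rw [sub_eq_neg_add, fourier_add]
    ring
  simp only [e]
  rw [integral_finsetSum _ fun n _ => ((BddMeas.const (c n)).mul (bddMeas_fourier _)).integrable]
  simp only [integral_const_mul, integral_fourier, sub_eq_zero, mul_ite, mul_one, mul_zero,
    Finset.sum_ite_eq']

lemma LPproj_eq (hΛ : StrictMono Λ) (hpos : 0 < Λ 0) (s : Finset ℤ) (c : ℤ → ℂ) (j : ℕ) (x : Tor) :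
    LPproj Λ j (fun x => ∑ n ∈ s, c n * fourier n x) x =
      ∑ n ∈ s, if consZero Λ j ≤ |n| ∧ |n| < consZero Λ (j + 1) then c n * fourier n x else 0 := by
  have h : ∀ I : Finset ℤ, (∀ n, n ∈ I ↔ consZero Λ j ≤ |n| ∧ |n| < consZero Λ (j + 1)) →
      ∑ n ∈ I, fourierCoeff (fun x : Tor => ∑ n ∈ s, c n * fourier n x) n * fourier n x =
      ∑ n ∈ s, if consZero Λ j ≤ |n| ∧ |n| < consZero Λ (j + 1) then c n * fourier n x else 0 := by
    intro I hI
    simp only [fourierCoeff_trigPoly, ← hI, ite_mul, zero_mul]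
    rw [Finset.sum_ite_mem, Finset.sum_ite_mem, Finset.inter_comm]
  cases j with
  | zero =>
    rw [LPproj, if_pos rfl]
    refine h _ fun n => ?_
    simp only [consZero, Finset.mem_Ioo, ← abs_lt]
    simp
  | succ j =>
    rw [LPproj, if_neg (Nat.succ_ne_zero j)]
    refine h _ fun n => ?_
    simp only [consZero, Finset.mem_union, Finset.mem_Ico, Finset.mem_Ioc, Nat.add_sub_cancel]
    have hp : (0 : ℤ) < Λ j := by exact_mod_cast hpos.trans_le (hΛ.monotone (Nat.zero_le j))
    rcases abs_cases n with ⟨h, _⟩ | ⟨h, _⟩ <;> rw [h] <;> omega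

lemma abelMult_one (n : ℤ) : abelMult 1 n = if 0 ≤ n then 1 else 0 := by
  simp [abelMult]

lemma LPproj_eq_band (hΛ : StrictMono Λ) (hpos : 0 < Λ 0) (s : Finset ℤ) (c : ℤ → ℂ) (j : ℕ)
    (x : Tor) :
    LPproj Λ j (fun x => ∑ n ∈ s, c n * fourier n x) x =
      band 1 s c id (consZero Λ) j x +
        (starRingEnd ℂ) (band 1 s (fun n => (starRingEnd ℂ) (c n)) (fun n => -n) (consZero Λ) j x) +
        if j = 0 then -fourierCoeff (fun x : Tor => ∑ n ∈ s, c n * fourier n x) 0 else 0 := by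
  have e : (if j = 0 then -fourierCoeff (fun x : Tor => ∑ n ∈ s, c n * fourier n x) 0 else 0) =
      ∑ n ∈ s, if n = 0 then (if j = 0 then -c n else 0) else 0 := by
    rw [fourierCoeff_trigPoly, Finset.sum_ite_eq']
    split_ifs <;> simp
  rw [LPproj_eq hΛ hpos, e, band, band, map_sum, ← Finset.sum_add_distrib, ← Finset.sum_add_distrib]
  refine Finset.sum_congr rfl fun n _ => ?_
  have hc : (starRingEnd ℂ) (fourier (-n) x) = fourier n x := by
    rw [fourier_neg, Complex.conj_conj]
  have hm : consZero Λ j < consZero Λ (j + 1) := by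
    cases j with
    | zero => exact hpos
    | succ j => exact hΛ (Nat.lt_succ_self j)
  have hj : j = 0 ↔ consZero Λ j = 0 := by
    cases j with
    | zero => simp [consZero]
    | succ j =>
      have : Λ 0 ≤ Λ j := hΛ.monotone (Nat.zero_le j)
      simp only [consZero]
      omega
  simp only [abelMult_one, map_mul, hc, Complex.conj_conj, Complex.conj_ofReal, id, hj]
  generalize consZero Λ j = a at *
  generalize consZero Λ (j + 1) = b at *
  have key : ∀ z : ℂ, z = fourier n x → (n = 0 → z = 1) →
      (if (a : ℤ) ≤ |n| ∧ |n| < b then c n * z else 0) =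
      c n * (((if 0 ≤ n - a then 1 else 0) - (if 0 ≤ n - b then 1 else 0) : ℝ) : ℂ) * z +
      c n * (((if 0 ≤ -n - a then 1 else 0) - (if 0 ≤ -n - b then 1 else 0) : ℝ) : ℂ) * z +
      if n = 0 then (if a = 0 then -c n else 0) else 0 := by
    intro z _ hz
    rcases lt_trichotomy n 0 with h | h | h
    · rw [abs_of_neg h]
      split_ifs <;> first | (exfalso; omega) | simp
    · rw [hz h, h]
      simp only [abs_zero]
      split_ifs <;> first | (exfalso; omega) | simp
    · rw [abs_of_pos h]
      split_ifs <;> first | (exfalso; omega) | simp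
  exact key _ rfl fun h => by rw [h]; simp

lemma LPsq_eq (hΛ : StrictMono Λ) (hpos : 0 < Λ 0) (s : Finset ℤ) (c : ℤ → ℂ) : ∃ N, ∀ x,
    LPsq Λ (fun x => ∑ n ∈ s, c n * fourier n x) x =
      l2norm N fun j => LPproj Λ j (fun x => ∑ n ∈ s, c n * fourier n x) x := by
  obtain ⟨B, hB⟩ : ∃ B : ℕ, ∀ n ∈ s, |n| < B := by
    refine ⟨∑ n ∈ s, n.natAbs + 1, fun n hn => ?_⟩
    have : n.natAbs ≤ ∑ n ∈ s, n.natAbs :=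
      Finset.single_le_sum (f := fun n : ℤ => n.natAbs) (fun _ _ => Nat.zero_le _) hn
    rw [Int.abs_eq_natAbs]
    omega
  refine ⟨B + 1, fun x => ?_⟩
  rw [LPsq, l2norm]
  congr 1
  refine tsum_eq_sum fun j hj => ?_
  have hj' : B + 1 ≤ j := not_lt.1 fun h => hj (Finset.mem_range.2 h)
  rw [LPproj_eq hΛ hpos, Finset.sum_eq_zero, norm_zero, zero_pow two_ne_zero]
  intro n hn
  refine if_neg fun h => ?_
  obtain ⟨i, rfl⟩ : ∃ i, j = i + 1 := ⟨j - 1, by omega⟩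
  have h1 : i ≤ Λ i := hΛ.id_le i
  have h2 := hB n hn
  have h3 := h.1
  simp only [consZero] at h3
  omega

lemma l2norm_conj (n : ℕ) (u : ℕ → ℂ) : l2norm n (fun j => (starRingEnd ℂ) (u j)) = l2norm n u := by
  simp [l2norm]

lemma l2norm_ite_zero_le (n : ℕ) (z : ℂ) : l2norm n (fun j => if j = 0 then z else 0) ≤ ‖z‖ := by
  refine Real.sqrt_le_iff.2 ⟨norm_nonneg _, ?_⟩
  have e : ∀ j, ‖(if j = 0 then z else 0)‖ ^ 2 = if j = 0 then ‖z‖ ^ 2 else 0 := by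
    intro j; split_ifs <;> simp
  simp only [e, Finset.sum_ite_eq']
  split_ifs <;> simp

lemma norm_fourierCoeff_le_integral (f : Tor → ℂ) (n : ℤ) :
    ‖fourierCoeff f n‖ ≤ ∫ x, ‖f x‖ ∂haarT := by
  rw [fourierCoeff_haarT]
  refine (norm_integral_le_integral_norm _).trans (le_of_eq ?_)
  simp only [norm_mul, norm_fourier_apply, one_mul]

/-- Weak-type estimate for the Littlewood–Paley square function, in terms of a doubling
parameter of the sequence. -/
theorem mul_measureReal_lt_LPsq_le (hΛ : StrictMono Λ) (hpos : 0 < Λ 0) {M : ℕ}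
    (hA : Doubling (consZero Λ) M) (s : Finset ℤ) (c : ℤ → ℂ) {α : ℝ} (hα : 0 < α) :
    α * haarT.real {x | α < LPsq Λ (fun x => ∑ n ∈ s, c n * fourier n x) x} ≤
      4000000000 * √M * (1 + ∫ x, young ‖∑ n ∈ s, c n * fourier n x‖ ∂haarT) := by
  set f : Tor → ℂ := fun x => ∑ n ∈ s, c n * fourier n x with hf
  have hfc : Continuous f := continuous_finsetSum _ fun i _ => continuous_const.mul (by fun_prop)
  have hsM : (1 : ℝ) ≤ √M := Real.one_le_sqrt.2 (by exact_mod_cast hA.pos)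
  set Y := ∫ x, young ‖f x‖ ∂haarT with hY
  have hY0 : 0 ≤ Y := integral_nonneg fun x => young_nonneg (norm_nonneg _)
  obtain ⟨N, hN⟩ := LPsq_eq hΛ hpos s c
  set k := fourierCoeff f 0 with hk
  have hkY : ‖k‖ ≤ Y := (norm_fourierCoeff_le_integral f 0).trans <|
    integral_mono (BddMeas.of_continuous hfc.norm).integrable
      (BddMeas.of_continuous (continuous_young_comp hfc.norm fun _ => norm_nonneg _)).integrable
      fun x => le_young (norm_nonneg _)
  set b₁ : ℕ → Tor → ℂ := band 1 s c id (consZero Λ) with hb₁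
  set b₂ : ℕ → Tor → ℂ := band 1 s (fun n => (starRingEnd ℂ) (c n)) (fun n => -n) (consZero Λ)
    with hb₂
  have h1 := mul_measureReal_lt_l2norm_band_le hA s c id N (by positivity : 0 < α / 3)
  have h2 := mul_measureReal_lt_l2norm_band_le hA s (fun n => (starRingEnd ℂ) (c n)) (fun n => -n) N
    (by positivity : 0 < α / 3)
  have hconj : ∀ x : Tor, ‖∑ n ∈ s, (starRingEnd ℂ) (c n) * fourier (-n) x‖ = ‖f x‖ := by
    intro x
    rw [← Complex.norm_conj (f x), hf, map_sum]
    simp only [map_mul, ← fourier_neg]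
  simp only [hconj] at h2
  change _ ≤ 600000000 * √M * (1 + Y) at h1
  change _ ≤ 600000000 * √M * (1 + Y) at h2
  have h3 : α / 3 * haarT.real {_x : Tor | α / 3 < ‖k‖} ≤ Y := by
    by_cases h : α / 3 < ‖k‖
    · calc _ ≤ α / 3 * 1 := by gcongr; exact measureReal_le_one
        _ ≤ Y := by linarith
    · simpa [h] using hY0
  have hsub : {x | α < LPsq Λ f x} ⊆ ({x | α / 3 < l2norm N fun j => b₁ j x} ∪
      {x | α / 3 < l2norm N fun j => b₂ j x}) ∪ {_x : Tor | α / 3 < ‖k‖} := by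
    intro x hx
    by_contra hcon
    simp only [Set.mem_union, not_or] at hcon
    obtain ⟨⟨hx1, hx2⟩, hx3⟩ := hcon
    have hx1 : (l2norm N fun j => b₁ j x) ≤ α / 3 := not_lt.1 hx1
    have hx2 : (l2norm N fun j => b₂ j x) ≤ α / 3 := not_lt.1 hx2
    have hx3 : ‖k‖ ≤ α / 3 := not_lt.1 hx3
    have hx : α < LPsq Λ f x := hx
    rw [hf, hN] at hx
    simp only [LPproj_eq_band hΛ hpos] at hx
    have e1 := l2norm_add_le N (fun j => b₁ j x + (starRingEnd ℂ) (b₂ j x))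
      (fun j => if j = 0 then -k else 0)
    have e2 := l2norm_add_le N (fun j => b₁ j x) (fun j => (starRingEnd ℂ) (b₂ j x))
    rw [l2norm_conj] at e2
    have e3 := l2norm_ite_zero_le N (-k)
    rw [norm_neg] at e3
    have := hx.trans_le e1
    linarith
  have hle : haarT.real {x | α < LPsq Λ f x} ≤
      haarT.real {x | α / 3 < l2norm N fun j => b₁ j x} +
        haarT.real {x | α / 3 < l2norm N fun j => b₂ j x} +
        haarT.real {_x : Tor | α / 3 < ‖k‖} :=
    (measureReal_mono (μ := haarT) hsub).trans ((measureReal_union_le _ _).trans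
      (add_le_add_left (measureReal_union_le _ _) _))
  have := mul_le_mul_of_nonneg_left hle hα.le
  have hYM : Y ≤ √M * (1 + Y) := by nlinarith
  linarith

end projection

end LPWeak

/-- There is an absolute constant `C > 0` such that for every lacunary sequence `Λ` of
positive integers with ratio `ρ_Λ ∈ (1,2)` and every trigonometric polynomial `f` on `𝕋`,
`‖S^{(Λ)}(f)‖_{L^{1,∞}} ≤ C (ρ_Λ - 1)^{-1/2} [1 + (2π)^{-1}∫ |f| log^{1/2}(e + |f|)]`. -/
theorem statement9 :
    ∃ C : ℝ, 0 < C ∧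
      ∀ (Λ : ℕ → ℕ), StrictMono Λ → 0 < Λ 0 →
      1 < ratio Λ → ratio Λ < 2 →
      ∀ f : Tor → ℂ,
        (∃ (s : Finset ℤ) (c : ℤ → ℂ), f = fun x => ∑ n ∈ s, c n * fourier n x) →
        wkNorm1 (LPsq Λ f) ≤
          ENNReal.ofReal (C * (ratio Λ - 1) ^ (-(1:ℝ)/2) *
            (1 + ∫ x, ‖f x‖ * Real.sqrt (Real.log (Real.exp 1 + ‖f x‖)) ∂haarT)) := by
  refine ⟨8000000000, by norm_num, ?_⟩
  rintro Λ hΛ hpos h1 h2 _ ⟨s, c, rfl⟩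
  obtain ⟨M, hA, hM⟩ := LPWeak.exists_doubling hΛ hpos h1 h2
  have hr : 0 < ratio Λ - 1 := by linarith
  have hsM : √(M : ℝ) ≤ 2 * (ratio Λ - 1) ^ (-(1 : ℝ) / 2) := by
    rw [neg_div, Real.rpow_neg hr.le, ← Real.sqrt_eq_rpow, ← div_eq_mul_inv]
    refine Real.sqrt_le_iff.2 ⟨by positivity, hM.trans ?_⟩
    rw [div_pow, Real.sq_sqrt hr.le]
    gcongr
    norm_num
  refine iSup₂_le fun α hα => ?_
  have h := LPWeak.mul_measureReal_lt_LPsq_le hΛ hpos hA s c hα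
  rw [← ofReal_measureReal, ← ENNReal.ofReal_mul hα.le]
  refine ENNReal.ofReal_le_ofReal ?_
  have e : ∀ x, |LPsq Λ (fun x => ∑ n ∈ s, c n * fourier n x) x| =
      LPsq Λ (fun x => ∑ n ∈ s, c n * fourier n x) x := fun x => abs_of_nonneg (Real.sqrt_nonneg _)
  simp only [e]
  have hY : 0 ≤ ∫ x, LPWeak.young ‖∑ n ∈ s, c n * fourier n x‖ ∂haarT :=
    integral_nonneg fun x => LPWeak.young_nonneg (norm_nonneg _)
  refine h.trans ?_
  change _ ≤ 8000000000 * (ratio Λ - 1) ^ (-(1 : ℝ) / 2) *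
    (1 + ∫ x, LPWeak.young ‖∑ n ∈ s, c n * fourier n x‖ ∂haarT)
  exact mul_le_mul_of_nonneg_right (by linarith) (by linarith)

end
end
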